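/- Let (u_p)_{p>1} be a family of nodal solutions of (𝒫_p) satisfying condition (A). Then z_p converges in C²_loc(ℝ²), as p → +∞, to U(x) = −2·log(1 + |x|²/8); in particular U solves −ΔU = e^U on ℝ², U ≤ 0, U(0) = 0 and ∫_{ℝ²} e^U = 8π. -/

import Mathlib

open MeasureTheory Real Set Filter Topology Metric

noncomputable section

/-- The Euclidean plane. -/
abbrev R2 : Type := EuclideanSpace ℝ (Fin 2)

/-- The Laplacian: sum of the two pure second directional derivatives. -/
def lap (u : R2 → ℝ) (x : R2) : ℝ :=
  ∑ i : Fin 2,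
    fderiv ℝ (fun y => fderiv ℝ u y (EuclideanSpace.single i 1)) x (EuclideanSpace.single i 1)

/-- Each point of ∂Ω has a neighborhood in which ∂Ω is the graph of a C^∞ function
(in suitable Euclidean coordinates). -/
def SmoothBoundary (Ω : Set R2) : Prop :=
  ∀ x ∈ frontier Ω, ∃ V : Set R2, IsOpen V ∧ x ∈ V ∧
    ∃ (e : R2 ≃ᵢ R2) (g : ℝ → ℝ), ContDiff ℝ (⊤ : ℕ∞) g ∧
      frontier Ω ∩ V = {y | y ∈ V ∧ e y 1 = g (e y 0)}

/-- A (classical) solution of the Lane–Emden problem `(𝒫_p)` on Ω. -/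
def IsSolution (Ω : Set R2) (p : ℝ) (u : R2 → ℝ) : Prop :=
  ContDiffOn ℝ 2 u Ω ∧ ContDiffOn ℝ 1 u (closure Ω) ∧
  (∀ x ∈ Ω, -lap u x = |u x| ^ (p - 1) * u x) ∧
  (∀ x ∈ frontier Ω, u x = 0)

/-- A nodal (sign-changing) function on Ω. -/
def IsNodal (Ω : Set R2) (u : R2 → ℝ) : Prop :=
  (∃ x ∈ Ω, 0 < u x) ∧ ∃ x ∈ Ω, u x < 0

/-- The energy functional E_p. -/
def energy (Ω : Set R2) (p : ℝ) (u : R2 → ℝ) : ℝ :=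
  (1 / 2) * ∫ x in Ω, ‖gradient u x‖ ^ 2 - (1 / (p + 1)) * ∫ x in Ω, |u x| ^ (p + 1)

/-- Condition (A): p·∫_Ω |∇u_p|² → 16πe. -/
def CondA (Ω : Set R2) (u : ℝ → R2 → ℝ) : Prop :=
  Tendsto (fun p : ℝ => p * ∫ x in Ω, ‖gradient (u p) x‖ ^ 2) atTop
    (𝓝 (16 * π * Real.exp 1))

/-- Condition (B): p·(u_p(x_p⁺) + u_p(x_p⁻)) → K for some K ≥ 0. -/
def CondB (u : ℝ → R2 → ℝ) (xp xm : ℝ → R2) : Prop :=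
  ∃ K : ℝ, 0 ≤ K ∧ Tendsto (fun p : ℝ => p * (u p (xp p) + u p (xm p))) atTop (𝓝 K)

/-- ε_p := (p·u_p(x_p⁺)^{p−1})^{−1/2}. -/
def eps (u : ℝ → R2 → ℝ) (xp : ℝ → R2) (p : ℝ) : ℝ :=
  1 / Real.sqrt (p * u p (xp p) ^ (p - 1))

/-- The rescaling z_p of u_p around x_p⁺. -/
def zp (u : ℝ → R2 → ℝ) (xp : ℝ → R2) (p : ℝ) (x : R2) : ℝ :=
  (p / u p (xp p)) * (u p (eps u xp p • x + xp p) - u p (xp p))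

/-- The rescaling z_p⁻ of u_p around x_p⁻ (with the scale ε_p of the maximum). -/
def zm (u : ℝ → R2 → ℝ) (xp xm : ℝ → R2) (p : ℝ) (x : R2) : ℝ :=
  (p / u p (xp p)) * (-u p (eps u xp p • x + xm p) - u p (xp p))

/-- Convergence in C²_loc(ℝ²) of a family of functions f_i defined on sets D_i:
every compact set K is eventually contained in D_i, and on K all derivatives up to
order 2 converge uniformly. -/
def TendstoC2loc {ι : Type} (l : Filter ι) (D : ι → Set R2) (f : ι → R2 → ℝ)
    (g : R2 → ℝ) : Prop :=
  ∀ K : Set R2, IsCompact K →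
    (∀ᶠ i in l, K ⊆ D i) ∧
    ∀ n : ℕ, n ≤ 2 →
      TendstoUniformlyOn (fun i x => iteratedFDeriv ℝ n (f i) x)
        (fun x => iteratedFDeriv ℝ n g x) l K

/-- The standard bubble U(x) = −2 log(1 + |x|²/8). -/
def stdBubble (x : R2) : ℝ := -2 * Real.log (1 + ‖x‖ ^ 2 / 8)

/-- The bubble U_μ(x) = log(μ/(1 + μ|x|²/8)²). -/
def bubble (μ : ℝ) (x : R2) : ℝ := Real.log (μ / (1 + μ * ‖x‖ ^ 2 / 8) ^ 2)

/-- A C^∞ function compactly supported in S. -/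
def CcSmoothIn (S : Set R2) (v : R2 → ℝ) : Prop :=
  ContDiff ℝ (⊤ : ℕ∞) v ∧ HasCompactSupport v ∧ tsupport v ⊆ S

/-- The quadratic form of the linearized operator at u. -/
def Qform (p : ℝ) (u v : R2 → ℝ) : ℝ :=
  ∫ x, (‖gradient v x‖ ^ 2 - p * |u x| ^ (p - 1) * v x ^ 2)

/-- Morse index one hypothesis (M): for p large, the quadratic form of the linearized
operator is negative somewhere on C_c^∞ of the positive nodal domain, but is not
negative definite on any 2-dimensional subspace. -/
def MorseOne (Ω : Set R2) (u : ℝ → R2 → ℝ) : Prop :=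
  ∀ᶠ p : ℝ in atTop,
    (∃ v : R2 → ℝ, CcSmoothIn {x ∈ Ω | 0 < u p x} v ∧ Qform p (u p) v < 0) ∧
    ¬ ∃ v w : R2 → ℝ, CcSmoothIn {x ∈ Ω | 0 < u p x} v ∧
        CcSmoothIn {x ∈ Ω | 0 < u p x} w ∧
        LinearIndependent ℝ ![v, w] ∧
        ∀ a b : ℝ, ¬(a = 0 ∧ b = 0) →
          Qform p (u p) (fun x => a * v x + b * w x) < 0

/-- The `i`-th partial derivative. -/
def pd (i : Fin 2) (u : R2 → ℝ) (x : R2) : ℝ := fderiv ℝ u x (EuclideanSpace.single i 1)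

lemma lap_eq_pd (u : R2 → ℝ) (x : R2) : lap u x = pd 0 (pd 0 u) x + pd 1 (pd 1 u) x := by
  unfold lap pd
  rw [Fin.sum_univ_two]

lemma R2.eq_sum_single (v : R2) :
    v = v 0 • EuclideanSpace.single (0 : Fin 2) (1 : ℝ)
      + v 1 • EuclideanSpace.single (1 : Fin 2) (1 : ℝ) := by
  ext i
  fin_cases i <;> simp

lemma R2.norm_sq (v : R2) : ‖v‖ ^ 2 = v 0 ^ 2 + v 1 ^ 2 := by
  rw [EuclideanSpace.norm_sq_eq, Fin.sum_univ_two]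
  simp

lemma R2.abs_apply_le (v : R2) (i : Fin 2) : |v i| ≤ ‖v‖ := by
  simpa using PiLp.norm_apply_le v i

lemma R2.norm_single (i : Fin 2) : ‖EuclideanSpace.single i (1 : ℝ)‖ = 1 := by
  simp

section CLM
variable {F : Type*} [NormedAddCommGroup F] [NormedSpace ℝ F]

lemma R2.clm_apply (L : R2 →L[ℝ] F) (v : R2) :
    L v = v 0 • L (EuclideanSpace.single 0 1) + v 1 • L (EuclideanSpace.single 1 1) := by
  conv_lhs => rw [R2.eq_sum_single v]
  simp only [map_add, map_smul]

lemma R2.norm_clm_le (L : R2 →L[ℝ] F) :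
    ‖L‖ ≤ ‖L (EuclideanSpace.single 0 1)‖ + ‖L (EuclideanSpace.single 1 1)‖ := by
  refine L.opNorm_le_bound (by positivity) fun v => ?_
  rw [R2.clm_apply L v]
  refine (norm_add_le _ _).trans ?_
  rw [norm_smul, norm_smul, add_mul]
  have h0 := R2.abs_apply_le v 0
  have h1 := R2.abs_apply_le v 1
  rw [Real.norm_eq_abs, Real.norm_eq_abs, mul_comm _ ‖v‖, mul_comm _ ‖v‖]
  gcongr

end CLM

lemma abs_pd_le (i : Fin 2) (u : R2 → ℝ) (x : R2) : |pd i u x| ≤ ‖fderiv ℝ u x‖ := by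
  have := (fderiv ℝ u x).le_opNorm (EuclideanSpace.single i 1)
  rwa [R2.norm_single, mul_one] at this

lemma norm_fderiv_le_pd (u : R2 → ℝ) (x : R2) :
    ‖fderiv ℝ u x‖ ≤ |pd 0 u x| + |pd 1 u x| := R2.norm_clm_le _

lemma pd_congr {u v : R2 → ℝ} {x : R2} (h : u =ᶠ[𝓝 x] v) (i : Fin 2) :
    pd i u =ᶠ[𝓝 x] pd i v := by
  filter_upwards [h.eventuallyEq_nhds] with y hy
  unfold pd
  rw [hy.fderiv_eq]

lemma ContDiffAt.eventually_two {u : R2 → ℝ} {x : R2} (h : ContDiffAt ℝ 2 u x) :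
    ∀ᶠ y in 𝓝 x, ContDiffAt ℝ 2 u y := h.eventually (by simp)

lemma ContDiffAt.fderiv_one {F : Type*} [NormedAddCommGroup F] [NormedSpace ℝ F]
    {u : R2 → F} {x : R2} (h : ContDiffAt ℝ 2 u x) :
    ContDiffAt ℝ 1 (fderiv ℝ u) x :=
  h.fderiv_right (by norm_num)

lemma ContDiffAt.pd_one {u : R2 → ℝ} {x : R2} (h : ContDiffAt ℝ 2 u x) (i : Fin 2) :
    ContDiffAt ℝ 1 (pd i u) x :=
  h.fderiv_one.clm_apply contDiffAt_const

lemma ContDiffAt.pd_pd {u : R2 → ℝ} {x : R2} (h : ContDiffAt ℝ 2 u x) (i j : Fin 2) :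
    pd j (pd i u) x = fderiv ℝ (fderiv ℝ u) x (EuclideanSpace.single j 1)
      (EuclideanSpace.single i 1) := by
  have h1 : DifferentiableAt ℝ (fderiv ℝ u) x := h.fderiv_one.differentiableAt (by simp)
  have := (h1.hasFDerivAt.clm_apply (hasFDerivAt_const (EuclideanSpace.single i (1:ℝ)) x)).fderiv
  unfold pd
  rw [this]
  simp

lemma ContDiffAt.pd_comm {u : R2 → ℝ} {x : R2} (h : ContDiffAt ℝ 2 u x) (i j : Fin 2) :
    pd j (pd i u) x = pd i (pd j u) x := by
  rw [h.pd_pd, h.pd_pd]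
  exact h.isSymmSndFDerivAt (by simp) _ _

section Algebra
variable {u v : R2 → ℝ} {x : R2}

lemma pd_add (hu : DifferentiableAt ℝ u x) (hv : DifferentiableAt ℝ v x) (i : Fin 2) :
    pd i (fun y => u y + v y) x = pd i u x + pd i v x := by
  unfold pd
  rw [fderiv_fun_add hu hv]; rfl

lemma pd_sub (hu : DifferentiableAt ℝ u x) (hv : DifferentiableAt ℝ v x) (i : Fin 2) :
    pd i (fun y => u y - v y) x = pd i u x - pd i v x := by
  unfold pd
  rw [fderiv_fun_sub hu hv]; rfl

lemma pd_mul (hu : DifferentiableAt ℝ u x) (hv : DifferentiableAt ℝ v x) (i : Fin 2) :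
    pd i (fun y => u y * v y) x = u x * pd i v x + v x * pd i u x := by
  unfold pd
  rw [fderiv_fun_mul hu hv]; rfl

lemma pd_const_mul (hu : DifferentiableAt ℝ u x) (a : ℝ) (i : Fin 2) :
    pd i (fun y => a * u y) x = a * pd i u x := by
  unfold pd
  rw [fderiv_const_mul hu a]; rfl

lemma pd_comp {g : ℝ → ℝ} {g' : ℝ} (hg : HasDerivAt g g' (u x)) (hu : DifferentiableAt ℝ u x)
    (i : Fin 2) : pd i (fun y => g (u y)) x = g' * pd i u x := by
  have h : HasFDerivAt (fun y => g (u y)) (g' • fderiv ℝ u x) x :=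
    hg.comp_hasFDerivAt x hu.hasFDerivAt
  unfold pd
  rw [h.fderiv]; rfl

lemma pd_comp_affine {r : ℝ} {c : R2} (hu : DifferentiableAt ℝ u (r • x + c)) (i : Fin 2) :
    pd i (fun y => u (r • y + c)) x = r * pd i u (r • x + c) := by
  unfold pd
  have h1 : HasFDerivAt (fun y : R2 => r • y + c) (r • ContinuousLinearMap.id ℝ R2) x :=
    ((hasFDerivAt_id x).const_smul r).add_const c
  have h2 : HasFDerivAt (fun y => u (r • y + c))
      ((fderiv ℝ u (r • x + c)).comp (r • ContinuousLinearMap.id ℝ R2)) x :=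
    HasFDerivAt.comp x hu.hasFDerivAt h1
  rw [h2.fderiv]
  simp

lemma lap_add (hu : ContDiffAt ℝ 2 u x) (hv : ContDiffAt ℝ 2 v x) :
    lap (fun y => u y + v y) x = lap u x + lap v x := by
  have key : ∀ i, pd i (pd i (fun y => u y + v y)) x = pd i (pd i u) x + pd i (pd i v) x := by
    intro i
    have : pd i (fun y => u y + v y) =ᶠ[𝓝 x] fun y => pd i u y + pd i v y := by
      filter_upwards [hu.eventually_two, hv.eventually_two] with y hy hy'
      exact pd_add (hy.differentiableAt (by simp)) (hy'.differentiableAt (by simp)) i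
    rw [(pd_congr this i).eq_of_nhds]
    exact pd_add ((hu.pd_one i).differentiableAt (by simp))
      ((hv.pd_one i).differentiableAt (by simp)) i
  rw [lap_eq_pd, lap_eq_pd, lap_eq_pd, key, key]; ring

lemma lap_const_mul (hu : ContDiffAt ℝ 2 u x) (a : ℝ) :
    lap (fun y => a * u y) x = a * lap u x := by
  have key : ∀ i, pd i (pd i (fun y => a * u y)) x = a * pd i (pd i u) x := by
    intro i
    have : pd i (fun y => a * u y) =ᶠ[𝓝 x] fun y => a * pd i u y := by
      filter_upwards [hu.eventually_two] with y hy
      exact pd_const_mul (hy.differentiableAt (by simp)) a i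
    rw [(pd_congr this i).eq_of_nhds]
    exact pd_const_mul ((hu.pd_one i).differentiableAt (by simp)) a i
  rw [lap_eq_pd, lap_eq_pd, key, key]; ring

lemma lap_neg (hu : ContDiffAt ℝ 2 u x) : lap (fun y => -u y) x = -lap u x := by
  simpa using lap_const_mul hu (-1)

lemma lap_sub (hu : ContDiffAt ℝ 2 u x) (hv : ContDiffAt ℝ 2 v x) :
    lap (fun y => u y - v y) x = lap u x - lap v x := by
  simp only [sub_eq_add_neg]
  rw [lap_add hu hv.neg, lap_neg hv]

lemma pd_const (a : ℝ) (i : Fin 2) : pd i (fun _ : R2 => a) x = 0 := by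
  simp [pd]

lemma lap_const (a : ℝ) : lap (fun _ : R2 => a) x = 0 := by
  have : pd 0 (fun _ : R2 => a) = fun _ => 0 := funext fun _ => pd_const a 0
  have h' : pd 1 (fun _ : R2 => a) = fun _ => 0 := funext fun _ => pd_const a 1
  rw [lap_eq_pd, this, h', pd_const, pd_const, add_zero]

lemma lap_comp_affine {r : ℝ} {c : R2} (hu : ContDiffAt ℝ 2 u (r • x + c)) :
    lap (fun y => u (r • y + c)) x = r ^ 2 * lap u (r • x + c) := by
  have key : ∀ i, pd i (pd i (fun y => u (r • y + c))) x = r ^ 2 * pd i (pd i u) (r • x + c) := by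
    intro i
    have hc : ContinuousAt (fun y : R2 => r • y + c) x := by fun_prop
    have : pd i (fun y => u (r • y + c)) =ᶠ[𝓝 x] fun y => r * pd i u (r • y + c) := by
      filter_upwards [hc.eventually hu.eventually_two] with y hy
      exact pd_comp_affine (hy.differentiableAt (by simp)) i
    rw [(pd_congr this i).eq_of_nhds]
    have hd : DifferentiableAt ℝ (pd i u) (r • x + c) :=
      (hu.pd_one i).differentiableAt (by simp)
    have hd' : DifferentiableAt ℝ (fun y => pd i u (r • y + c)) x :=
      hd.comp x (f := fun y : R2 => r • y + c) (by fun_prop)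
    rw [pd_const_mul hd' , pd_comp_affine hd]; ring
  rw [lap_eq_pd, lap_eq_pd, key, key]; ring

lemma lap_comp {g g' : ℝ → ℝ} {g'' : ℝ} (hg : ∀ᶠ t in 𝓝 (u x), HasDerivAt g (g' t) t)
    (hg' : HasDerivAt g' g'' (u x)) (hu : ContDiffAt ℝ 2 u x) :
    lap (fun y => g (u y)) x
      = g' (u x) * lap u x + g'' * (pd 0 u x ^ 2 + pd 1 u x ^ 2) := by
  have hux : DifferentiableAt ℝ u x := hu.differentiableAt (by simp)
  have key : ∀ i, pd i (pd i (fun y => g (u y))) x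
      = g' (u x) * pd i (pd i u) x + g'' * pd i u x ^ 2 := by
    intro i
    have : pd i (fun y => g (u y)) =ᶠ[𝓝 x] fun y => g' (u y) * pd i u y := by
      filter_upwards [hu.eventually_two, hux.continuousAt.eventually hg] with y hy hgy
      exact pd_comp hgy (hy.differentiableAt (by simp)) i
    rw [(pd_congr this i).eq_of_nhds]
    have hd : DifferentiableAt ℝ (pd i u) x := (hu.pd_one i).differentiableAt (by simp)
    have hd' : DifferentiableAt ℝ (fun y => g' (u y)) x :=
      (hg'.comp_hasFDerivAt x hux.hasFDerivAt).differentiableAt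
    rw [pd_mul hd' hd, pd_comp hg' hux]; ring
  rw [lap_eq_pd, lap_eq_pd, key, key]; ring

end Algebra

lemma pd_coord (i j : Fin 2) (c x : R2) :
    pd i (fun y : R2 => y j - c j) x = if i = j then 1 else 0 := by
  unfold pd
  have : HasFDerivAt (fun y : R2 => y j - c j)
      (EuclideanSpace.proj j : R2 →L[ℝ] ℝ) x :=
    ((EuclideanSpace.proj j : R2 →L[ℝ] ℝ).hasFDerivAt).sub_const _
  rw [this.fderiv]
  simp [eq_comm]

lemma contDiff_coord (j : Fin 2) (c : R2) {n : WithTop ℕ∞} :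
    ContDiff ℝ n (fun y : R2 => y j - c j) := by
  have : ContDiff ℝ n (fun y : R2 => (EuclideanSpace.proj j : R2 →L[ℝ] ℝ) y) :=
    ContinuousLinearMap.contDiff _
  exact this.sub contDiff_const

lemma lap_coord (j : Fin 2) (c x : R2) : lap (fun y : R2 => y j - c j) x = 0 := by
  have h : ∀ i, pd i (fun y : R2 => y j - c j) = fun _ => if i = j then 1 else 0 :=
    fun i => funext fun y => pd_coord i j c y
  rw [lap_eq_pd, h, h, pd_const, pd_const, add_zero]

lemma lap_coord_sq (j : Fin 2) (c x : R2) : lap (fun y : R2 => (y j - c j) ^ 2) x = 2 := by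
  have h := lap_comp (u := fun y : R2 => y j - c j) (x := x) (g := fun t => t ^ 2)
    (g' := fun t => 2 * t) (g'' := 2)
    (Eventually.of_forall fun t => by simpa using hasDerivAt_pow 2 t)
    (by simpa using (hasDerivAt_id (x j - c j)).const_mul 2)
    (contDiff_coord j c).contDiffAt
  rw [h, lap_coord, pd_coord, pd_coord]
  fin_cases j <;> simp

lemma norm_sub_sq_eq (c x : R2) : ‖x - c‖ ^ 2 = (x 0 - c 0) ^ 2 + (x 1 - c 1) ^ 2 := by
  rw [R2.norm_sq]; simp

lemma contDiff_norm_sub_sq (c : R2) {n : WithTop ℕ∞} :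
    ContDiff ℝ n (fun y : R2 => ‖y - c‖ ^ 2) := by
  exact (contDiff_id.sub contDiff_const).norm_sq ℝ

lemma pd_norm_sub_sq (c x : R2) (i : Fin 2) :
    pd i (fun y : R2 => ‖y - c‖ ^ 2) x = 2 * (x i - c i) := by
  simp_rw [norm_sub_sq_eq]
  have hd : ∀ j, DifferentiableAt ℝ (fun y : R2 => y j - c j) x := fun j =>
    (contDiff_coord j c (n := 1)).contDiffAt.differentiableAt (by simp)
  have hd2 : ∀ j, DifferentiableAt ℝ (fun y : R2 => (y j - c j) ^ 2) x := fun j => (hd j).pow 2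
  have h2 : ∀ j : Fin 2, pd i (fun y : R2 => (y j - c j) ^ 2) x
      = 2 * (x j - c j) * pd i (fun y : R2 => y j - c j) x := fun j =>
    pd_comp (g := fun t => t ^ 2) (by simpa using hasDerivAt_pow 2 (x j - c j)) (hd j) i
  rw [pd_add (hd2 0) (hd2 1), h2, h2, pd_coord, pd_coord]
  fin_cases i <;> simp

lemma lap_norm_sub_sq (c x : R2) : lap (fun y : R2 => ‖y - c‖ ^ 2) x = 4 := by
  simp_rw [norm_sub_sq_eq]
  rw [lap_add ((contDiff_coord 0 c).pow 2).contDiffAt ((contDiff_coord 1 c).pow 2).contDiffAt,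
    lap_coord_sq, lap_coord_sq]
  norm_num

lemma lap_radial {g g' : ℝ → ℝ} {g'' : ℝ} {x : R2}
    (hg : ∀ᶠ t in 𝓝 (‖x‖ ^ 2), HasDerivAt g (g' t) t)
    (hg' : HasDerivAt g' g'' (‖x‖ ^ 2)) :
    lap (fun y => g (‖y‖ ^ 2)) x = 4 * (‖x‖ ^ 2 * g'' + g' (‖x‖ ^ 2)) := by
  have h1 := lap_norm_sub_sq 0 x
  have h2 := pd_norm_sub_sq 0 x
  have h3 := contDiff_norm_sub_sq 0 (n := 2)
  simp only [sub_zero] at h1 h2 h3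
  rw [lap_comp hg hg' h3.contDiffAt, h1, h2, h2, R2.norm_sq]
  simp; ring

lemma pd_pd_nonpos_of_isLocalMax {w : R2 → ℝ} {x : R2} (hw : ContDiffAt ℝ 2 w x)
    (hm : IsLocalMax w x) (i : Fin 2) : pd i (pd i w) x ≤ 0 := by
  by_contra! hpos
  set e : R2 := EuclideanSpace.single i 1 with he
  have hl : ∀ t : ℝ, HasDerivAt (fun t : ℝ => x + t • e) e t := fun t => by
    simpa using ((hasDerivAt_id t).smul_const e).const_add x
  have hc : Tendsto (fun t : ℝ => x + t • e) (𝓝 0) (𝓝 x) := by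
    simpa using (hl 0).continuousAt.tendsto
  have hd : ∀ᶠ t : ℝ in 𝓝 0, HasDerivAt (fun t : ℝ => w (x + t • e)) (pd i w (x + t • e)) t := by
    filter_upwards [hc.eventually hw.eventually_two] with t ht
    exact (ht.differentiableAt (by simp)).hasFDerivAt.comp_hasDerivAt t (hl t)
  have hd' : deriv (fun t : ℝ => w (x + t • e)) =ᶠ[𝓝 0] fun t => pd i w (x + t • e) := by
    filter_upwards [hd] with t ht using ht.deriv
  have hdd : HasDerivAt (fun t : ℝ => pd i w (x + t • e)) (pd i (pd i w) x) 0 := by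
    have h1 : DifferentiableAt ℝ (pd i w) (x + (0:ℝ) • e) := by
      simpa using (hw.pd_one i).differentiableAt (by simp)
    have : HasDerivAt (fun t : ℝ => pd i w (x + t • e))
        (fderiv ℝ (pd i w) (x + (0:ℝ) • e) e) 0 :=
      HasFDerivAt.comp_hasDerivAt (f := fun t : ℝ => x + t • e) (l := pd i w) (0:ℝ)
        h1.hasFDerivAt (hl 0)
    rw [zero_smul, add_zero] at this
    exact this
  have hmax : IsLocalMax (fun t : ℝ => w (x + t • e)) 0 := by
    have h2 : ∀ᶠ y in 𝓝 x, w y ≤ w x := hm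
    filter_upwards [hc.eventually h2] with t ht
    simpa using ht
  have h2 : deriv (deriv fun t : ℝ => w (x + t • e)) 0 = pd i (pd i w) x := by
    rw [hd'.deriv_eq, hdd.deriv]
  have hmin := isLocalMin_of_deriv_deriv_pos (by rw [h2]; exact hpos) hmax.deriv_eq_zero
    hd.self_of_nhds.continuousAt
  have hconst : (fun t : ℝ => w (x + t • e)) =ᶠ[𝓝 0] fun _ => w (x + (0:ℝ) • e) := by
    filter_upwards [hmax, hmin] with t h1 h2 using le_antisymm h1 h2
  rw [hconst.deriv.deriv_eq] at h2
  simp at h2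
  linarith

lemma lap_nonpos_of_isLocalMax {w : R2 → ℝ} {x : R2} (hw : ContDiffAt ℝ 2 w x)
    (hm : IsLocalMax w x) : lap w x ≤ 0 := by
  rw [lap_eq_pd]
  linarith [pd_pd_nonpos_of_isLocalMax hw hm 0, pd_pd_nonpos_of_isLocalMax hw hm 1]

/-- Weak maximum principle for subharmonic functions. -/
lemma max_principle {K O : Set R2} {w : R2 → ℝ} (hK : IsCompact K) (hO : IsOpen O) (hOK : O ⊆ K)
    (hw : ContinuousOn w K) (hC : ∀ x ∈ O, ContDiffAt ℝ 2 w x) (hl : ∀ x ∈ O, 0 ≤ lap w x)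
    (hb : ∀ x ∈ K \ O, w x ≤ 0) : ∀ x ∈ K, w x ≤ 0 := by
  intro x hx
  obtain ⟨D, hD⟩ := hK.isBounded.exists_norm_le
  have hq : ContDiff ℝ 2 (fun y : R2 => ‖y‖ ^ 2) := contDiff_norm_sq ℝ
  have key : ∀ ε > 0, w x ≤ ε * D ^ 2 := by
    intro ε hε
    set v : R2 → ℝ := fun y => w y + ε * ‖y‖ ^ 2 with hv
    have hvc : ContinuousOn v K := hw.add (by fun_prop)
    obtain ⟨z, hz, hmax⟩ := hK.exists_isMaxOn ⟨x, hx⟩ hvc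
    have hzO : z ∉ O := by
      intro hzO
      have hloc : IsLocalMax v z := by
        filter_upwards [hO.mem_nhds hzO] with y hy using hmax (hOK hy)
      have hce : ContDiffAt ℝ 2 (fun y : R2 => ε * ‖y‖ ^ 2) z := (contDiff_const.mul hq).contDiffAt
      have h1 := lap_nonpos_of_isLocalMax ((hC z hzO).add hce) hloc
      have h2 := lap_norm_sub_sq 0 z
      simp only [sub_zero] at h2
      rw [lap_add (hC z hzO) hce, lap_const_mul hq.contDiffAt, h2] at h1
      linarith [hl z hzO]
    have h1 : v x ≤ v z := hmax hx
    have h2 := hb z ⟨hz, hzO⟩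
    have h3 : ‖z‖ ^ 2 ≤ D ^ 2 := by
      have := hD z hz
      gcongr
    simp only [hv] at h1
    nlinarith [mul_le_mul_of_nonneg_left h3 hε.le, mul_nonneg hε.le (sq_nonneg ‖x‖)]
  by_contra! h
  have h3 := key (w x / (2 * (D ^ 2 + 1))) (by positivity)
  have : w x / (2 * (D ^ 2 + 1)) * D ^ 2 < w x := by
    rw [div_mul_eq_mul_div, div_lt_iff₀ (by positivity)]
    nlinarith [sq_nonneg D]
  linarith

/-- Reflection in the line `x i = c i`. -/
def reflect (c : R2) (i : Fin 2) (x : R2) : R2 :=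
  x - (2 * (x i - c i)) • EuclideanSpace.single i (1 : ℝ)

lemma reflect_apply (c : R2) (i j : Fin 2) (x : R2) :
    reflect c i x j = if j = i then 2 * c i - x i else x j := by
  simp only [reflect, PiLp.sub_apply, PiLp.smul_apply, PiLp.single_apply, smul_eq_mul]
  split_ifs with h
  · subst h; ring
  · simp

lemma norm_reflect_sub (c : R2) (i : Fin 2) (x : R2) : ‖reflect c i x - c‖ ^ 2 = ‖x - c‖ ^ 2 := by
  rw [norm_sub_sq_eq, norm_sub_sq_eq, reflect_apply, reflect_apply]
  fin_cases i <;> simp <;> ring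

lemma hasFDerivAt_reflect (c : R2) (i : Fin 2) (x : R2) :
    HasFDerivAt (reflect c i) (ContinuousLinearMap.id ℝ R2 -
      ((2 : ℝ) • (EuclideanSpace.proj i : R2 →L[ℝ] ℝ)).smulRight
        (EuclideanSpace.single i (1 : ℝ))) x := by
  have h1 : HasFDerivAt (fun y : R2 => y i - c i) (EuclideanSpace.proj i : R2 →L[ℝ] ℝ) x :=
    ((EuclideanSpace.proj i : R2 →L[ℝ] ℝ).hasFDerivAt).sub_const _
  exact (hasFDerivAt_id x).sub ((h1.const_mul 2).smul_const _)

lemma contDiff_reflect (c : R2) (i : Fin 2) : ContDiff ℝ 2 (reflect c i) :=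
  contDiff_id.sub ((contDiff_const.mul (contDiff_coord i c)).smul contDiff_const)

lemma pd_reflect {w : R2 → ℝ} {c x : R2} {i : Fin 2}
    (hw : DifferentiableAt ℝ w (reflect c i x)) (j : Fin 2) :
    pd j (fun y => w (reflect c i y)) x = (if j = i then -1 else 1) * pd j w (reflect c i x) := by
  have h : HasFDerivAt (fun y => w (reflect c i y)) _ x :=
    HasFDerivAt.comp x hw.hasFDerivAt (hasFDerivAt_reflect c i x)
  unfold pd
  rw [h.fderiv]
  by_cases hj : j = i
  · subst hj
    simp; ring
  · have : i ≠ j := fun h => hj h.symm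
    simp [hj, this]

lemma lap_reflect {w : R2 → ℝ} {c x : R2} {i : Fin 2} (hw : ContDiffAt ℝ 2 w (reflect c i x)) :
    lap (fun y => w (reflect c i y)) x = lap w (reflect c i x) := by
  have hcont : ContinuousAt (reflect c i) x := (contDiff_reflect c i).continuous.continuousAt
  have key : ∀ j, pd j (pd j (fun y => w (reflect c i y))) x
      = pd j (pd j w) (reflect c i x) := by
    intro j
    have : pd j (fun y => w (reflect c i y)) =ᶠ[𝓝 x]
        fun y => (if j = i then -1 else 1) * pd j w (reflect c i y) := by
      filter_upwards [hcont.eventually hw.eventually_two] with y hy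
      exact pd_reflect (hy.differentiableAt (by simp)) j
    have hd : DifferentiableAt ℝ (pd j w) (reflect c i x) :=
      (hw.pd_one j).differentiableAt (by simp)
    have hd' : DifferentiableAt ℝ (fun y => pd j w (reflect c i y)) x :=
      hd.comp x (hasFDerivAt_reflect c i x).differentiableAt
    rw [(pd_congr this j).eq_of_nhds, pd_const_mul hd', pd_reflect hd]
    split_ifs <;> ring
  rw [lap_eq_pd, lap_eq_pd, key, key]

/-- Comparison with a quadratic barrier after antisymmetrization. -/
lemma odd_part_le {w : R2 → ℝ} {c : R2} {d M N : ℝ} (hd : 0 < d)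
    (hC : ∀ x ∈ closedBall c (2 * d), ContDiffAt ℝ 2 w x)
    (hM : ∀ x ∈ closedBall c (2 * d), |w x| ≤ M)
    (hN : ∀ x ∈ closedBall c (2 * d), |lap w x| ≤ N) (i : Fin 2) {t : ℝ} (ht : 0 ≤ t)
    (htd : t ≤ d) :
    w (c + t • EuclideanSpace.single i 1) - w (c - t • EuclideanSpace.single i 1)
      ≤ t * (4 * M / d + N * d) := by
  set e : R2 := EuclideanSpace.single i 1 with he
  have hM0 : 0 ≤ M := (abs_nonneg _).trans (hM c (by simp; positivity))
  have hN0 : 0 ≤ N := (abs_nonneg _).trans (hN c (by simp; positivity))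
  set K : Set R2 := {x | 0 ≤ x i - c i ∧ x i - c i ≤ d ∧ ‖x - c‖ ^ 2 - (x i - c i) ^ 2 ≤ d ^ 2}
    with hKdef
  set O : Set R2 := {x | 0 < x i - c i ∧ x i - c i < d ∧ ‖x - c‖ ^ 2 - (x i - c i) ^ 2 < d ^ 2}
    with hOdef
  have hci : Continuous fun x : R2 => x i - c i := (contDiff_coord i c (n := 0)).continuous
  have hcn : Continuous fun x : R2 => ‖x - c‖ ^ 2 - (x i - c i) ^ 2 := by fun_prop
  have hKball : K ⊆ closedBall c (2 * d) := by
    intro x ⟨h1, h2, h3⟩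
    rw [mem_closedBall, dist_eq_norm]
    apply le_of_sq_le_sq _ (by positivity)
    nlinarith
  have hKr : ∀ x ∈ K, reflect c i x ∈ closedBall c (2 * d) := by
    intro x hx
    have h1 := hKball hx
    rw [mem_closedBall, dist_eq_norm] at h1 ⊢
    apply le_of_sq_le_sq _ (by positivity)
    rw [norm_reflect_sub]
    gcongr
  have hKc : IsClosed K :=
    (isClosed_le continuous_const hci).inter
      ((isClosed_le hci continuous_const).inter (isClosed_le hcn continuous_const))
  have hKcomp : IsCompact K := (isCompact_closedBall c (2 * d)).of_isClosed_subset hKc hKball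
  have hO : IsOpen O :=
    (isOpen_lt continuous_const hci).inter
      ((isOpen_lt hci continuous_const).inter (isOpen_lt hcn continuous_const))
  have hOK : O ⊆ K := fun x hx => ⟨hx.1.le, hx.2.1.le, hx.2.2.le⟩
  set a : ℝ := M / d ^ 2 with ha
  have ha0 : 0 ≤ a := by positivity
  have had : a * d ^ 2 = M := by rw [ha]; field_simp
  set ψ : R2 → ℝ := fun x => a * ‖x - c‖ ^ 2 - ((2 * a + N / 2) * (x i - c i) ^ 2
    - (2 * d * a + N / 2 * d) * (x i - c i)) with hψ
  have hn2 := contDiff_norm_sub_sq c (n := 2)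
  have hi2 := contDiff_coord i c (n := 2)
  have hψC : ContDiff ℝ 2 ψ :=
    (contDiff_const.mul hn2).sub ((contDiff_const.mul (hi2.pow 2)).sub (contDiff_const.mul hi2))
  have hψl : ∀ x, lap ψ x = -N := by
    intro x
    rw [hψ, lap_sub (contDiff_const.mul hn2).contDiffAt
      ((contDiff_const.mul (hi2.pow 2)).sub (contDiff_const.mul hi2)).contDiffAt,
      lap_sub (contDiff_const.mul (hi2.pow 2)).contDiffAt (contDiff_const.mul hi2).contDiffAt,
      lap_const_mul hn2.contDiffAt, lap_const_mul (hi2.pow 2).contDiffAt,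
      lap_const_mul hi2.contDiffAt, lap_norm_sub_sq, lap_coord_sq, lap_coord]
    ring
  have hCr : ∀ x ∈ K, ContDiffAt ℝ 2 (fun y => w (reflect c i y)) x := fun x hx =>
    (hC _ (hKr x hx)).comp x (contDiff_reflect c i).contDiffAt
  set v : R2 → ℝ := fun x => (w x - w (reflect c i x)) - 2 * ψ x with hv
  have hvC : ∀ x ∈ K, ContDiffAt ℝ 2 v x := fun x hx =>
    ((hC x (hKball hx)).sub (hCr x hx)).sub (contDiff_const.mul hψC).contDiffAt
  have hvl : ∀ x ∈ O, 0 ≤ lap v x := by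
    intro x hx
    have hxK := hOK hx
    rw [hv, lap_sub ((hC x (hKball hxK)).sub (hCr x hxK)) (contDiff_const.mul hψC).contDiffAt,
      lap_sub (hC x (hKball hxK)) (hCr x hxK), lap_const_mul hψC.contDiffAt, hψl,
      lap_reflect (hC _ (hKr x hxK))]
    have h1 := abs_le.1 (hN x (hKball hxK))
    have h2 := abs_le.1 (hN _ (hKr x hxK))
    linarith
  have hvb : ∀ x ∈ K \ O, v x ≤ 0 := by
    rintro x ⟨hxK, hxO⟩
    have h1 := abs_le.1 (hM x (hKball hxK))
    have h2 := abs_le.1 (hM _ (hKr x hxK))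
    obtain ⟨k1, k2, k3⟩ := hxK
    have hge : (x i - c i) ^ 2 ≤ ‖x - c‖ ^ 2 := by
      rw [norm_sub_sq_eq]; fin_cases i <;> simp <;> positivity
    simp only [hv, hψ]
    set X := x i - c i
    set Y := ‖x - c‖ ^ 2 - X ^ 2 with hY
    have hYX : ‖x - c‖ ^ 2 = Y + X ^ 2 := by rw [hY]; ring
    have hY0 : 0 ≤ Y := by linarith
    rw [hYX]
    have hid : a * (Y + X ^ 2) - ((2 * a + N / 2) * X ^ 2 - (2 * d * a + N / 2 * d) * X)
        = a * Y + a * (X * (2 * d - X)) + N / 2 * (X * (d - X)) := by ring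
    rw [hid]
    have p1 : 0 ≤ N / 2 * (X * (d - X)) :=
      mul_nonneg (by positivity) (mul_nonneg k1 (by linarith))
    have p2 : 0 ≤ a * (X * (2 * d - X)) := mul_nonneg ha0 (mul_nonneg k1 (by linarith))
    have p3 : 0 ≤ a * Y := mul_nonneg ha0 hY0
    rcases k1.eq_or_lt with h0 | h0
    · have : reflect c i x = x := by
        have : x i - c i = 0 := h0.symm
        simp [reflect, this]
      rw [this]
      linarith
    rcases k2.eq_or_lt with hd' | hd'
    · have : a * (X * (2 * d - X)) = M := by rw [hd', ← had]; ring
      linarith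
    · have : Y = d ^ 2 := by
        by_contra hne
        exact hxO ⟨h0, hd', lt_of_le_of_ne k3 hne⟩
      have : a * Y = M := by rw [this, had]
      linarith
  have hfin := max_principle hKcomp hO hOK (fun x hx => (hvC x hx).continuousAt.continuousWithinAt)
    (fun x hx => hvC x (hOK hx)) hvl hvb (c + t • e)
  have hti : (c + t • e) i - c i = t := by simp [he]
  have htn : ‖c + t • e - c‖ ^ 2 = t ^ 2 := by
    rw [add_sub_cancel_left, norm_smul, he, R2.norm_single, mul_one, Real.norm_eq_abs, sq_abs]
  have hmem : c + t • e ∈ K := by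
    refine ⟨by rw [hti]; exact ht, by rw [hti]; exact htd, ?_⟩
    rw [hti, htn]; simp; positivity
  have h1 := hfin hmem
  have href : reflect c i (c + t • e) = c - t • e := by
    rw [reflect, hti, ← he, two_mul, add_smul]; abel
  simp only [hv, hψ, href, hti, htn] at h1
  have h4 : 4 * M / d = 4 * (d * a) := by rw [← had]; field_simp
  rw [h4]
  nlinarith [mul_nonneg ha0 (sq_nonneg t), mul_nonneg hN0 (sq_nonneg t)]

lemma pd_le_of_bounds {w : R2 → ℝ} {c : R2} {d M N : ℝ} (hd : 0 < d)
    (hC : ∀ x ∈ closedBall c (2 * d), ContDiffAt ℝ 2 w x)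
    (hM : ∀ x ∈ closedBall c (2 * d), |w x| ≤ M)
    (hN : ∀ x ∈ closedBall c (2 * d), |lap w x| ≤ N) (i : Fin 2) :
    pd i w c ≤ 2 * M / d + N * d / 2 := by
  set e : R2 := EuclideanSpace.single i 1 with he
  have hw : DifferentiableAt ℝ w c := (hC c (by simp; positivity)).differentiableAt (by simp)
  have h1 : HasDerivAt (fun t : ℝ => w (c + t • e)) (pd i w c) 0 := by
    have hl : HasDerivAt (fun t : ℝ => c + t • e) e 0 := by
      simpa using ((hasDerivAt_id (0:ℝ)).smul_const e).const_add c
    have hw' : DifferentiableAt ℝ w (c + (0:ℝ) • e) := by simpa using hw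
    have : HasDerivAt (fun t : ℝ => w (c + t • e)) (fderiv ℝ w (c + (0:ℝ) • e) e) 0 :=
      hw'.hasFDerivAt.comp_hasDerivAt (0:ℝ) hl
    rw [zero_smul, add_zero] at this
    exact this
  have h2 : HasDerivAt (fun t : ℝ => w (c - t • e)) (-pd i w c) 0 := by
    have hl : HasDerivAt (fun t : ℝ => c - t • e) (-e) 0 := by
      simpa using ((hasDerivAt_id (0:ℝ)).smul_const e).const_sub c
    have hw' : DifferentiableAt ℝ w (c - (0:ℝ) • e) := by simpa using hw
    have : HasDerivAt (fun t : ℝ => w (c - t • e)) (fderiv ℝ w (c - (0:ℝ) • e) (-e)) 0 :=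
      hw'.hasFDerivAt.comp_hasDerivAt (0:ℝ) hl
    rw [zero_smul, sub_zero, map_neg] at this
    exact this
  have h3 := (h1.sub h2).tendsto_slope_zero_right
  have h4 : pd i w c - -pd i w c ≤ 4 * M / d + N * d := by
    refine le_of_tendsto h3 ?_
    have hIoc : Ioc (0:ℝ) d ∈ 𝓝[>] (0:ℝ) := Ioc_mem_nhdsGT hd
    filter_upwards [hIoc] with t ht
    have := odd_part_le hd hC hM hN i ht.1.le ht.2
    simp only [Pi.sub_apply, zero_add, zero_smul, add_zero, sub_zero, sub_self, smul_eq_mul]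
    rw [inv_mul_le_iff₀ ht.1]
    exact this
  have : 4 * M / d = 2 * (2 * M / d) := by ring
  linarith

/-- Interior gradient estimate. -/
lemma norm_fderiv_le_of_bounds {w : R2 → ℝ} {c : R2} {d M N : ℝ} (hd : 0 < d)
    (hC : ∀ x ∈ closedBall c (2 * d), ContDiffAt ℝ 2 w x)
    (hM : ∀ x ∈ closedBall c (2 * d), |w x| ≤ M)
    (hN : ∀ x ∈ closedBall c (2 * d), |lap w x| ≤ N) :
    ‖fderiv ℝ w c‖ ≤ 4 * M / d + N * d := by
  have key : ∀ i, |pd i w c| ≤ 2 * M / d + N * d / 2 := by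
    intro i
    have hneg : pd i (fun x => -w x) c = -pd i w c := by simp [pd]
    refine abs_le.2 ⟨?_, pd_le_of_bounds hd hC hM hN i⟩
    have := pd_le_of_bounds (w := fun x => -w x) hd (fun x hx => (hC x hx).neg)
      (fun x hx => by simpa using hM x hx)
      (fun x hx => by rw [lap_neg (hC x hx), abs_neg]; exact hN x hx) i
    linarith
  have := norm_fderiv_le_pd w c
  have h : 4 * M / d = 2 * (2 * M / d) := by ring
  linarith [key 0, key 1]

lemma norm_fderiv_fderiv_le_of_bounds {w : R2 → ℝ} {c : R2} {d M N : ℝ} (hd : 0 < d)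
    (hC : ∀ x ∈ closedBall c (3 * d), ContDiffAt ℝ 2 w x)
    (hD : ∀ x ∈ closedBall c (3 * d), DifferentiableAt ℝ (lap w) x)
    (hM : ∀ x ∈ closedBall c (3 * d), ‖fderiv ℝ w x‖ ≤ M)
    (hN : ∀ x ∈ closedBall c (3 * d), ‖fderiv ℝ (lap w) x‖ ≤ N) :
    ‖fderiv ℝ (fderiv ℝ w) c‖ ≤ 2 * (4 * M / d + N * d) := by
  have hcc : c ∈ closedBall c (3 * d) := by simp; positivity
  have key : ∀ j : Fin 2, ‖fderiv ℝ (fderiv ℝ w) c (EuclideanSpace.single j 1)‖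
      ≤ 4 * M / d + N * d := by
    intro j
    set e : R2 := EuclideanSpace.single j 1 with he
    have hen : ‖e‖ = 1 := R2.norm_single j
    have hl : HasDerivAt (fun t : ℝ => c + t • e) e 0 := by
      simpa using ((hasDerivAt_id (0:ℝ)).smul_const e).const_add c
    have hdd : DifferentiableAt ℝ (fderiv ℝ w) (c + (0:ℝ) • e) := by
      simpa using (hC c hcc).fderiv_one.differentiableAt (by simp)
    have h1 := hdd.hasFDerivAt.comp_hasDerivAt (0:ℝ) hl
    have h2 := h1.tendsto_slope_zero_right
    simp only [Function.comp_def, zero_add, zero_smul, add_zero] at h2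
    refine le_of_tendsto h2.norm ?_
    filter_upwards [Ioc_mem_nhdsGT hd] with h hh
    have hh0 : 0 < h := hh.1
    have hsh : ∀ x ∈ closedBall c (2 * d), (x ∈ closedBall c (3 * d)) ∧
        ((1:ℝ) • x + h • e) ∈ closedBall c (3 * d) := by
      intro x hx
      rw [mem_closedBall, dist_eq_norm] at hx
      constructor
      · rw [mem_closedBall, dist_eq_norm]; linarith
      · rw [mem_closedBall, dist_eq_norm, one_smul, add_sub_right_comm]
        refine (norm_add_le _ _).trans ?_
        rw [norm_smul, hen, Real.norm_eq_abs, abs_of_pos hh0]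
        linarith [hh.2]
    set v : R2 → ℝ := fun x => h⁻¹ * (w ((1:ℝ) • x + h • e) - w x) with hv
    have hs : ∀ x ∈ closedBall c (2 * d), ContDiffAt ℝ 2 (fun x => w ((1:ℝ) • x + h • e)) x :=
      fun x hx => (hC _ (hsh x hx).2).comp x (by fun_prop)
    have hlip : ∀ (f : R2 → ℝ) (B : ℝ), (∀ x ∈ closedBall c (3 * d), DifferentiableAt ℝ f x) →
        (∀ x ∈ closedBall c (3 * d), ‖fderiv ℝ f x‖ ≤ B) → ∀ x ∈ closedBall c (2 * d),
        |h⁻¹ * (f ((1:ℝ) • x + h • e) - f x)| ≤ B := by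
      intro f B hf hB x hx
      have := (convex_closedBall c (3 * d)).norm_image_sub_le_of_norm_fderiv_le hf hB
        (hsh x hx).1 (hsh x hx).2
      rw [one_smul, add_sub_cancel_left, norm_smul, hen, mul_one, Real.norm_eq_abs,
        Real.norm_eq_abs, abs_of_pos hh0] at this
      rw [abs_mul, abs_of_pos (inv_pos.2 hh0), one_smul, inv_mul_le_iff₀ hh0]
      linarith
    have hb := norm_fderiv_le_of_bounds (w := v) (M := M) (N := N) hd
      (fun x hx => contDiffAt_const.mul ((hs x hx).sub (hC x (hsh x hx).1)))
      (hlip w M (fun x hx => (hC x hx).differentiableAt (by simp)) hM)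
      (fun x hx => by
        rw [hv, lap_const_mul ((hs x hx).sub (hC x (hsh x hx).1)),
          lap_sub (hs x hx) (hC x (hsh x hx).1), lap_comp_affine (hC _ (hsh x hx).2), one_pow,
          one_mul]
        exact hlip (lap w) N hD hN x hx)
    have hc2 : c ∈ closedBall c (2 * d) := by simp; positivity
    have hf1 : HasFDerivAt (fun x => w ((1:ℝ) • x + h • e))
        (fderiv ℝ w (c + h • e)) c := by
      have hd1 : DifferentiableAt ℝ w (c + h • e) := by
        simpa using (hC _ (hsh c hc2).2).differentiableAt (by simp)
      have := hd1.hasFDerivAt.comp c ((hasFDerivAt_id c).add_const (h • e))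
      simpa [Function.comp_def] using this
    have hf2 := (hf1.sub ((hC c hcc).differentiableAt (by simp)).hasFDerivAt).const_mul h⁻¹
    have hf3 : fderiv ℝ v c = h⁻¹ • (fderiv ℝ w (c + h • e) - fderiv ℝ w c) := hf2.fderiv
    rw [hf3] at hb
    exact hb
  refine (R2.norm_clm_le _).trans ?_
  linarith [key 0, key 1]

lemma hasDerivAt_max_pow (n : ℕ) (t : ℝ) :
    HasDerivAt (fun t : ℝ => max t 0 ^ (n + 2)) ((n + 2) * max t 0 ^ (n + 1)) t := by
  rcases lt_trichotomy t 0 with h | h | h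
  · rw [max_eq_right h.le, zero_pow (by simp), mul_zero]
    refine (hasDerivAt_const t (0:ℝ)).congr_of_eventuallyEq ?_
    filter_upwards [Iio_mem_nhds h] with s hs
    rw [max_eq_right (le_of_lt hs), zero_pow (by simp)]
  · subst h
    rw [max_self, zero_pow (by simp), mul_zero, hasDerivAt_iff_isLittleO_nhds_zero]
    simp only [zero_add, max_self, smul_zero, sub_zero, ne_eq, Nat.add_eq_zero_iff,
      OfNat.ofNat_ne_zero, and_false, not_false_eq_true, zero_pow]
    have h1 : (fun h : ℝ => max h 0 ^ (n + 2)) =O[𝓝 0] fun h : ℝ => h ^ (n + 2) := by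
      refine Asymptotics.isBigO_of_le _ fun h => ?_
      rw [norm_pow, norm_pow]
      gcongr
      rw [Real.norm_eq_abs, Real.norm_eq_abs, abs_of_nonneg (le_max_right _ _)]
      exact max_le (le_abs_self h) (abs_nonneg h)
    exact h1.trans_isLittleO (Asymptotics.isLittleO_pow_id (by omega))
  · rw [max_eq_left h.le]
    have := hasDerivAt_pow (n + 2) t
    push_cast at this
    refine HasDerivAt.congr_of_eventuallyEq (by simpa using this) ?_
    filter_upwards [Ioi_mem_nhds h] with s hs
    rw [max_eq_left (le_of_lt hs)]

lemma contDiff_max_pow (n : ℕ) : ContDiff ℝ 1 (fun t : ℝ => max t 0 ^ (n + 2)) := by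
  rw [contDiff_one_iff_deriv]
  refine ⟨fun t => (hasDerivAt_max_pow n t).differentiableAt, ?_⟩
  have : deriv (fun t : ℝ => max t 0 ^ (n + 2)) = fun t : ℝ => ((n:ℝ) + 2) * max t 0 ^ (n + 1) :=
    funext fun t => (hasDerivAt_max_pow n t).deriv
  rw [this]
  fun_prop

/-- The weight in the mean value inequality. -/
def wt (y : R2) : ℝ := max (1 - ‖y‖ ^ 2) 0 ^ 2

/-- A potential for the weight: its gradient is `- y * wt y`. -/
def wtPot (y : R2) : ℝ := max (1 - ‖y‖ ^ 2) 0 ^ 3 / 6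

lemma wt_nonneg (y : R2) : 0 ≤ wt y := by unfold wt; positivity

lemma wtPot_nonneg (y : R2) : 0 ≤ wtPot y := by unfold wtPot; positivity

lemma continuous_wt : Continuous wt := by unfold wt; fun_prop

lemma wt_eq_zero {y : R2} (hy : y ∉ closedBall (0 : R2) 1) : wt y = 0 := by
  rw [mem_closedBall, dist_zero_right, not_le] at hy
  unfold wt
  rw [max_eq_right (by nlinarith)]
  simp

lemma wtPot_eq_zero {y : R2} (hy : y ∉ closedBall (0 : R2) 1) : wtPot y = 0 := by
  rw [mem_closedBall, dist_zero_right, not_le] at hy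
  unfold wtPot
  rw [max_eq_right (by nlinarith)]
  simp

lemma contDiff_wtPot : ContDiff ℝ 1 wtPot :=
  ((contDiff_max_pow 1).comp (contDiff_const.sub (contDiff_norm_sq ℝ))).div_const 6

lemma pd_wtPot (i : Fin 2) (y : R2) : pd i wtPot y = -(y i * wt y) := by
  have h1 : HasDerivAt (fun s : ℝ => max (1 - s) 0 ^ 3 / 6)
      (-(max (1 - ‖y‖ ^ 2) 0 ^ 2 / 2)) (‖y‖ ^ 2) := by
    have h2 := hasDerivAt_max_pow 1 (1 - ‖y‖ ^ 2)
    have h3 := (h2.scomp (‖y‖ ^ 2) ((hasDerivAt_id (‖y‖ ^ 2)).const_sub 1)).div_const 6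
    refine h3.congr_deriv ?_
    norm_num
    ring
  have h4 : DifferentiableAt ℝ (fun y : R2 => ‖y‖ ^ 2) y :=
    (contDiff_norm_sq ℝ (n := 1)).contDiffAt.differentiableAt (by simp)
  have h5 := pd_comp (u := fun y : R2 => ‖y‖ ^ 2) h1 h4 i
  have h6 := pd_norm_sub_sq 0 y i
  simp only [sub_zero, PiLp.zero_apply] at h6
  rw [h6] at h5
  unfold wt
  refine h5.trans ?_
  ring

/-- The integral of the weight. -/
def wtMass : ℝ := ∫ y, wt y

lemma hasCompactSupport_wt : HasCompactSupport wt :=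
  HasCompactSupport.intro (isCompact_closedBall (0 : R2) 1) fun _ h => wt_eq_zero h

lemma wtMass_pos : 0 < wtMass :=
  continuous_wt.integral_pos_of_hasCompactSupport_nonneg_nonzero hasCompactSupport_wt
    wt_nonneg (x := 0) (by simp [wt])

lemma integral_pd_eq_zero {G : R2 → ℝ} (hG : ContDiff ℝ 1 G) (hs : HasCompactSupport G)
    (i : Fin 2) : ∫ x, pd i G x = 0 := by
  have hc : Continuous (pd i G) :=
    (hG.continuous_fderiv (by simp)).clm_apply continuous_const
  have hs' : HasCompactSupport (pd i G) := hs.fderiv_apply ℝ _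
  have := integral_mul_fderiv_eq_neg_fderiv_mul_of_integrable (μ := (volume : Measure R2))
    (f := fun _ => (1:ℝ)) (g := G) (v := EuclideanSpace.single i (1:ℝ)) (by simp)
    (by simp only [one_mul]; exact hc.integrable_of_hasCompactSupport hs')
    (by simpa using hG.continuous.integrable_of_hasCompactSupport hs)
    (fun x _ => by fun_prop) (fun x _ => hG.contDiffAt.differentiableAt (by simp))
  simp only [one_mul, fderiv_fun_const, Pi.zero_apply, zero_apply, zero_mul, integral_zero,
    neg_zero] at this
  exact this

lemma contDiff_mul_of_eq_zero {f k : R2 → ℝ} {S : Set R2} {n : WithTop ℕ∞} (hS : IsClosed S)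
    (hf : ∀ x ∈ S, ContDiffAt ℝ n f x) (hk : ContDiff ℝ n k) (h0 : ∀ x ∉ S, k x = 0) :
    ContDiff ℝ n fun x => f x * k x := by
  rw [contDiff_iff_contDiffAt]
  intro x
  by_cases hx : x ∈ S
  · exact (hf x hx).mul hk.contDiffAt
  · refine contDiffAt_const (c := (0:ℝ)) |>.congr_of_eventuallyEq ?_
    filter_upwards [hS.isOpen_compl.mem_nhds hx] with y hy
    rw [h0 y hy, mul_zero]

/-- Weighted mean of `v` over the disc of radius `R` about `c`. -/
def wmean (v : R2 → ℝ) (c : R2) (R : ℝ) : ℝ := ∫ y, v (R • y + c) * wt y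

lemma affine_mem_closedBall {c y : R2} {r R : ℝ} (hr : 0 ≤ r) (hrR : r ≤ R)
    (hy : y ∈ closedBall (0 : R2) 1) : r • y + c ∈ closedBall c R := by
  rw [mem_closedBall, dist_zero_right] at hy
  rw [mem_closedBall, dist_eq_norm, add_sub_cancel_right, norm_smul, Real.norm_eq_abs,
    abs_of_nonneg hr]
  nlinarith

lemma integrable_wmean {v : R2 → ℝ} {c : R2} {R : ℝ} (hR : 0 ≤ R)
    (hv : ContinuousOn v (closedBall c R)) : Integrable fun y => v (R • y + c) * wt y := by
  have h1 : ContinuousOn (fun y : R2 => v (R • y + c) * wt y) (closedBall 0 1) := by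
    refine ContinuousOn.mul ?_ continuous_wt.continuousOn
    exact hv.comp (by fun_prop) fun y hy => affine_mem_closedBall hR le_rfl hy
  have h2 := h1.integrableOn_compact (μ := volume) (isCompact_closedBall _ _)
  refine (integrableOn_iff_integrable_of_support_subset ?_).1 h2
  intro y hy
  by_contra h
  exact hy (by simp [wt_eq_zero h])

lemma hasDerivAt_wmean {v : R2 → ℝ} {c : R2} {R r : ℝ}
    (hC : ∀ x ∈ closedBall c R, ContDiffAt ℝ 2 v x) (hr : 0 < r) (hrR : r < R) :
    HasDerivAt (fun r => wmean v c r) (r * ∫ y, lap v (r • y + c) * wtPot y) r := by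
  have hR : 0 ≤ R := hr.le.trans hrR.le
  have hcf : ContinuousOn (fderiv ℝ v) (closedBall c R) := fun x hx =>
    (hC x hx).fderiv_one.continuousAt.continuousWithinAt
  obtain ⟨B, hB⟩ := (isCompact_closedBall c R).exists_bound_of_continuousOn hcf
  have hset : ∀ ρ : ℝ, 0 ≤ ρ → wmean v c ρ = ∫ y in closedBall 0 1, v (ρ • y + c) * wt y := by
    intro ρ _
    refine (setIntegral_eq_integral_of_forall_compl_eq_zero fun y hy => ?_).symm
    rw [wt_eq_zero hy, mul_zero]
  have hmem : ∀ y ∈ closedBall (0 : R2) 1, ∀ ρ ∈ Ioo 0 R, ρ • y + c ∈ closedBall c R :=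
    fun y hy ρ hρ => affine_mem_closedBall hρ.1.le hρ.2.le hy
  have hmeas : ∀ f : R2 → ℝ, (∀ x ∈ closedBall (0 : R2) 1, ContinuousAt f x) →
      IntegrableOn f (closedBall (0 : R2) 1) := fun f hf =>
    ContinuousOn.integrableOn_compact (isCompact_closedBall _ _)
      fun x hx => (hf x hx).continuousWithinAt
  have haff : ∀ (ρ : ℝ) (x : R2), ContinuousAt (fun y : R2 => ρ • y + c) x := fun ρ x => by
    fun_prop
  have hI : ∀ ρ ∈ Ioo 0 R, IntegrableOn (fun y => v (ρ • y + c) * wt y) (closedBall (0 : R2) 1) :=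
    fun ρ hρ => hmeas _ fun x hx =>
      (ContinuousAt.comp (f := fun y : R2 => ρ • y + c) (hC _ (hmem x hx ρ hρ)).continuousAt
        (haff ρ x)).mul continuous_wt.continuousAt
  have hI' : IntegrableOn (fun y => fderiv ℝ v (r • y + c) y * wt y) (closedBall (0 : R2) 1) :=
    hmeas _ fun x hx =>
      ((ContinuousAt.comp (f := fun y : R2 => r • y + c)
        (hC _ (hmem x hx r ⟨hr, hrR⟩)).fderiv_one.continuousAt (haff r x)).clm_apply
          continuousAt_id).mul continuous_wt.continuousAt
  have hd := (hasDerivAt_integral_of_dominated_loc_of_deriv_le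
    (μ := volume.restrict (closedBall (0 : R2) 1))
    (F := fun ρ y => v (ρ • y + c) * wt y)
    (F' := fun ρ y => fderiv ℝ v (ρ • y + c) y * wt y) (bound := fun _ => B) (x₀ := r)
    (Ioo_mem_nhds hr hrR)
    (by filter_upwards [Ioo_mem_nhds hr hrR] with ρ hρ using (hI ρ hρ).aestronglyMeasurable)
    (hI r ⟨hr, hrR⟩) hI'.aestronglyMeasurable
    (by
      filter_upwards [ae_restrict_mem measurableSet_closedBall] with y hy ρ hρ
      have h1 := hB _ (hmem y hy ρ hρ)
      have hB0 : 0 ≤ B := (norm_nonneg _).trans h1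
      have hy1 : ‖y‖ ≤ 1 := by simpa using hy
      have h2 : wt y ≤ 1 := by
        unfold wt
        exact pow_le_one₀ (le_max_right _ _) (max_le (by nlinarith [sq_nonneg ‖y‖]) zero_le_one)
      rw [norm_mul, Real.norm_eq_abs (wt y), abs_of_nonneg (wt_nonneg y)]
      have h3 := (fderiv ℝ v (ρ • y + c)).le_opNorm y
      have h4 : ‖fderiv ℝ v (ρ • y + c)‖ * ‖y‖ ≤ B * 1 := by gcongr
      calc _ ≤ B * 1 := by
            refine mul_le_mul ?_ h2 (wt_nonneg y) hB0
            linarith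
        _ = B := mul_one B)
    (integrableOn_const (by simp))
    (by
      filter_upwards [ae_restrict_mem measurableSet_closedBall] with y hy ρ hρ
      have hl : HasDerivAt (fun ρ : ℝ => ρ • y + c) y ρ := by
        simpa using ((hasDerivAt_id ρ).smul_const y).add_const c
      have h1 := ((hC _ (hmem y hy ρ hρ)).differentiableAt (by simp)).hasFDerivAt
      have h2 : HasDerivAt (fun ρ : ℝ => v (ρ • y + c)) (fderiv ℝ v (ρ • y + c) y) ρ :=
        HasFDerivAt.comp_hasDerivAt (f := fun ρ : ℝ => ρ • y + c) (l := v) ρ h1 hl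
      exact h2.mul_const _)).2
  have hev : (fun r => wmean v c r) =ᶠ[𝓝 r]
      fun ρ => ∫ y in closedBall 0 1, v (ρ • y + c) * wt y := by
    filter_upwards [Ioo_mem_nhds hr hrR] with ρ hρ using hset ρ hρ.1.le
  refine (hd.congr_of_eventuallyEq hev).congr_deriv ?_
  rw [setIntegral_eq_integral_of_forall_compl_eq_zero
    (fun y hy => by rw [wt_eq_zero hy, mul_zero])]
  have hmr : ∀ y ∈ closedBall (0 : R2) 1, ContDiffAt ℝ 2 v (r • y + c) := fun y hy =>
    hC _ (hmem y hy r ⟨hr, hrR⟩)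
  have hp1 : ∀ i, ∀ y ∈ closedBall (0 : R2) 1,
      ContDiffAt ℝ 1 (fun y => pd i v (r • y + c)) y := fun i y hy =>
    ContDiffAt.comp (f := fun y : R2 => r • y + c) y ((hmr y hy).pd_one i) (by fun_prop)
  have hG : ∀ i, ContDiff ℝ 1 fun y => pd i v (r • y + c) * wtPot y := fun i =>
    contDiff_mul_of_eq_zero isClosed_closedBall (hp1 i) contDiff_wtPot
      fun x hx => wtPot_eq_zero hx
  have hGs : ∀ i, HasCompactSupport fun y => pd i v (r • y + c) * wtPot y := fun i =>
    HasCompactSupport.intro (isCompact_closedBall (0 : R2) 1) fun x hx => by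
      rw [wtPot_eq_zero hx, mul_zero]
  have hpt : ∀ y, r * (lap v (r • y + c) * wtPot y) - fderiv ℝ v (r • y + c) y * wt y
      = pd 0 (fun y => pd 0 v (r • y + c) * wtPot y) y
        + pd 1 (fun y => pd 1 v (r • y + c) * wtPot y) y := by
    intro y
    by_cases hy : y ∈ closedBall (0 : R2) 1
    · have hdp : ∀ i, DifferentiableAt ℝ (fun y => pd i v (r • y + c)) y := fun i =>
        (hp1 i y hy).differentiableAt (by simp)
      have hdw : DifferentiableAt ℝ wtPot y := contDiff_wtPot.contDiffAt.differentiableAt (by simp)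
      have hdv : ∀ i, DifferentiableAt ℝ (pd i v) (r • y + c) := fun i =>
        ((hmr y hy).pd_one i).differentiableAt (by simp)
      rw [pd_mul (hdp 0) hdw, pd_mul (hdp 1) hdw, pd_comp_affine (hdv 0), pd_comp_affine (hdv 1),
        pd_wtPot, pd_wtPot, lap_eq_pd, R2.clm_apply (fderiv ℝ v (r • y + c)) y]
      simp only [pd, smul_eq_mul]
      ring
    · have h0 : ∀ i, pd i (fun y => pd i v (r • y + c) * wtPot y) y = 0 := by
        intro i
        have : (fun y => pd i v (r • y + c) * wtPot y) =ᶠ[𝓝 y] fun _ => 0 := by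
          filter_upwards [isClosed_closedBall.isOpen_compl.mem_nhds hy] with z hz
          rw [wtPot_eq_zero hz, mul_zero]
        rw [(pd_congr this i).eq_of_nhds, pd_const]
      rw [h0, h0, wtPot_eq_zero hy, wt_eq_zero hy]; simp
  have hint0 : ∀ i, Integrable (pd i fun y => pd i v (r • y + c) * wtPot y) := fun i =>
    (((hG i).continuous_fderiv (by simp)).clm_apply continuous_const).integrable_of_hasCompactSupport
      ((hGs i).fderiv_apply ℝ _)
  have hsum : ∫ y, (r * (lap v (r • y + c) * wtPot y) - fderiv ℝ v (r • y + c) y * wt y) = 0 := by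
    simp_rw [hpt]
    rw [integral_add (hint0 0) (hint0 1), integral_pd_eq_zero (hG 0) (hGs 0),
      integral_pd_eq_zero (hG 1) (hGs 1), add_zero]
  have hI2 : Integrable fun y => fderiv ℝ v (r • y + c) y * wt y := by
    refine (integrableOn_iff_integrable_of_support_subset ?_).1 hI'
    intro y hy
    by_contra h
    exact hy (by simp [wt_eq_zero h])
  have hI3 : Integrable fun y => r * (lap v (r • y + c) * wtPot y) := by
    have : (fun y => r * (lap v (r • y + c) * wtPot y)) = fun y =>
        (pd 0 (fun y => pd 0 v (r • y + c) * wtPot y) y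
        + pd 1 (fun y => pd 1 v (r • y + c) * wtPot y) y) + fderiv ℝ v (r • y + c) y * wt y := by
      funext y; rw [← hpt]; ring
    rw [this]
    exact ((hint0 0).add (hint0 1)).add hI2
  rw [integral_sub hI3 hI2, integral_const_mul] at hsum
  linarith

lemma continuousOn_wmean {v : R2 → ℝ} {c : R2} {R : ℝ}
    (hC : ContinuousOn v (closedBall c R)) : ContinuousOn (fun r => wmean v c r) (Icc 0 R) := by
  have hset : ∀ ρ : ℝ, wmean v c ρ = ∫ y in closedBall 0 1, v (ρ • y + c) * wt y := by
    intro ρ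
    refine (setIntegral_eq_integral_of_forall_compl_eq_zero fun y hy => ?_).symm
    rw [wt_eq_zero hy, mul_zero]
  simp_rw [hset]
  obtain ⟨B, hB⟩ := (isCompact_closedBall c R).exists_bound_of_continuousOn hC
  refine continuousOn_of_dominated (bound := fun _ => B) ?_ ?_ ?_ ?_
  · intro ρ hρ
    refine (ContinuousOn.integrableOn_compact (isCompact_closedBall _ _) ?_).aestronglyMeasurable
    exact (hC.comp (by fun_prop) fun y hy => affine_mem_closedBall hρ.1 hρ.2 hy).mul
      continuous_wt.continuousOn
  · intro ρ hρ
    filter_upwards [ae_restrict_mem measurableSet_closedBall] with y hy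
    have h1 := hB _ (affine_mem_closedBall hρ.1 hρ.2 hy)
    have h2 : wt y ≤ 1 := by
      unfold wt
      exact pow_le_one₀ (le_max_right _ _) (max_le (by nlinarith [sq_nonneg ‖y‖]) zero_le_one)
    rw [norm_mul, Real.norm_eq_abs (wt y), abs_of_nonneg (wt_nonneg y)]
    nlinarith [norm_nonneg (v (ρ • y + c)), wt_nonneg y]
  · exact integrableOn_const (by simp)
  · filter_upwards [ae_restrict_mem measurableSet_closedBall] with y hy
    refine ContinuousOn.mul ?_ continuousOn_const
    exact hC.comp (by fun_prop) fun ρ hρ => affine_mem_closedBall hρ.1 hρ.2 hy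

/-- Weighted mean value inequality for subharmonic functions. -/
lemma le_wmean {v : R2 → ℝ} {c : R2} {R : ℝ} (hR : 0 ≤ R)
    (hC : ∀ x ∈ closedBall c R, ContDiffAt ℝ 2 v x) (hl : ∀ x ∈ closedBall c R, 0 ≤ lap v x) :
    v c * wtMass ≤ wmean v c R := by
  have hcont : ContinuousOn v (closedBall c R) := fun x hx =>
    (hC x hx).continuousAt.continuousWithinAt
  have hmono : MonotoneOn (fun r => wmean v c r) (Icc 0 R) := by
    refine monotoneOn_of_deriv_nonneg (convex_Icc 0 R) (continuousOn_wmean hcont) ?_ ?_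
    · intro r hr
      rw [interior_Icc] at hr
      exact (hasDerivAt_wmean hC hr.1 hr.2).differentiableAt.differentiableWithinAt
    · intro r hr
      rw [interior_Icc] at hr
      rw [(hasDerivAt_wmean hC hr.1 hr.2).deriv]
      refine mul_nonneg hr.1.le (integral_nonneg fun y => ?_)
      by_cases hy : y ∈ closedBall (0 : R2) 1
      · exact mul_nonneg (hl _ (affine_mem_closedBall hr.1.le hr.2.le hy)) (wtPot_nonneg y)
      · simp [wtPot_eq_zero hy]
  have := hmono (left_mem_Icc.2 hR) (right_mem_Icc.2 hR) hR
  simpa [wmean, wtMass, integral_const_mul] using this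

lemma integral_comp_affine (f : R2 → ℝ) (c : R2) {r : ℝ} (hr : 0 < r) :
    ∫ y, f (r • y + c) = (r ^ 2)⁻¹ * ∫ y, f y := by
  have h1 := Measure.integral_comp_smul (volume : Measure R2) (fun x => f (x + c)) r
  rw [integral_add_right_eq_self f c, finrank_euclideanSpace_fin, smul_eq_mul,
    abs_of_pos (by positivity)] at h1
  exact h1

lemma wmean_mono {v w : R2 → ℝ} {c : R2} {R : ℝ} (hR : 0 ≤ R)
    (hv : ContinuousOn v (closedBall c R)) (hw : ContinuousOn w (closedBall c R))
    (h : ∀ x ∈ closedBall c R, v x ≤ w x) : wmean v c R ≤ wmean w c R := by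
  refine integral_mono (integrable_wmean hR hv) (integrable_wmean hR hw) fun y => ?_
  by_cases hy : y ∈ closedBall (0 : R2) 1
  · exact mul_le_mul_of_nonneg_right (h _ (affine_mem_closedBall hR le_rfl hy)) (wt_nonneg y)
  · simp [wt_eq_zero hy]

lemma wmean_const (a : ℝ) (c : R2) (R : ℝ) : wmean (fun _ => a) c R = a * wtMass := by
  simp [wmean, wtMass, integral_const_mul]

lemma wmean_le_of_le {v : R2 → ℝ} {c : R2} {R a : ℝ} (hR : 0 ≤ R)
    (hv : ContinuousOn v (closedBall c R))
    (h : ∀ x ∈ closedBall c R, v x ≤ a) : wmean v c R ≤ a * wtMass := by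
  rw [← wmean_const a c R]
  exact wmean_mono hR hv continuousOn_const h

lemma wmean_add {v w : R2 → ℝ} {c : R2} {R : ℝ} (hR : 0 ≤ R)
    (hv : ContinuousOn v (closedBall c R)) (hw : ContinuousOn w (closedBall c R)) :
    wmean (fun x => v x + w x) c R = wmean v c R + wmean w c R := by
  unfold wmean
  rw [← integral_add (integrable_wmean hR hv) (integrable_wmean hR hw)]
  simp only [add_mul]

lemma wmean_sub {v w : R2 → ℝ} {c : R2} {R : ℝ} (hR : 0 ≤ R)
    (hv : ContinuousOn v (closedBall c R)) (hw : ContinuousOn w (closedBall c R)) :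
    wmean (fun x => v x - w x) c R = wmean v c R - wmean w c R := by
  unfold wmean
  rw [← integral_sub (integrable_wmean hR hv) (integrable_wmean hR hw)]
  simp only [sub_mul]

/-- Comparison of weighted means. -/
lemma wmean_sub_le {v G : R2 → ℝ} {c : R2} {R : ℝ} (hR : 0 ≤ R)
    (hv : ∀ x ∈ closedBall c R, ContDiffAt ℝ 2 v x)
    (hG : ∀ x ∈ closedBall c R, ContDiffAt ℝ 2 G x)
    (hl : ∀ x ∈ closedBall c R, lap v x ≤ lap G x) :
    wmean v c R ≤ wmean G c R + (v c - G c) * wtMass := by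
  have h1 := le_wmean hR (v := fun x => G x - v x) (fun x hx => (hG x hx).sub (hv x hx))
    (fun x hx => by rw [lap_sub (hG x hx) (hv x hx)]; linarith [hl x hx])
  rw [wmean_sub hR (fun x hx => (hG x hx).continuousAt.continuousWithinAt)
    fun x hx => (hv x hx).continuousAt.continuousWithinAt] at h1
  linarith

lemma lap_quad (a : ℝ) (c x : R2) : lap (fun y => a * ‖y - c‖ ^ 2) x = 4 * a := by
  rw [lap_const_mul (contDiff_norm_sub_sq c).contDiffAt, lap_norm_sub_sq]; ring

lemma contDiffAt_quad (a : ℝ) (c x : R2) {n : WithTop ℕ∞} :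
    ContDiffAt ℝ n (fun y : R2 => a * ‖y - c‖ ^ 2) x :=
  (contDiff_const.mul (contDiff_norm_sub_sq c)).contDiffAt

lemma quad_le {a : ℝ} (ha : 0 ≤ a) {c x : R2} {R : ℝ} (hx : x ∈ closedBall c R) :
    a * ‖x - c‖ ^ 2 ≤ a * R ^ 2 := by
  rw [mem_closedBall, dist_eq_norm] at hx
  gcongr

/-- Mean value inequality for functions with Laplacian bounded below. -/
lemma le_wmean_add {v : R2 → ℝ} {c : R2} {R N : ℝ} (hR : 0 ≤ R) (hN : 0 ≤ N)
    (hC : ∀ x ∈ closedBall c R, ContDiffAt ℝ 2 v x) (hl : ∀ x ∈ closedBall c R, -N ≤ lap v x) :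
    v c * wtMass ≤ wmean v c R + N * R ^ 2 / 4 * wtMass := by
  have hq : ∀ x, ContDiffAt ℝ 2 (fun y : R2 => N / 4 * ‖y - c‖ ^ 2) x := fun x => contDiffAt_quad _ _ x
  have h1 := le_wmean hR (v := fun x => v x + N / 4 * ‖x - c‖ ^ 2)
    (fun x hx => (hC x hx).add (hq x))
    (fun x hx => by rw [lap_add (hC x hx) (hq x), lap_quad]; linarith [hl x hx])
  rw [wmean_add hR (fun x hx => (hC x hx).continuousAt.continuousWithinAt)
    fun x hx => (hq x).continuousAt.continuousWithinAt] at h1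
  have h2 := wmean_le_of_le (v := fun x => N / 4 * ‖x - c‖ ^ 2) hR
    (fun x hx => (hq x).continuousAt.continuousWithinAt)
    fun x hx => quad_le (by positivity) hx
  simp only [sub_self, norm_zero] at h1
  linarith

lemma wt_le_one (y : R2) : wt y ≤ 1 := by
  unfold wt
  exact pow_le_one₀ (le_max_right _ _) (max_le (by nlinarith [sq_nonneg ‖y‖]) zero_le_one)

lemma wt_comparison {b y : R2} (hb : ‖b‖ ≤ 1) : wt ((4 : ℝ) • y + b) ≤ 16 / 9 * wt y := by
  by_cases h : (4 : ℝ) • y + b ∈ closedBall (0 : R2) 1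
  · rw [mem_closedBall, dist_zero_right] at h
    have h1 : ‖(4 : ℝ) • y‖ ≤ 2 := by
      have := norm_sub_le ((4 : ℝ) • y + b) b
      rw [add_sub_cancel_right] at this
      linarith
    rw [norm_smul, Real.norm_eq_abs, abs_of_pos (by norm_num : (0:ℝ) < 4)] at h1
    have h2 : 3 / 4 ≤ max (1 - ‖y‖ ^ 2) 0 := le_max_of_le_left (by nlinarith [norm_nonneg y])
    have h3 : (3 / 4) ^ 2 ≤ wt y := by unfold wt; gcongr
    linarith [wt_le_one ((4 : ℝ) • y + b)]
  · rw [wt_eq_zero h]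
    linarith [wt_nonneg y]

/-- Weak Harnack inequality with the weighted mean on the right-hand side. -/
lemma le_of_wmean_le {v : R2 → ℝ} {c x : R2} {s N T : ℝ} (hs : 0 < s) (hN : 0 ≤ N)
    (hC : ∀ x ∈ closedBall c (4 * s), ContDiffAt ℝ 2 v x)
    (hv : ∀ x ∈ closedBall c (4 * s), 0 ≤ v x)
    (hl : ∀ x ∈ closedBall c (4 * s), -N ≤ lap v x)
    (hT : wmean v c (4 * s) ≤ T * wtMass) (hx : x ∈ closedBall c s) :
    v x ≤ 256 / 9 * T + N * s ^ 2 / 4 := by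
  have hsub : closedBall x s ⊆ closedBall c (4 * s) := by
    refine closedBall_subset_closedBall' ?_
    rw [mem_closedBall] at hx
    linarith
  have h1 := le_wmean_add hs.le hN (fun y hy => hC y (hsub hy)) fun y hy => hl y (hsub hy)
  set b : R2 := s⁻¹ • (c - x) with hb
  have hb1 : ‖b‖ ≤ 1 := by
    rw [mem_closedBall, dist_comm, dist_eq_norm] at hx
    rw [hb, norm_smul, norm_inv, Real.norm_eq_abs, abs_of_pos hs, inv_mul_le_iff₀ hs]
    linarith
  have h2 := integral_comp_affine (fun y => v (s • y + x) * wt y) b (r := 4) (by norm_num)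
  have hpt : ∀ y : R2, s • ((4:ℝ) • y + b) + x = (4 * s) • y + c := by
    intro y
    rw [hb, smul_add, smul_smul, smul_smul, mul_inv_cancel₀ hs.ne', one_smul, mul_comm s 4]
    abel
  simp only [hpt] at h2
  have hcont : ContinuousOn v (closedBall c (4 * s)) := fun x hx =>
    (hC x hx).continuousAt.continuousWithinAt
  have hle : ∫ y, v ((4 * s) • y + c) * wt ((4:ℝ) • y + b)
      ≤ ∫ y, 16 / 9 * (v ((4 * s) • y + c) * wt y) := by
    refine integral_mono_of_nonneg ?_ ((integrable_wmean (by positivity) hcont).const_mul _) ?_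
    · refine Eventually.of_forall fun y => ?_
      by_cases hy : (4:ℝ) • y + b ∈ closedBall (0 : R2) 1
      · refine mul_nonneg ?_ (wt_nonneg _)
        rw [← hpt]
        exact hv _ (hsub (affine_mem_closedBall hs.le le_rfl hy))
      · simp [wt_eq_zero hy]
    · refine Eventually.of_forall fun y => ?_
      by_cases hy : y ∈ closedBall (0 : R2) 1
      · have h3 := wt_comparison (y := y) hb1
        have h4 := hv _ (affine_mem_closedBall (c := c) (by positivity : 0 ≤ 4 * s) le_rfl hy)
        simp only
        nlinarith [mul_le_mul_of_nonneg_left h3 h4]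
      · have h3 := wt_comparison (y := y) hb1
        rw [wt_eq_zero hy, mul_zero] at h3
        have h4 := le_antisymm h3 (wt_nonneg _)
        simp [h4, wt_eq_zero hy]
  rw [integral_const_mul] at hle
  have h5 : wmean v x s ≤ 256 / 9 * (T * wtMass) := by
    change ∫ y, v (s • y + x) * wt y ≤ _
    change ∫ y, v ((4 * s) • y + c) * wt y ≤ _ at hT
    linarith
  have h6 := wtMass_pos
  refine le_of_mul_le_mul_right ?_ h6
  linarith

/-- Harnack inequality for nonnegative functions with bounded Laplacian. -/
lemma harnack {v : R2 → ℝ} {c x : R2} {s N : ℝ} (hs : 0 < s)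
    (hC : ∀ x ∈ closedBall c (4 * s), ContDiffAt ℝ 2 v x)
    (hv : ∀ x ∈ closedBall c (4 * s), 0 ≤ v x)
    (hl : ∀ x ∈ closedBall c (4 * s), |lap v x| ≤ N) (hx : x ∈ closedBall c s) :
    v x ≤ 29 * v c + 115 * (N * s ^ 2) := by
  have hcc : c ∈ closedBall c (4 * s) := by simp; positivity
  have hN : 0 ≤ N := (abs_nonneg _).trans (hl c hcc)
  have hq : ∀ x, ContDiffAt ℝ 2 (fun y : R2 => N / 4 * ‖y - c‖ ^ 2) x := fun x => contDiffAt_quad _ _ x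
  have h1 := wmean_sub_le (by positivity : 0 ≤ 4 * s) hC (fun x _ => hq x)
    (fun x hx => by rw [lap_quad]; linarith [(abs_le.1 (hl x hx)).2])
  have h2 := wmean_le_of_le (v := fun x => N / 4 * ‖x - c‖ ^ 2) (by positivity : 0 ≤ 4 * s)
    (fun x hx => (hq x).continuousAt.continuousWithinAt)
    fun x hx => quad_le (by positivity) hx
  simp only [sub_self, norm_zero] at h1
  have h3 := le_of_wmean_le hs hN hC hv (fun x hx => (abs_le.1 (hl x hx)).1)
    (T := v c + 4 * (N * s ^ 2)) (by nlinarith) hx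
  have : 0 ≤ N * s ^ 2 := by positivity
  linarith [hv c hcc]

lemma wmean_le_setIntegral {f : R2 → ℝ} {c : R2} {r : ℝ} (hr : 0 < r)
    (hf : ContinuousOn f (closedBall c r)) (h0 : ∀ x, 0 ≤ f x) :
    wmean f c r ≤ (r ^ 2)⁻¹ * ∫ x in closedBall c r, f x := by
  rw [← integral_indicator measurableSet_closedBall, ← integral_comp_affine _ c hr]
  have hi : Integrable ((closedBall c r).indicator f) :=
    (hf.integrableOn_compact (isCompact_closedBall _ _)).integrable_indicator
      measurableSet_closedBall
  refine integral_mono (integrable_wmean hr.le hf)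
    ((hi.comp_add_right c).comp_smul hr.ne') fun y => ?_
  by_cases hy : y ∈ closedBall (0 : R2) 1
  · have := affine_mem_closedBall (c := c) hr.le le_rfl hy
    simp only [indicator_of_mem this]
    have := h0 (r • y + c)
    nlinarith [wt_le_one y]
  · simp only [wt_eq_zero hy, mul_zero]
    exact indicator_nonneg (fun x _ => h0 x) _

/-- Small-mass regularity for nonnegative functions with `-Δf ≤ f²`. -/
lemma sq_mul_le_of_small_mass {f : R2 → ℝ} {y : R2} {ρ : ℝ} (hρ : 0 < ρ) (hf : ContDiff ℝ 2 f)
    (h0 : ∀ x, 0 ≤ f x) (hl : ∀ x, -f x ^ 2 ≤ lap f x)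
    (hm : ∫ x in closedBall y ρ, f x < wtMass / 16) : ρ ^ 2 * f y ≤ 1 / 2 := by
  set q : R2 → ℝ := fun x => (ρ - dist x y) ^ 2 * f x with hq
  have hfc := hf.continuous
  have hqc : Continuous q := by fun_prop
  obtain ⟨z, hz, hmax⟩ := (isCompact_closedBall y ρ).exists_isMaxOn
    ⟨y, mem_closedBall_self hρ.le⟩ hqc.continuousOn
  have hzy : dist z y ≤ ρ := hz
  set d := ρ - dist z y with hd
  have hqy : ρ ^ 2 * f y ≤ d ^ 2 * f z := by
    have : q y ≤ q z := hmax (mem_closedBall_self hρ.le)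
    simpa [hq] using this
  by_contra! hcon
  have hA : 1 / 2 < d ^ 2 * f z := hcon.trans_le hqy
  have hd0 : 0 ≤ d := by simp only [hd]; linarith
  have hfz : 0 < f z := by
    by_contra! h
    nlinarith [sq_nonneg d]
  set r := Real.sqrt (1 / (8 * f z)) with hr
  have hr0 : 0 < r := Real.sqrt_pos.2 (by positivity)
  have hr2 : r ^ 2 = 1 / (8 * f z) := Real.sq_sqrt (by positivity)
  have hr2' : r ^ 2 * f z = 1 / 8 := by rw [hr2]; field_simp
  have hrd : r ≤ d / 2 := by
    apply le_of_sq_le_sq _ (by positivity)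
    by_contra! h
    have := mul_lt_mul_of_pos_right h hfz
    nlinarith
  have hsub : closedBall z r ⊆ closedBall y ρ := by
    refine closedBall_subset_closedBall' ?_
    linarith
  have hS : ∀ x ∈ closedBall z r, f x ≤ 4 * f z := by
    intro x hx
    have h1 : q x ≤ q z := hmax (hsub hx)
    have hx' : dist x z ≤ r := hx
    have h2 : d / 2 ≤ ρ - dist x y := by
      have := dist_triangle x z y
      linarith
    simp only [hq] at h1
    have hd1 : 0 < d := by linarith
    have h3 : (d / 2) ^ 2 * f x ≤ d ^ 2 * f z := by
      refine le_trans ?_ h1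
      have := h0 x
      gcongr
    have hd2 : 0 < d ^ 2 := by positivity
    refine le_of_mul_le_mul_left ?_ hd2
    linarith
  have h1 := le_wmean_add hr0.le (by positivity : 0 ≤ (4 * f z) ^ 2)
    (fun x _ => hf.contDiffAt) (fun x hx => by
      refine le_trans ?_ (hl x)
      have := hS x hx
      have := h0 x
      gcongr)
  have h2 := wmean_le_setIntegral hr0 hfc.continuousOn (c := z) h0
  have h3 : ∫ x in closedBall z r, f x ≤ ∫ x in closedBall y ρ, f x :=
    setIntegral_mono_set (hfc.continuousOn.integrableOn_compact (isCompact_closedBall _ _))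
      (Eventually.of_forall fun x => h0 x) hsub.eventuallyLE
  have h4 : (r ^ 2)⁻¹ = 8 * f z := by rw [hr2]; simp
  have h5 : (4 * f z) ^ 2 * r ^ 2 / 4 = f z / 2 := by
    have : (4 * f z) ^ 2 * r ^ 2 / 4 = 4 * f z * (r ^ 2 * f z) := by ring
    rw [this, hr2']; ring
  rw [h5] at h1
  rw [h4] at h2
  have h6 : 8 * f z * ∫ x in closedBall z r, f x ≤ 8 * f z * ∫ x in closedBall y ρ, f x := by
    gcongr
  have h7 : 8 * f z * ∫ x in closedBall y ρ, f x < 8 * f z * (wtMass / 16) := by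
    gcongr
  linarith

lemma norm_gradient (u : R2 → ℝ) (x : R2) : ‖gradient u x‖ = ‖fderiv ℝ u x‖ := by
  unfold gradient
  rw [LinearIsometryEquiv.norm_map]

lemma norm_gradient_sq (u : R2 → ℝ) (x : R2) :
    ‖gradient u x‖ ^ 2 = pd 0 u x ^ 2 + pd 1 u x ^ 2 := by
  have h : ∀ i, gradient u x i = pd i u x := by
    intro i
    have h1 : inner ℝ (gradient u x) (EuclideanSpace.single i (1:ℝ)) = pd i u x := by
      unfold gradient pd
      rw [InnerProductSpace.toDual_symm_apply]
    rw [← h1, EuclideanSpace.inner_single_right]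
    simp
  rw [R2.norm_sq, h, h]

section Solution
variable {Ω : Set R2} {p m : ℝ} {u : R2 → ℝ}

lemma IsSolution.contDiffAt (hop : IsOpen Ω) (h : IsSolution Ω p u) {x : R2} (hx : x ∈ Ω) :
    ContDiffAt ℝ 2 u x := h.1.contDiffAt (hop.mem_nhds hx)

lemma IsSolution.continuousOn (h : IsSolution Ω p u) : ContinuousOn u (closure Ω) :=
  h.2.1.continuousOn

lemma IsSolution.eq_zero (hop : IsOpen Ω) (h : IsSolution Ω p u) {x : R2} (hx : x ∈ closure Ω)
    (hx' : x ∉ Ω) : u x = 0 := h.2.2.2 x (by rw [hop.frontier_eq]; exact ⟨hx, hx'⟩)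

lemma IsSolution.lap_eq (h : IsSolution Ω p u) {x : R2} (hx : x ∈ Ω) :
    lap u x = -(|u x| ^ (p - 1) * u x) := by
  rw [← h.2.2.1 x hx, neg_neg]

/-- Lower bound for the maximum of a solution. -/
lemma IsSolution.le_max (hop : IsOpen Ω) (h : IsSolution Ω p u) (hp : 1 < p) (hm : 0 < m)
    (hum : ∀ x ∈ Ω, |u x| ≤ m) {D : ℝ} (hD : Ω ⊆ closedBall 0 D) {x₀ : R2} (hx₀ : x₀ ∈ Ω)
    (hux₀ : u x₀ = m) : 4 ≤ m ^ (p - 1) * D ^ 2 := by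
  have hDc : closure Ω ⊆ closedBall 0 D := closure_minimal hD isClosed_closedBall
  have hK : IsCompact (closure Ω) :=
    (isCompact_closedBall (0 : R2) D).of_isClosed_subset isClosed_closure hDc
  have hnD : ∀ x ∈ closure Ω, ‖x‖ ^ 2 ≤ D ^ 2 := by
    intro x hx
    have := hDc hx
    rw [mem_closedBall, dist_zero_right] at this
    gcongr
  set a : ℝ := m ^ (p - 1) * m / 4 with ha
  have ha0 : 0 < a := by positivity
  set w : R2 → ℝ := fun x => (u x + a * ‖x - 0‖ ^ 2) - a * D ^ 2 with hw
  have hmax := max_principle (w := w) hK hop subset_closure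
    ((h.continuousOn.add (by fun_prop)).sub continuousOn_const)
    (fun x hx => ((h.contDiffAt hop hx).add (contDiffAt_quad _ _ _)).sub contDiffAt_const)
    (fun x hx => by
      rw [hw, lap_sub ((h.contDiffAt hop hx).add (contDiffAt_quad _ _ _)) contDiffAt_const,
        lap_add (h.contDiffAt hop hx) (contDiffAt_quad _ _ _), lap_quad, lap_const, h.lap_eq hx]
      have h1 : |u x| ^ (p - 1) ≤ m ^ (p - 1) :=
        Real.rpow_le_rpow (abs_nonneg _) (hum x hx) (by linarith)
      have h2 : |u x| ^ (p - 1) * u x ≤ m ^ (p - 1) * m := by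
        exact (mul_le_mul_of_nonneg_left (le_of_abs_le (hum x hx)) (by positivity)).trans
          (mul_le_mul_of_nonneg_right h1 hm.le)
      have h3 : 4 * a = m ^ (p - 1) * m := by rw [ha]; ring
      linarith)
    (fun x hx => by
      simp only [hw, sub_zero, h.eq_zero hop hx.1 hx.2]
      nlinarith [hnD x hx.1]) x₀ (subset_closure hx₀)
  simp only [hw, sub_zero, hux₀] at hmax
  have h2 : m ≤ a * D ^ 2 := by nlinarith [mul_nonneg ha0.le (sq_nonneg ‖x₀‖)]
  have h3 : a * D ^ 2 = m * (m ^ (p - 1) * D ^ 2 / 4) := by rw [ha]; ring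
  rw [h3] at h2
  have := (le_mul_iff_one_le_right hm).1 h2
  linarith

lemma IsSolution.isCompact_superlevel (hop : IsOpen Ω) (hb : Bornology.IsBounded Ω)
    (h : IsSolution Ω p u) {k : ℝ} (hk : 0 < k) : IsCompact {x | x ∈ Ω ∧ k ≤ u x} := by
  have hcomp : IsCompact (closure Ω) := hb.isCompact_closure
  have h1 : {x | x ∈ Ω ∧ k ≤ u x} = closure Ω ∩ u ⁻¹' Ici k := by
    ext x
    constructor
    · rintro ⟨h1, h2⟩
      exact ⟨subset_closure h1, h2⟩
    · rintro ⟨h1, h2⟩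
      refine ⟨?_, h2⟩
      by_contra hx
      have := h.eq_zero hop h1 hx
      have h3 : k ≤ u x := h2
      linarith
  rw [h1]
  exact hcomp.of_isClosed_subset
    (h.continuousOn.preimage_isClosed_of_isClosed isClosed_closure isClosed_Ici) inter_subset_left

lemma IsSolution.continuousOn_rhs (h : IsSolution Ω p u) (hp : 1 < p) :
    ContinuousOn (fun x => |u x| ^ (p - 1) * u x) (closure Ω) :=
  (h.continuousOn.abs.rpow_const fun _ _ => Or.inr (by linarith)).mul h.continuousOn

/-- The mass of the region where `u` exceeds half of its maximum is controlled by the energy. -/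
lemma IsSolution.mass_le (hop : IsOpen Ω) (hb : Bornology.IsBounded Ω) (h : IsSolution Ω p u)
    (hp : 1 < p) (hm : 0 < m) (hum : ∀ x ∈ Ω, |u x| ≤ m)
    (hgint : IntegrableOn (fun x => ‖gradient u x‖ ^ 2) Ω) :
    ∫ x in {x | x ∈ Ω ∧ m / 2 ≤ u x}, |u x| ^ (p - 1) * u x
      ≤ 24 / m * ∫ x in Ω, ‖gradient u x‖ ^ 2 := by
  classical
  set k : ℝ := m / 4 with hk
  have hk0 : 0 < k := by positivity
  set S : Set R2 := {x | x ∈ Ω ∧ k ≤ u x} with hSdef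
  have hS : IsCompact S := h.isCompact_superlevel hop hb hk0
  have hSΩ : S ⊆ Ω := fun x hx => hx.1
  have hsmall : ∀ x ∈ Ω, x ∉ S → max (u x - k) 0 = 0 := by
    intro x hx hxS
    have : u x < k := by
      by_contra! h'
      exact hxS ⟨hx, h'⟩
    exact max_eq_right (by linarith)
  have cut : ∀ n : ℕ, n ≠ 0 → ∀ N : WithTop ℕ∞, N ≤ 2 →
      ContDiff ℝ N (fun t : ℝ => max t 0 ^ n) →
      ContDiff ℝ N (fun x => if x ∈ Ω then max (u x - k) 0 ^ n else 0) := by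
    intro n hn N hN hC
    rw [contDiff_iff_contDiffAt]
    intro x
    by_cases hx : x ∈ S
    · have h1 : ContDiffAt ℝ N (fun x => max (u x - k) 0 ^ n) x :=
        hC.contDiffAt.comp x
          (((h.contDiffAt hop (hSΩ hx)).of_le hN).sub contDiffAt_const)
      refine h1.congr_of_eventuallyEq ?_
      filter_upwards [hop.mem_nhds (hSΩ hx)] with y hy
      simp [hy]
    · refine contDiffAt_const (c := (0:ℝ)) |>.congr_of_eventuallyEq ?_
      filter_upwards [hS.isClosed.isOpen_compl.mem_nhds hx] with y hy
      by_cases hyΩ : y ∈ Ω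
      · simp [hyΩ, hsmall y hyΩ hy, hn]
      · simp [hyΩ]
  set χ : R2 → ℝ := fun x => if x ∈ Ω then max (u x - k) 0 ^ 2 else 0 with hχ
  set χ' : R2 → ℝ := fun x => if x ∈ Ω then max (u x - k) 0 ^ 1 else 0 with hχ'
  have hχC : ContDiff ℝ 1 χ := cut 2 (by simp) 1 (by norm_num) (contDiff_max_pow 0)
  have hχ'C : ContDiff ℝ 0 χ' := cut 1 (by simp) 0 (by norm_num)
    (contDiff_zero.2 (by fun_prop))
  have hχ0 : ∀ x ∉ S, χ x = 0 := by
    intro x hx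
    by_cases hxΩ : x ∈ Ω
    · simp [hχ, hxΩ, hsmall x hxΩ hx]
    · simp [hχ, hxΩ]
  have hχ'0 : ∀ x ∉ S, χ' x = 0 := by
    intro x hx
    by_cases hxΩ : x ∈ Ω
    · simp [hχ', hxΩ, hsmall x hxΩ hx]
    · simp [hχ', hxΩ]
  have hpdu : ∀ i, ∀ x ∈ S, ContDiffAt ℝ 1 (pd i u) x := fun i x hx =>
    (h.contDiffAt hop (hSΩ hx)).pd_one i
  have hG : ∀ i, ContDiff ℝ 1 fun x => pd i u x * χ x := fun i =>
    contDiff_mul_of_eq_zero hS.isClosed (hpdu i) hχC hχ0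
  have hGs : ∀ i, HasCompactSupport fun x => pd i u x * χ x := fun i =>
    HasCompactSupport.intro hS fun x hx => by rw [hχ0 x hx, mul_zero]
  have hA : Continuous fun x => (|u x| ^ (p - 1) * u x) * χ x := by
    rw [← contDiff_zero (𝕜 := ℝ)]
    refine contDiff_mul_of_eq_zero hS.isClosed (fun x hx => ?_) (hχC.of_le (by norm_num)) hχ0
    refine (contDiffOn_zero.2 ((h.continuousOn_rhs hp).mono subset_closure)).contDiffAt
      (hop.mem_nhds (hSΩ hx))
  have hB : Continuous fun x => (pd 0 u x ^ 2 + pd 1 u x ^ 2) * χ' x := by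
    rw [← contDiff_zero (𝕜 := ℝ)]
    exact contDiff_mul_of_eq_zero hS.isClosed
      (fun x hx => ((((hpdu 0 x hx).pow 2).add ((hpdu 1 x hx).pow 2))).of_le (by norm_num))
      hχ'C hχ'0
  have hAi := hA.integrable_of_hasCompactSupport (μ := (volume : Measure R2))
    (HasCompactSupport.intro hS fun x hx => by rw [hχ0 x hx, mul_zero])
  have hBi := hB.integrable_of_hasCompactSupport (μ := (volume : Measure R2))
    (HasCompactSupport.intro hS fun x hx => by rw [hχ'0 x hx, mul_zero])
  have hpt : ∀ x, pd 0 (fun x => pd 0 u x * χ x) x + pd 1 (fun x => pd 1 u x * χ x) x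
      = 2 * ((pd 0 u x ^ 2 + pd 1 u x ^ 2) * χ' x) - (|u x| ^ (p - 1) * u x) * χ x := by
    intro x
    by_cases hx : x ∈ S
    · have hxΩ := hSΩ hx
      have hdp : ∀ i, DifferentiableAt ℝ (pd i u) x := fun i =>
        (hpdu i x hx).differentiableAt (by simp)
      have hdχ : DifferentiableAt ℝ χ x := hχC.contDiffAt.differentiableAt (by simp)
      have hpχ : ∀ i, pd i χ x = 2 * χ' x * pd i u x := by
        intro i
        have he : χ =ᶠ[𝓝 x] fun y => max (u y - k) 0 ^ 2 := by
          filter_upwards [hop.mem_nhds hxΩ] with y hy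
          simp [hχ, hy]
        have h3 : HasDerivAt (fun t : ℝ => max (t - k) 0 ^ 2) (2 * max (u x - k) 0) (u x) := by
          have h2 := hasDerivAt_max_pow 0 (u x - k)
          have := h2.comp_sub_const (u x) k
          simpa using this
        rw [(pd_congr he i).eq_of_nhds,
          pd_comp h3 ((h.contDiffAt hop hxΩ).differentiableAt (by simp))]
        simp [hχ', hxΩ]
      rw [pd_mul (hdp 0) hdχ, pd_mul (hdp 1) hdχ, hpχ, hpχ]
      have := h.lap_eq hxΩ
      rw [lap_eq_pd] at this
      linear_combination χ x * this
    · have h0 : ∀ i, pd i (fun y => pd i u y * χ y) x = 0 := by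
        intro i
        have : (fun y => pd i u y * χ y) =ᶠ[𝓝 x] fun _ => 0 := by
          filter_upwards [hS.isClosed.isOpen_compl.mem_nhds hx] with z hz
          rw [hχ0 z hz, mul_zero]
        rw [(pd_congr this i).eq_of_nhds, pd_const]
      rw [h0, h0, hχ0 x hx, hχ'0 x hx]; simp
  have hint0 : ∀ i, Integrable (pd i fun x => pd i u x * χ x) := fun i =>
    (((hG i).continuous_fderiv (by simp)).clm_apply continuous_const).integrable_of_hasCompactSupport
      ((hGs i).fderiv_apply ℝ _)
  have hsum := integral_add (hint0 0) (hint0 1)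
  rw [integral_pd_eq_zero (hG 0) (hGs 0), integral_pd_eq_zero (hG 1) (hGs 1), add_zero] at hsum
  simp_rw [hpt] at hsum
  rw [integral_sub (hBi.const_mul 2) hAi, integral_const_mul] at hsum
  have hup : ∀ x ∈ Ω, u x ≤ m := fun x hx => le_of_abs_le (hum x hx)
  have hBle : ∫ x, (pd 0 u x ^ 2 + pd 1 u x ^ 2) * χ' x
      ≤ ∫ x, Ω.indicator (fun x => 3 * m / 4 * ‖gradient u x‖ ^ 2) x := by
    refine integral_mono hBi (IntegrableOn.integrable_indicator (hgint.const_mul _)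
      hop.measurableSet) fun x => ?_
    by_cases hx : x ∈ Ω
    · simp only [indicator_of_mem hx, norm_gradient_sq, hχ', if_pos hx, pow_one]
      have h1 : max (u x - k) 0 ≤ 3 * m / 4 :=
        max_le (by linarith [hup x hx]) (by positivity)
      nlinarith [mul_le_mul_of_nonneg_left h1 (by positivity : 0 ≤ pd 0 u x ^ 2 + pd 1 u x ^ 2)]
    · simp [hχ', hx]
  have hAm : MeasurableSet {x | x ∈ Ω ∧ m / 2 ≤ u x} :=
    (h.isCompact_superlevel hop hb (by positivity)).isClosed.measurableSet
  have hAle : ∫ x, {x | x ∈ Ω ∧ m / 2 ≤ u x}.indicator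
      (fun x => m ^ 2 / 16 * (|u x| ^ (p - 1) * u x)) x
      ≤ ∫ x, (|u x| ^ (p - 1) * u x) * χ x := by
    refine integral_mono_of_nonneg ?_ hAi ?_
    · refine Eventually.of_forall fun x => indicator_nonneg (fun y hy => ?_) x
      have : 0 ≤ u y := by linarith [hy.2]
      positivity
    · refine Eventually.of_forall fun x => ?_
      by_cases hx : x ∈ {x | x ∈ Ω ∧ m / 2 ≤ u x}
      · simp only [indicator_of_mem hx, hχ, if_pos hx.1]
        have h1 : m / 4 ≤ max (u x - k) 0 := le_max_of_le_left (by linarith [hx.2])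
        have h2 : (m / 4) ^ 2 ≤ max (u x - k) 0 ^ 2 := by gcongr
        have h3 : 0 ≤ |u x| ^ (p - 1) * u x := by
          have : 0 ≤ u x := by linarith [hx.2]
          positivity
        nlinarith
      · simp only [indicator_of_notMem hx]
        by_cases hxS : x ∈ S
        · have h3 : 0 ≤ u x := by linarith [hxS.2]
          have h4 : 0 ≤ χ x := by simp only [hχ]; split_ifs <;> positivity
          positivity
        · rw [hχ0 x hxS, mul_zero]
  rw [integral_indicator hop.measurableSet, integral_const_mul] at hBle
  rw [integral_indicator hAm, integral_const_mul] at hAle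
  have h9 : m ^ 2 / 16 * ∫ x in {x | x ∈ Ω ∧ m / 2 ≤ u x}, |u x| ^ (p - 1) * u x
      ≤ 3 * m / 2 * ∫ x in Ω, ‖gradient u x‖ ^ 2 := by linarith
  have h10 : 0 < m ^ 2 / 16 := by positivity
  refine le_of_mul_le_mul_left (h9.trans (le_of_eq ?_)) h10
  field_simp
  ring
end Solution

/-- Every small circle centred on a graph-like boundary meets that boundary. -/
lemma SmoothBoundary.exists_dist_eq {Ω : Set R2} (hsm : SmoothBoundary Ω)
    (hb : Bornology.IsBounded Ω) :
    ∃ r₀ > 0, ∀ x ∈ frontier Ω, ∀ r, 0 < r → r < r₀ → ∃ y ∈ frontier Ω, dist y x = r := by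
  have hK : IsCompact (frontier Ω) :=
    hb.isCompact_closure.of_isClosed_subset isClosed_frontier frontier_subset_closure
  choose V hV hxV e g hg hfr using hsm
  obtain ⟨r₀, hr₀, hball⟩ := lebesgue_number_lemma_of_metric (s := frontier Ω)
    (c := fun z : frontier Ω => V z z.2) hK (fun z => hV z z.2)
    (fun x hx => mem_iUnion.2 ⟨⟨x, hx⟩, hxV x hx⟩)
  refine ⟨r₀, hr₀, fun x hx r hr hrr => ?_⟩
  obtain ⟨⟨z, hz⟩, hzV⟩ := hball x hx
  have hgz : Continuous (g z hz) := (hg z hz).continuous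
  set a : ℝ := e z hz x 0 with ha
  have hxg : e z hz x 1 = g z hz a := by
    have : x ∈ frontier Ω ∩ V z hz := ⟨hx, hzV (mem_ball_self hr₀)⟩
    rw [hfr z hz] at this
    exact this.2
  set q : ℝ → R2 := fun t => !₂[a + t, g z hz (a + t)] with hq
  have hq0 : q 0 = e z hz x := by
    ext i
    fin_cases i
    · simp [hq, ha]
    · simp [hq, hxg]
  have hqc : Continuous q := by
    simp only [hq]
    fun_prop
  have hdc : Continuous fun t => dist (q t) (q 0) := by fun_prop
  have hdr : r ≤ dist (q r) (q 0) := by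
    have h0 : (q r - q 0) 0 = r := by simp [hq]
    have := R2.abs_apply_le (q r - q 0) 0
    rwa [h0, abs_of_pos hr, ← dist_eq_norm] at this
  obtain ⟨t, -, ht⟩ : ∃ t ∈ Icc 0 r, dist (q t) (q 0) = r := by
    have := intermediate_value_Icc hr.le hdc.continuousOn
    exact this ⟨by simpa using hr.le, hdr⟩
  set y := (e z hz).symm (q t) with hy
  have hdy : dist y x = r := by
    rw [← ht, hq0, ← (e z hz).dist_eq y x, hy, IsometryEquiv.apply_symm_apply]
  refine ⟨y, ?_, hdy⟩
  have hyV : y ∈ V z hz := hzV (by rw [mem_ball, hdy]; exact hrr)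
  have : y ∈ frontier Ω ∩ V z hz := by
    rw [hfr z hz]
    refine ⟨hyV, ?_⟩
    simp [hy, hq]
  exact this.1

/-- The point at angle `θ` on the circle of radius `r` about `c`. -/
def circ (c : R2) (r θ : ℝ) : R2 := r • !₂[cos θ, sin θ] + c

lemma exists_circ (c y : R2) : ∃ θ ∈ Icc (-π) π, y = circ c (dist y c) θ := by
  set z : ℂ := ⟨(y - c) 0, (y - c) 1⟩ with hz
  have hn : ‖z‖ = dist y c := by
    rw [dist_eq_norm, Complex.norm_def, Complex.normSq_apply, EuclideanSpace.norm_eq,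
      Fin.sum_univ_two]
    simp [hz, sq]
  refine ⟨z.arg, ⟨(Complex.neg_pi_lt_arg z).le, Complex.arg_le_pi z⟩, ?_⟩
  have h1 := Complex.norm_mul_cos_arg z
  have h2 := Complex.norm_mul_sin_arg z
  have hre : z.re = y 0 - c 0 := by simp [hz]
  have him : z.im = y 1 - c 1 := by simp [hz]
  rw [hn] at h1 h2
  ext i
  fin_cases i
  · simp [circ, h1, hre]
  · simp [circ, h2, him]

lemma hasDerivAt_circ (c : R2) (r θ : ℝ) :
    HasDerivAt (circ c r) (r • !₂[-sin θ, cos θ]) θ := by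
  unfold circ
  refine HasDerivAt.add_const _ (HasDerivAt.const_smul r ?_)
  have h : HasDerivAt (fun θ : ℝ => (![cos θ, sin θ] : Fin 2 → ℝ)) ![-sin θ, cos θ] θ := by
    rw [hasDerivAt_pi]
    intro i
    fin_cases i
    · simpa using hasDerivAt_cos θ
    · simpa using hasDerivAt_sin θ
  exact (PiLp.continuousLinearEquiv 2 ℝ (fun _ : Fin 2 => ℝ)).symm.toContinuousLinearMap.hasFDerivAt.comp_hasDerivAt θ h

lemma continuous_circ (c : R2) (r : ℝ) : Continuous (circ c r) :=
  continuous_iff_continuousAt.2 fun θ => (hasDerivAt_circ c r θ).continuousAt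

/-- Cauchy–Schwarz on an arc along which the function oscillates by at least `b`. -/
lemma lintegral_arc_ge {Ω : Set R2} {u : R2 → ℝ} (hu : ∀ x ∈ Ω, ContDiffAt ℝ 1 u x) {c : R2}
    {r α β b : ℝ} (hr : 0 < r) (hα : α ∈ Icc (-π) π) (hβ : β ∈ Icc (-π) π) (hαβ : α ≤ β)
    (hb : 0 < b) (hΩ : ∀ θ ∈ Icc α β, circ c r θ ∈ Ω)
    (hosc : b ≤ |u (circ c r β) - u (circ c r α)|) :
    ENNReal.ofReal (b ^ 2 / (2 * π * r ^ 2)) ≤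
      ∫⁻ θ in Ioo (-π) π, Ω.indicator (fun x => ENNReal.ofReal (‖gradient u x‖ ^ 2))
        (circ c r θ) := by
  set D : ℝ → ℝ := fun θ => ‖fderiv ℝ u (circ c r θ)‖ with hD
  have hDc : ContinuousOn D (Icc α β) := fun θ hθ =>
    (ContinuousAt.comp (f := circ c r)
      ((hu _ (hΩ θ hθ)).fderiv_right (m := 0) (by norm_num)).continuousAt
      (continuous_circ c r).continuousAt).norm.continuousWithinAt
  have hd : ∀ θ ∈ Icc α β, HasDerivAt (fun θ => u (circ c r θ))
      (fderiv ℝ u (circ c r θ) (r • !₂[-sin θ, cos θ])) θ := fun θ hθ =>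
    HasFDerivAt.comp_hasDerivAt (f := circ c r) (l := u) θ
      ((hu _ (hΩ θ hθ)).differentiableAt (by simp)).hasFDerivAt (hasDerivAt_circ c r θ)
  have hnorm : ∀ θ : ℝ, ‖(!₂[-sin θ, cos θ] : R2)‖ = 1 := by
    intro θ
    rw [EuclideanSpace.norm_eq, Fin.sum_univ_two]
    simp
  have hdb : ∀ θ ∈ Icc α β, |fderiv ℝ u (circ c r θ) (r • !₂[-sin θ, cos θ])| ≤ r * D θ := by
    intro θ _
    have := (fderiv ℝ u (circ c r θ)).le_opNorm (r • !₂[-sin θ, cos θ])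
    rw [norm_smul, hnorm, mul_one, Real.norm_eq_abs, Real.norm_eq_abs, abs_of_pos hr] at this
    linarith
  set s : ℝ := 2 * π / b with hs
  have hs0 : 0 < s := by positivity
  have hD2 : IntervalIntegrable (fun θ => s / 2 * (r * D θ) ^ 2 + 1 / (2 * s)) volume α β := by
    refine ContinuousOn.intervalIntegrable ?_
    rw [uIcc_of_le hαβ]
    fun_prop
  have hD3 : IntervalIntegrable (fun θ => s / 2 * (r * D θ) ^ 2) volume α β := by
    refine ContinuousOn.intervalIntegrable ?_
    rw [uIcc_of_le hαβ]
    fun_prop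
  have h1 : |u (circ c r β) - u (circ c r α)|
      ≤ ∫ θ in α..β, (s / 2 * (r * D θ) ^ 2 + 1 / (2 * s)) := by
    refine (norm_sub_le_integral_of_norm_deriv_le_of_le hαβ (f := fun θ => u (circ c r θ))
      (fun θ hθ => (hd θ hθ).continuousAt.continuousWithinAt)
      (fun θ hθ => (hd θ (Ioo_subset_Icc_self hθ)).differentiableAt.differentiableWithinAt)
      ?_ hD2)
    refine Eventually.of_forall fun θ hθ => ?_
    rw [(hd θ (Ioo_subset_Icc_self hθ)).deriv, Real.norm_eq_abs]
    refine (hdb θ (Ioo_subset_Icc_self hθ)).trans ?_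
    have h : s / 2 * (r * D θ) ^ 2 + 1 / (2 * s) - r * D θ
        = (s * (r * D θ) - 1) ^ 2 / (2 * s) := by
      field_simp
      ring
    have : 0 ≤ (s * (r * D θ) - 1) ^ 2 / (2 * s) := by positivity
    linarith
  rw [intervalIntegral.integral_add hD3 (by simp), intervalIntegral.integral_const_mul,
    intervalIntegral.integral_const, smul_eq_mul] at h1
  have h2 : (β - α) * (1 / (2 * s)) ≤ b / 2 := by
    have : β - α ≤ 2 * π := by linarith [hα.1, hβ.2]
    calc (β - α) * (1 / (2 * s)) ≤ 2 * π * (1 / (2 * s)) := by gcongr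
      _ = b / 2 := by rw [hs]; field_simp
  have h3 : b ^ 2 / (2 * π * r ^ 2) ≤ ∫ θ in α..β, D θ ^ 2 := by
    have h4 : ∫ θ in α..β, (r * D θ) ^ 2 = r ^ 2 * ∫ θ in α..β, D θ ^ 2 := by
      rw [← intervalIntegral.integral_const_mul]; simp only [mul_pow]
    rw [h4] at h1
    have h5 : b / 2 ≤ s / 2 * (r ^ 2 * ∫ θ in α..β, D θ ^ 2) := by linarith
    rw [div_le_iff₀ (by positivity)]
    have h6 : s / 2 * (r ^ 2 * ∫ θ in α..β, D θ ^ 2)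
        = ((∫ θ in α..β, D θ ^ 2) * (2 * π * r ^ 2)) / (2 * b) := by rw [hs]; field_simp
    rw [h6, le_div_iff₀ (by positivity)] at h5
    linarith
  refine (ENNReal.ofReal_le_ofReal h3).trans ?_
  rw [intervalIntegral.integral_of_le hαβ, integral_Ioc_eq_integral_Ioo]
  have hDi : IntegrableOn (fun θ => D θ ^ 2) (Ioo α β) :=
    ((hDc.pow 2).integrableOn_Icc).mono_set Ioo_subset_Icc_self
  rw [ofReal_integral_eq_lintegral_ofReal hDi (Eventually.of_forall fun θ => sq_nonneg _)]
  refine (setLIntegral_mono' measurableSet_Ioo fun θ hθ => ?_).trans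
    (lintegral_mono_set (Ioo_subset_Ioo hα.1 hβ.2))
  rw [indicator_of_mem (hΩ θ (Ioo_subset_Icc_self hθ)), norm_gradient]

lemma IsSolution.lintegral_circ_ge {Ω : Set R2} {p : ℝ} {u : R2 → ℝ} (hop : IsOpen Ω)
    (h : IsSolution Ω p u) {c : R2} {r m θ₁ θ₂ : ℝ} (hr : 0 < r) (hm : 0 < m)
    (h₁ : θ₁ ∈ Icc (-π) π) (h₂ : θ₂ ∈ Icc (-π) π) (hΩ₁ : circ c r θ₁ ∈ Ω)
    (hΩ₂ : circ c r θ₂ ∉ Ω) (hu : m / 2 ≤ u (circ c r θ₁)) :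
    ENNReal.ofReal (m ^ 2 / (32 * π) / r ^ 2) ≤
      ∫⁻ θ in Ioo (-π) π, Ω.indicator (fun x => ENNReal.ofReal (‖gradient u x‖ ^ 2))
        (circ c r θ) := by
  set γ : ℝ → ℝ := fun s => θ₁ + s * (θ₂ - θ₁) with hγ
  have hγc : Continuous fun s => circ c r (γ s) :=
    (continuous_circ c r).comp (by fun_prop)
  set A : Set ℝ := Icc 0 1 ∩ {s | circ c r (γ s) ∈ Ωᶜ} with hA
  have hAc : IsCompact A := isCompact_Icc.inter_right (hop.isClosed_compl.preimage hγc)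
  have hAne : A.Nonempty := ⟨1, by simp, by simpa [hγ] using hΩ₂⟩
  have hSA : sInf A ∈ A := hAc.sInf_mem hAne
  set S := sInf A with hS
  have hlt : ∀ s, 0 ≤ s → s < S → circ c r (γ s) ∈ Ω := by
    intro s hs hsS
    by_contra hcon
    exact absurd (csInf_le hAc.bddBelow (show s ∈ A from ⟨⟨hs, hsS.le.trans hSA.1.2⟩, hcon⟩))
      (not_le.2 hsS)
  have hS0 : 0 < S := by
    refine lt_of_le_of_ne hSA.1.1 fun h0 => hSA.2 ?_
    rw [← h0]
    simpa [hγ] using hΩ₁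
  have hcl : MapsTo (fun s => circ c r (γ s)) (Icc 0 S) (closure Ω) := by
    have h1 : MapsTo (fun s => circ c r (γ s)) (Ico 0 S) Ω := fun s hs => hlt s hs.1 hs.2
    have h2 := h1.closure hγc
    rwa [closure_Ico hS0.ne] at h2
  have hf : ContinuousOn (fun s => u (circ c r (γ s))) (Icc 0 S) :=
    h.continuousOn.comp hγc.continuousOn hcl
  have hfS : u (circ c r (γ S)) = 0 :=
    h.eq_zero hop (hcl (right_mem_Icc.2 hS0.le)) hSA.2
  obtain ⟨t, ht, htu⟩ : ∃ t ∈ Icc 0 S, u (circ c r (γ t)) = m / 4 := by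
    refine intermediate_value_Icc' hS0.le hf ⟨?_, ?_⟩
    · simp only [hfS]; positivity
    · have : γ 0 = θ₁ := by simp [hγ]
      simp only [this]; linarith
  have htS : t < S := by
    refine lt_of_le_of_ne ht.2 fun h0 => ?_
    rw [h0, hfS] at htu
    linarith
  have hγt : γ t ∈ Icc (-π) π := by
    have h0 := ht.1
    have h1 : t ≤ 1 := htS.le.trans hSA.1.2
    constructor
    · have : γ t = (1 - t) * θ₁ + t * θ₂ := by simp only [hγ]; ring
      nlinarith [h₁.1, h₂.1, mul_nonneg h0 (sub_nonneg.2 h₂.1),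
        mul_nonneg (sub_nonneg.2 h1) (sub_nonneg.2 h₁.1)]
    · have : γ t = (1 - t) * θ₁ + t * θ₂ := by simp only [hγ]; ring
      nlinarith [h₁.1, h₂.1, mul_nonneg h0 (sub_nonneg.2 h₂.2),
        mul_nonneg (sub_nonneg.2 h1) (sub_nonneg.2 h₁.2)]
  have harc : ∀ θ ∈ uIcc θ₁ (γ t), circ c r θ ∈ Ω := by
    intro θ hθ
    rw [← segment_eq_uIcc] at hθ
    obtain ⟨a, b, ha, hb, hab, rfl⟩ := hθ
    have : a • θ₁ + b • γ t = γ (b * t) := by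
      simp only [hγ, smul_eq_mul]
      rw [← eq_sub_iff_add_eq] at hab
      rw [hab]; ring
    rw [this]
    exact hlt _ (mul_nonneg hb ht.1) ((mul_le_of_le_one_left ht.1 (by linarith)).trans_lt htS)
  have hosc : m / 4 ≤ |u (circ c r θ₁) - u (circ c r (γ t))| := by
    rw [htu]
    exact le_trans (by linarith) (le_abs_self _)
  have hcd : ∀ x ∈ Ω, ContDiffAt ℝ 1 u x := fun x hx =>
    (h.contDiffAt hop hx).of_le (by norm_num)
  have hval : m ^ 2 / (32 * π) / r ^ 2 = (m / 4) ^ 2 / (2 * π * r ^ 2) := by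
    field_simp; norm_num
  rw [hval]
  rcases le_total θ₁ (γ t) with hle | hle
  · rw [uIcc_of_le hle] at harc
    rw [abs_sub_comm] at hosc
    exact lintegral_arc_ge hcd hr h₁ hγt hle (by positivity) harc hosc
  · rw [uIcc_of_ge hle] at harc
    exact lintegral_arc_ge hcd hr hγt h₁ hle (by positivity) harc hosc

/-- Polar coordinates about `c`. -/
lemma lintegral_circ {g : R2 → ENNReal} (hg : Measurable g) (c : R2) :
    ∫⁻ r in Ioi 0, ENNReal.ofReal r * ∫⁻ θ in Ioo (-π) π, g (circ c r θ) = ∫⁻ x, g x := by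
  have e1 := EuclideanSpace.volume_preserving_symm_measurableEquiv_toLp (Fin 2)
  have e2 := volume_preserving_finTwoArrow ℝ
  have hmeas : Measurable fun q : ℝ × ℝ => g (circ c q.1 q.2) := by
    refine hg.comp (Continuous.measurable ?_)
    unfold circ
    fun_prop
  calc ∫⁻ r in Ioi 0, ENNReal.ofReal r * ∫⁻ θ in Ioo (-π) π, g (circ c r θ)
      = ∫⁻ r in Ioi 0, ∫⁻ θ in Ioo (-π) π, ENNReal.ofReal r * g (circ c r θ) := by
        refine lintegral_congr fun r => ?_
        exact (lintegral_const_mul (f := fun θ => g (circ c r θ)) _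
          (hmeas.comp measurable_prodMk_left)).symm
    _ = ∫⁻ q in polarCoord.target, ENNReal.ofReal q.1 * g (circ c q.1 q.2) := by
        refine (setLIntegral_prod (fun q : ℝ × ℝ => ENNReal.ofReal q.1 * g (circ c q.1 q.2))
          (Measurable.aemeasurable ?_)).symm
        exact measurable_fst.ennreal_ofReal.mul hmeas
    _ = ∫⁻ q in polarCoord.target, ENNReal.ofReal q.1 •
          (fun z : ℝ × ℝ => g (!₂[z.1, z.2] + c)) (polarCoord.symm q) := by
        refine lintegral_congr fun q => ?_
        congr 2
        rw [circ]
        congr 1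
        ext i
        fin_cases i <;> simp [polarCoord]
    _ = ∫⁻ z : ℝ × ℝ, g (!₂[z.1, z.2] + c) :=
        lintegral_comp_polarCoord_symm fun z : ℝ × ℝ => g (!₂[z.1, z.2] + c)
    _ = ∫⁻ x, g (x + c) := by
        rw [← (e2.comp e1).lintegral_comp]
        · refine lintegral_congr fun x => ?_
          congr 2
          ext i
          fin_cases i <;> simp [MeasurableEquiv.finTwoArrow]
        · refine hg.comp (Continuous.measurable ?_)
          fun_prop
    _ = ∫⁻ x, g x := lintegral_add_right_eq_self g c

/-- If every circle about `c` of radius in `(7δ/8, δ)` carries angular mass at least `b / r²`,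
the total mass is at least `b / 8`. -/
lemma lintegral_ge_of_circ {g : R2 → ENNReal} (hg : Measurable g) {c : R2} {b δ : ℝ} (hδ : 0 < δ)
    (hb : 0 ≤ b) (h : ∀ r ∈ Ioo (7 * δ / 8) δ,
      ENNReal.ofReal (b / r ^ 2) ≤ ∫⁻ θ in Ioo (-π) π, g (circ c r θ)) :
    ENNReal.ofReal (b / 8) ≤ ∫⁻ x, g x := by
  rw [← lintegral_circ hg c]
  calc ENNReal.ofReal (b / 8) = ∫⁻ r in Ioo (7 * δ / 8) δ, ENNReal.ofReal (b / δ) := by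
        rw [lintegral_const, Measure.restrict_apply_univ, Real.volume_Ioo,
          ← ENNReal.ofReal_mul (by positivity)]
        congr 1
        field_simp
        norm_num
    _ ≤ ∫⁻ r in Ioo (7 * δ / 8) δ, ENNReal.ofReal r * ∫⁻ θ in Ioo (-π) π, g (circ c r θ) := by
        refine setLIntegral_mono' measurableSet_Ioo fun r hr => ?_
        have hr0 : 0 < r := lt_trans (by positivity) hr.1
        refine le_trans ?_ (mul_le_mul_right (h r hr) _)
        rw [← ENNReal.ofReal_mul hr0.le]
        refine ENNReal.ofReal_le_ofReal ?_
        have : r * (b / r ^ 2) = b / r := by field_simp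
        rw [this]
        exact div_le_div_of_nonneg_left hb hr0 hr.2.le
    _ ≤ _ := lintegral_mono_set fun r hr => lt_trans (by positivity) hr.1

/-- A solution whose maximum point is too close to the boundary has Dirichlet energy bounded
below. -/
lemma IsSolution.energy_ge_of_near_boundary {Ω : Set R2} (hop : IsOpen Ω)
    (hb : Bornology.IsBounded Ω) (hsm : SmoothBoundary Ω) :
    ∃ r₀ > 0, ∀ (p m : ℝ) (u : R2 → ℝ) (x : R2), 1 < p → IsSolution Ω p u → x ∈ Ω → 0 < m →
      u x = m → (∀ y ∈ Ω, |u y| ≤ m) → infDist x Ωᶜ < r₀ →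
      115 * (m ^ (p - 1) * (infDist x Ωᶜ / 8) ^ 2) ≤ 1 / 2 →
      IntegrableOn (fun y => ‖gradient u y‖ ^ 2) Ω →
      m ^ 2 / (256 * π) ≤ ∫ y in Ω, ‖gradient u y‖ ^ 2 := by
  obtain ⟨r₀, hr₀, hfr⟩ := hsm.exists_dist_eq hb
  refine ⟨r₀, hr₀, fun p m u x hp h hx hm hum hbd hlt hsmall hgint => ?_⟩
  have hne : (Ωᶜ).Nonempty := by
    rw [nonempty_compl]
    rintro rfl
    exact NormedSpace.unbounded_univ ℝ R2 hb
  obtain ⟨x₀, hx₀, hdist⟩ := hop.isClosed_compl.exists_infDist_eq_dist hne x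
  set δ := infDist x Ωᶜ with hδ
  have hδ0 : 0 < δ := by
    rw [hdist, dist_pos]
    rintro rfl
    exact hx₀ hx
  have hball : ball x δ ⊆ Ω := by
    intro y hy
    by_contra hcon
    have : infDist x Ωᶜ ≤ dist x y := infDist_le_dist_of_mem hcon
    rw [mem_ball, dist_comm] at hy
    linarith
  have hx₀f : x₀ ∈ frontier Ω := by
    rw [hop.frontier_eq]
    refine ⟨closure_mono hball ?_, hx₀⟩
    rw [closure_ball x hδ0.ne', mem_closedBall, dist_comm, hdist]
  have hclose : ∀ y ∈ closedBall x (δ / 8), m / 2 ≤ u y := by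
    intro y hy
    have hsub : closedBall x (4 * (δ / 8)) ⊆ Ω :=
      (closedBall_subset_ball (by linarith)).trans hball
    have hC : ∀ z ∈ closedBall x (4 * (δ / 8)), ContDiffAt ℝ 2 (fun w => m - u w) z := fun z hz =>
      contDiffAt_const.sub (h.contDiffAt hop (hsub hz))
    have := harnack (v := fun w => m - u w) (N := m ^ (p - 1) * m) (by positivity) hC
      (fun z hz => by have := (abs_le.1 (hbd z (hsub hz))).2; linarith)
      (fun z hz => by
        rw [lap_sub contDiffAt_const (h.contDiffAt hop (hsub hz)), lap_const, zero_sub, abs_neg,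
          h.lap_eq (hsub hz), abs_neg, abs_mul, abs_of_nonneg (by positivity)]
        exact mul_le_mul (Real.rpow_le_rpow (abs_nonneg _) (hbd z (hsub hz)) (by linarith))
          (hbd z (hsub hz)) (abs_nonneg _) (by positivity)) hy
    simp only [hum] at this
    have h2 : 115 * (m ^ (p - 1) * m * (δ / 8) ^ 2)
        = 115 * (m ^ (p - 1) * (δ / 8) ^ 2) * m := by ring
    rw [h2] at this
    have h3 := mul_le_mul_of_nonneg_right hsmall hm.le
    linarith
  have hgm : Measurable (Ω.indicator fun y => ENNReal.ofReal (‖gradient u y‖ ^ 2)) := by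
    refine Measurable.indicator ?_ hop.measurableSet
    simp only [norm_gradient]
    exact ((measurable_fderiv ℝ u).norm.pow_const 2).ennreal_ofReal
  have key := lintegral_ge_of_circ hgm (c := x₀) (b := m ^ 2 / (32 * π)) hδ0 (by positivity) ?_
  · rw [lintegral_indicator hop.measurableSet,
      ← ofReal_integral_eq_lintegral_ofReal hgint (Eventually.of_forall fun _ => sq_nonneg _),
      ENNReal.ofReal_le_ofReal_iff (integral_nonneg fun _ => sq_nonneg _)] at key
    convert key using 1
    field_simp
    norm_num
  · intro r hr
    have hr0 : 0 < r := lt_trans (by positivity) hr.1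
    obtain ⟨y₂, hy₂, hdy₂⟩ := hfr x₀ hx₀f r hr0 (hr.2.trans hlt)
    set y₁ : R2 := (r / δ) • (x - x₀) + x₀ with hy₁
    have hn : ‖x - x₀‖ = δ := by rw [← dist_eq_norm, hdist]
    have hdy₁ : dist y₁ x₀ = r := by
      rw [dist_eq_norm, hy₁, add_sub_cancel_right, norm_smul, hn, Real.norm_eq_abs,
        abs_of_pos (by positivity)]
      field_simp
    have hy₁m : y₁ ∈ closedBall x (δ / 8) := by
      have : y₁ - x = (r / δ - 1) • (x - x₀) := by rw [hy₁]; module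
      rw [mem_closedBall, dist_eq_norm, this, norm_smul, hn, Real.norm_eq_abs, abs_of_nonpos]
      · have : -(r / δ - 1) * δ = δ - r := by field_simp; ring
        rw [this]; linarith [hr.1]
      · rw [sub_nonpos, div_le_one hδ0]; exact hr.2.le
    obtain ⟨θ₁, hθ₁, he₁⟩ := exists_circ x₀ y₁
    obtain ⟨θ₂, hθ₂, he₂⟩ := exists_circ x₀ y₂
    rw [hdy₁] at he₁
    rw [hdy₂] at he₂
    refine h.lintegral_circ_ge hop hr0 hm hθ₁ hθ₂ ?_ ?_ ?_
    · rw [← he₁]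
      exact hball (closedBall_subset_ball (by linarith) hy₁m)
    · rw [← he₂]
      rw [hop.frontier_eq] at hy₂
      exact hy₂.2
    · rw [← he₁]
      exact hclose y₁ hy₁m

/-- The rescaled nonlinearity `|1 + t/p|^(p-1) (1 + t/p)`, which tends to `exp t`. -/
def nl (p t : ℝ) : ℝ := |1 + t / p| ^ (p - 1) * (1 + t / p)

section Rescaling
variable {Ω : Set R2} {u : ℝ → R2 → ℝ} {xp : ℝ → R2} {p : ℝ} {x : R2}

lemma zp_zero : zp u xp p 0 = 0 := by simp [zp]

lemma one_add_zp_div (hp : 1 < p) (hm : 0 < u p (xp p)) :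
    1 + zp u xp p x / p = u p (eps u xp p • x + xp p) / u p (xp p) := by
  have : p ≠ 0 := by positivity
  unfold zp
  field_simp
  ring

lemma eps_pos (hp : 1 < p) (hm : 0 < u p (xp p)) : 0 < eps u xp p := by
  unfold eps
  positivity

lemma eps_sq (hp : 1 < p) (hm : 0 < u p (xp p)) :
    eps u xp p ^ 2 = 1 / (p * u p (xp p) ^ (p - 1)) := by
  unfold eps
  rw [div_pow, one_pow, Real.sq_sqrt (by positivity)]

lemma contDiffAt_zp (hop : IsOpen Ω) (h : IsSolution Ω p (u p))
    (hx : eps u xp p • x + xp p ∈ Ω) : ContDiffAt ℝ 2 (zp u xp p) x := by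
  unfold zp
  refine contDiffAt_const.mul (ContDiffAt.sub ?_ contDiffAt_const)
  exact ContDiffAt.comp (f := fun y : R2 => eps u xp p • y + xp p) x (h.contDiffAt hop hx)
    (by fun_prop)

lemma lap_zp (hop : IsOpen Ω) (h : IsSolution Ω p (u p)) (hp : 1 < p) (hm : 0 < u p (xp p))
    (hx : eps u xp p • x + xp p ∈ Ω) : -lap (zp u xp p) x = nl p (zp u xp p x) := by
  have hc : ContDiffAt ℝ 2 (fun y => u p (eps u xp p • y + xp p)) x :=
    ContDiffAt.comp (f := fun y : R2 => eps u xp p • y + xp p) x (h.contDiffAt hop hx)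
      (by fun_prop)
  have h1 : lap (zp u xp p) x = p / u p (xp p) *
      (eps u xp p ^ 2 * lap (u p) (eps u xp p • x + xp p)) := by
    unfold zp
    rw [lap_const_mul (hc.sub contDiffAt_const), lap_sub hc contDiffAt_const, lap_const, sub_zero,
      lap_comp_affine (h.contDiffAt hop hx)]
  have h2 : 0 < u p (xp p) ^ (p - 1) := by positivity
  rw [h1, h.lap_eq hx, eps_sq hp hm, nl, one_add_zp_div hp hm, abs_div, abs_of_pos hm,
    Real.div_rpow (abs_nonneg _) hm.le]
  have : p ≠ 0 := by positivity
  field_simp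

lemma zp_mass_le (hop : IsOpen Ω) (hb : Bornology.IsBounded Ω) (h : IsSolution Ω p (u p))
    (hp : 1 < p) (hm : 1 / 2 ≤ u p (xp p)) (hum : ∀ x ∈ Ω, |u p x| ≤ u p (xp p))
    (hgint : IntegrableOn (fun x => ‖gradient (u p) x‖ ^ 2) Ω) {R : ℝ}
    (hΩ : ∀ x ∈ closedBall 0 R, eps u xp p • x + xp p ∈ Ω)
    (hlow : ∀ x ∈ closedBall 0 R, -(p / 2) ≤ zp u xp p x) :
    ∫ x in closedBall 0 R, nl p (zp u xp p x)
      ≤ 96 * (p * ∫ x in Ω, ‖gradient (u p) x‖ ^ 2) := by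
  have hm0 : 0 < u p (xp p) := by linarith
  have hp0 : 0 < p := by positivity
  set m := u p (xp p) with hmdef
  set ε := eps u xp p with hε
  have hε0 : 0 < ε := eps_pos hp hm0
  have hε2 : ε ^ 2 = 1 / (p * m ^ (p - 1)) := eps_sq hp hm0
  set S : Set R2 := {x | x ∈ Ω ∧ m / 2 ≤ u p x} with hS
  have hSc : IsCompact S := h.isCompact_superlevel hop hb (by positivity)
  set f : R2 → ℝ := S.indicator fun x => |u p x| ^ (p - 1) * u p x with hf
  have hfS : IntegrableOn (fun x => |u p x| ^ (p - 1) * u p x) S :=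
    ((h.continuousOn_rhs hp).mono fun x hx => subset_closure hx.1).integrableOn_compact hSc
  have hfi : Integrable f := hfS.integrable_indicator hSc.measurableSet
  have hf0 : ∀ x, 0 ≤ f x := fun x => indicator_nonneg (fun y hy => by
    have : 0 ≤ u p y := le_trans (by positivity) hy.2
    positivity) x
  have h1m : 0 < m ^ (p - 1) := by positivity
  have heq : ∀ x ∈ closedBall (0 : R2) R,
      nl p (zp u xp p x) = (m ^ (p - 1) * m)⁻¹ * f (ε • x + xp p) := by
    intro x hx
    have h1 := one_add_zp_div (x := x) hp hm0
    rw [← hε] at h1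
    have h2 : ε • x + xp p ∈ S := by
      refine ⟨hΩ x hx, ?_⟩
      have h3 : 1 / 2 ≤ 1 + zp u xp p x / p := by
        have := div_le_div_of_nonneg_right (hlow x hx) hp0.le
        have h4 : -(p / 2) / p = -(1 / 2) := by field_simp
        linarith
      rw [h1, le_div_iff₀ hm0] at h3
      simp only [hmdef]
      linarith
    rw [hf, indicator_of_mem h2, nl, h1, abs_div, abs_of_pos hm0,
      Real.div_rpow (abs_nonneg _) hm0.le]
    simp only [← hmdef]
    field_simp
  have hgi : Integrable fun x => (m ^ (p - 1) * m)⁻¹ * f (ε • x + xp p) :=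
    ((hfi.comp_add_right (xp p)).comp_smul hε0.ne').const_mul _
  calc ∫ x in closedBall 0 R, nl p (zp u xp p x)
      = ∫ x in closedBall 0 R, (m ^ (p - 1) * m)⁻¹ * f (ε • x + xp p) :=
        setIntegral_congr_fun measurableSet_closedBall heq
    _ ≤ ∫ x, (m ^ (p - 1) * m)⁻¹ * f (ε • x + xp p) :=
        setIntegral_le_integral hgi (Eventually.of_forall fun x =>
          mul_nonneg (by positivity) (hf0 _))
    _ = p / m * ∫ x in S, |u p x| ^ (p - 1) * u p x := by
        rw [integral_const_mul, integral_comp_affine f (xp p) hε0, hε2, hf,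
          integral_indicator hSc.measurableSet]
        field_simp
    _ ≤ p / m * (24 / m * ∫ x in Ω, ‖gradient (u p) x‖ ^ 2) := by
        refine mul_le_mul_of_nonneg_left ?_ (by positivity)
        exact h.mass_le hop hb hp hm0 hum hgint
    _ = 24 / m ^ 2 * (p * ∫ x in Ω, ‖gradient (u p) x‖ ^ 2) := by field_simp
    _ ≤ 96 * (p * ∫ x in Ω, ‖gradient (u p) x‖ ^ 2) := by
        refine mul_le_mul_of_nonneg_right ?_
          (mul_nonneg hp0.le (integral_nonneg fun _ => sq_nonneg _))
        rw [div_le_iff₀ (by positivity)]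
        nlinarith
end Rescaling

/-- Everything needed of the rescaled functions on a ball of radius `R`. -/
structure RescaledOn (Ω : Set R2) (u : ℝ → R2 → ℝ) (xp : ℝ → R2) (C R p : ℝ) : Prop where
  one_lt : 1 < p
  mem : ∀ x ∈ closedBall (0 : R2) R, eps u xp p • x + xp p ∈ Ω
  contDiffAt : ∀ x ∈ closedBall (0 : R2) R, ContDiffAt ℝ 2 (zp u xp p) x
  nonpos : ∀ x ∈ closedBall (0 : R2) R, zp u xp p x ≤ 0
  lower : ∀ x ∈ closedBall (0 : R2) R, -(115 * R ^ 2) ≤ zp u xp p x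
  lap_eq : ∀ x ∈ closedBall (0 : R2) R, -lap (zp u xp p) x = nl p (zp u xp p x)
  mass : ∫ x in closedBall 0 R, nl p (zp u xp p x) ≤ C

theorem exists_eventually_rescaledOn {Ω : Set R2} (hop : IsOpen Ω)
    (hbdd : Bornology.IsBounded Ω) (hsm : SmoothBoundary Ω) {u : ℝ → R2 → ℝ}
    (hsol : ∀ p > (1 : ℝ), IsSolution Ω p (u p)) {xp : ℝ → R2} (hmem : ∀ p > (1 : ℝ), xp p ∈ Ω)
    (hpos : ∀ p > (1 : ℝ), 0 < u p (xp p)) (hum : ∀ p > (1 : ℝ), ∀ x ∈ Ω, |u p x| ≤ u p (xp p))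
    (hA : CondA Ω u) : ∃ C, ∀ R > 0, ∀ᶠ p in atTop, RescaledOn Ω u xp C R p := by
  set E : ℝ → ℝ := fun p => ∫ x in Ω, ‖gradient (u p) x‖ ^ 2 with hE
  obtain ⟨D, hD0, hD⟩ : ∃ D > 0, Ω ⊆ closedBall 0 D := by
    obtain ⟨D, hD⟩ := hbdd.subset_closedBall 0
    exact ⟨max D 1, by positivity, hD.trans (closedBall_subset_closedBall (le_max_left _ _))⟩
  have hgrow : ∀ p > (1 : ℝ), 4 / D ^ 2 ≤ u p (xp p) ^ (p - 1) := fun p hp => by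
    rw [div_le_iff₀ (by positivity)]
    exact (hsol p hp).le_max hop hp (hpos p hp) (hum p hp) hD (hmem p hp) rfl
  have hL : 0 < 16 * π * Real.exp 1 := by positivity
  have hpE : ∀ᶠ p in atTop, p * E p < 16 * π * Real.exp 1 + 1 :=
    hA.eventually_lt_const (lt_add_one _)
  have hgint : ∀ᶠ p in atTop, IntegrableOn (fun x => ‖gradient (u p) x‖ ^ 2) Ω := by
    filter_upwards [hA.eventually_const_lt hL] with p hp
    by_contra hcon
    rw [integral_undef hcon, mul_zero] at hp
    exact lt_irrefl _ hp
  have hE0 : Tendsto E atTop (𝓝 0) := by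
    have h1 := hA.mul tendsto_inv_atTop_zero
    rw [mul_zero] at h1
    refine h1.congr' ?_
    filter_upwards [eventually_gt_atTop 0] with p hp
    field_simp
    rfl
  have hhalf : ∀ᶠ p in atTop, 1 / 2 ≤ u p (xp p) := by
    have h1 : Tendsto (fun p : ℝ => (1 / 2 : ℝ) ^ (p - 1)) atTop (𝓝 0) :=
      (tendsto_rpow_atTop_of_base_lt_one _ (by norm_num) (by norm_num)).comp
        (tendsto_atTop_add_const_right _ _ tendsto_id)
    filter_upwards [h1.eventually_lt_const (show (0 : ℝ) < 4 / D ^ 2 by positivity),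
      eventually_gt_atTop 1] with p h2 hp
    by_contra! hcon
    have := Real.rpow_le_rpow (hpos p hp).le hcon.le (show 0 ≤ p - 1 by linarith)
    linarith [hgrow p hp]
  obtain ⟨r₀, hr₀, hnear⟩ := IsSolution.energy_ge_of_near_boundary hop hbdd hsm
  have hball : ∀ R > 0, ∀ᶠ p in atTop, R * eps u xp p < infDist (xp p) Ωᶜ := by
    intro R hR
    filter_upwards [eventually_gt_atTop 1, hgint, hhalf,
      hE0.eventually_lt_const (show (0 : ℝ) < 1 / (1024 * π) by positivity),
      eventually_gt_atTop (115 * R ^ 2 / 32), eventually_gt_atTop (R ^ 2 * D ^ 2 / (4 * r₀ ^ 2))]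
      with p hp hi hh hEs hp1 hp2
    by_contra! hcon
    have hm := hpos p hp
    have hε := eps_pos hp hm
    have hε2 := eps_sq hp hm
    have hp0 : 0 < p := by positivity
    have hm1 : 0 < u p (xp p) ^ (p - 1) := by positivity
    have hδ0 : 0 ≤ infDist (xp p) Ωᶜ := infDist_nonneg
    have hsq : infDist (xp p) Ωᶜ ^ 2 ≤ R ^ 2 / (p * u p (xp p) ^ (p - 1)) := by
      calc infDist (xp p) Ωᶜ ^ 2 ≤ (R * eps u xp p) ^ 2 := by gcongr
        _ = _ := by rw [mul_pow, hε2]; ring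
    have hlt : infDist (xp p) Ωᶜ < r₀ := by
      refine lt_of_pow_lt_pow_left₀ 2 hr₀.le (hsq.trans_lt ?_)
      rw [div_lt_iff₀ (by positivity)]
      rw [div_lt_iff₀ (by positivity)] at hp2
      have h4 := hgrow p hp
      rw [div_le_iff₀ (by positivity)] at h4
      have h5 : R ^ 2 * D ^ 2 < r₀ ^ 2 * (p * u p (xp p) ^ (p - 1)) * D ^ 2 := by
        have : p * r₀ ^ 2 * 4 ≤ p * r₀ ^ 2 * (u p (xp p) ^ (p - 1) * D ^ 2) := by gcongr
        linarith
      exact lt_of_mul_lt_mul_right h5 (by positivity)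
    have hsmall : 115 * (u p (xp p) ^ (p - 1) * (infDist (xp p) Ωᶜ / 8) ^ 2) ≤ 1 / 2 := by
      rw [le_div_iff₀ (by positivity)] at hsq
      rw [div_lt_iff₀ (by positivity)] at hp1
      have h5 : 115 * (u p (xp p) ^ (p - 1) * (infDist (xp p) Ωᶜ / 8) ^ 2) * p ≤ 1 / 2 * p := by
        linarith
      exact le_of_mul_le_mul_right h5 hp0
    have h6 := hnear p _ (u p) (xp p) hp (hsol p hp) (hmem p hp) hm rfl (hum p hp) hlt hsmall hi
    have h7 : 1 / (1024 * π) ≤ u p (xp p) ^ 2 / (256 * π) := by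
      rw [div_le_div_iff₀ (by positivity) (by positivity)]
      have : (1 / 2 : ℝ) ^ 2 ≤ u p (xp p) ^ 2 := by gcongr
      have := mul_le_mul_of_nonneg_right this Real.pi_pos.le
      linarith
    simp only [hE] at hEs
    linarith
  refine ⟨96 * (16 * π * Real.exp 1 + 1), fun R hR => ?_⟩
  filter_upwards [eventually_gt_atTop 1, hgint, hhalf, hpE, hball (4 * R) (by positivity),
    eventually_ge_atTop (2 * (115 * R ^ 2))] with p hp hi hh hpe hb hpl
  have hm := hpos p hp
  have hε := eps_pos hp hm
  have hp0 : 0 < p := by positivity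
  have hbig : ∀ x ∈ closedBall (0 : R2) (4 * R), eps u xp p • x + xp p ∈ Ω := by
    intro x hx
    by_contra hcon
    have h1 : infDist (xp p) Ωᶜ ≤ _ := infDist_le_dist_of_mem hcon
    rw [dist_comm, dist_eq_norm, add_sub_cancel_right, norm_smul, Real.norm_eq_abs,
      abs_of_pos hε] at h1
    rw [mem_closedBall_zero_iff] at hx
    have := mul_le_mul_of_nonneg_left hx hε.le
    linarith
  have hsub : closedBall (0 : R2) R ⊆ closedBall 0 (4 * R) :=
    closedBall_subset_closedBall (by linarith)
  have hone : ∀ x ∈ closedBall (0 : R2) (4 * R), |1 + zp u xp p x / p| ≤ 1 := by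
    intro x hx
    rw [one_add_zp_div hp hm, abs_div, abs_of_pos hm, div_le_one hm]
    exact hum p hp _ (hbig x hx)
  have hnp : ∀ x ∈ closedBall (0 : R2) (4 * R), zp u xp p x ≤ 0 := by
    intro x hx
    have h1 := (abs_le.1 (hone x hx)).2
    have h2 : zp u xp p x / p ≤ 0 := by linarith
    rw [div_le_iff₀ hp0] at h2
    linarith
  have hlow : ∀ x ∈ closedBall (0 : R2) R, -(115 * R ^ 2) ≤ zp u xp p x := by
    intro x hx
    have := harnack (v := fun y => -zp u xp p y) (c := 0) (N := 1) hR
      (fun y hy => (contDiffAt_zp hop (hsol p hp) (hbig y hy)).neg)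
      (fun y hy => by linarith [hnp y hy])
      (fun y hy => by
        rw [lap_neg (contDiffAt_zp hop (hsol p hp) (hbig y hy)),
          lap_zp hop (hsol p hp) hp hm (hbig y hy), nl, abs_mul, abs_of_nonneg (by positivity)]
        exact mul_le_one₀ (Real.rpow_le_one (abs_nonneg _) (hone y hy) (by linarith))
          (abs_nonneg _) (hone y hy)) hx
    simp only [zp_zero] at this
    linarith
  exact
    { one_lt := hp
      mem := fun x hx => hbig x (hsub hx)
      contDiffAt := fun x hx => contDiffAt_zp hop (hsol p hp) (hbig x (hsub hx))
      nonpos := fun x hx => hnp x (hsub hx)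
      lower := hlow
      lap_eq := fun x hx => lap_zp hop (hsol p hp) hp hm (hbig x (hsub hx))
      mass := (zp_mass_le hop hbdd (hsol p hp) hp hh (hum p hp) hi
        (fun x hx => hbig x (hsub hx)) fun x hx => by linarith [hlow x hx]).trans
          (mul_le_mul_of_nonneg_left hpe.le (by norm_num)) }

section UniformConvergence
variable {ι : Type*} {l : Filter ι} {F : Type*} [NormedAddCommGroup F]

/-- Uniform convergence on balls. -/
def UTendsto (l : Filter ι) (G : ι → R2 → F) (g : R2 → F) : Prop :=
  ∀ R : ℝ, ∀ ε > 0, ∀ᶠ i in l, ∀ x ∈ closedBall (0 : R2) R, ‖G i x - g x‖ ≤ ε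

/-- Uniform Cauchy condition on balls. -/
def UCauchy (l : Filter ι) (G : ι → R2 → F) : Prop :=
  ∀ R : ℝ, ∀ ε > 0, ∀ᶠ q in l ×ˢ l, ∀ x ∈ closedBall (0 : R2) R, ‖G q.1 x - G q.2 x‖ ≤ ε

lemma UTendsto.tendsto {G : ι → R2 → F} {g : R2 → F} (h : UTendsto l G g) (x : R2) :
    Tendsto (fun i => G i x) l (𝓝 (g x)) := by
  rw [Metric.tendsto_nhds]
  intro ε hε
  filter_upwards [h ‖x‖ (ε / 2) (by positivity)] with i hi
  rw [dist_eq_norm]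
  linarith [hi x (by simp)]

lemma UTendsto.tendstoUniformlyOn {G : ι → R2 → F} {g : R2 → F} (h : UTendsto l G g) (R : ℝ) :
    TendstoUniformlyOn G g l (closedBall 0 R) := by
  rw [Metric.tendstoUniformlyOn_iff]
  intro ε hε
  filter_upwards [h R (ε / 2) (by positivity)] with i hi x hx
  rw [dist_comm, dist_eq_norm]
  linarith [hi x hx]

lemma UTendsto.uCauchy {G : ι → R2 → F} {g : R2 → F} (h : UTendsto l G g) : UCauchy l G := by
  intro R ε hε
  filter_upwards [(h R (ε / 2) (by positivity)).prod_mk (h R (ε / 2) (by positivity))]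
    with q hq x hx
  calc ‖G q.1 x - G q.2 x‖ = ‖(G q.1 x - g x) - (G q.2 x - g x)‖ := by congr 1; abel
    _ ≤ ‖G q.1 x - g x‖ + ‖G q.2 x - g x‖ := norm_sub_le _ _
    _ ≤ ε := by linarith [hq.1 x hx, hq.2 x hx]

lemma UCauchy.exists_uTendsto [CompleteSpace F] [l.NeBot] {G : ι → R2 → F} (h : UCauchy l G) :
    ∃ g, UTendsto l G g := by
  have h1 : ∀ x, ∃ y, Tendsto (fun i => G i x) l (𝓝 y) := by
    intro x
    refine cauchy_iff_exists_le_nhds.1 ?_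
    rw [cauchy_map_iff]
    refine ⟨inferInstance, ?_⟩
    rw [Metric.uniformity_basis_dist_le.tendsto_right_iff]
    intro ε hε
    filter_upwards [h ‖x‖ ε hε] with q hq
    simpa [dist_eq_norm] using hq x (by simp)
  choose g hg using h1
  refine ⟨g, fun R ε hε => ?_⟩
  filter_upwards [(h R ε hε).curry] with i hi x hx
  refine le_of_tendsto ((tendsto_const_nhds (x := G i x)).sub (hg x)).norm ?_
  filter_upwards [hi] with j hj
  exact hj x hx

lemma UTendsto.continuous [l.NeBot] {G : ι → R2 → F} {g : R2 → F} (h : UTendsto l G g)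
    (hG : ∀ R : ℝ, ∀ᶠ i in l, ContinuousOn (G i) (closedBall 0 R)) : Continuous g := by
  rw [continuous_iff_continuousAt]
  intro x
  have := (h.tendstoUniformlyOn (‖x‖ + 1)).continuousOn (hG (‖x‖ + 1)).frequently
  refine this.continuousAt (closedBall_mem_nhds_of_mem ?_)
  simp

variable [NormedSpace ℝ F]

lemma UTendsto.hasFDerivAt [l.NeBot] {G : ι → R2 → F} {g : R2 → F} {g' : R2 → R2 →L[ℝ] F}
    (h : UTendsto l G g) (h' : UTendsto l (fun i => fderiv ℝ (G i)) g')
    (hd : ∀ R : ℝ, ∀ᶠ i in l, ∀ x ∈ closedBall (0 : R2) R, DifferentiableAt ℝ (G i) x) (x : R2) :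
    HasFDerivAt g (g' x) x := by
  have hx : closedBall (0 : R2) (‖x‖ + 1) ∈ 𝓝 x := closedBall_mem_nhds_of_mem (by simp)
  refine hasFDerivAt_of_tendstoUniformlyOnFilter (l := l) (f := G)
    (f' := fun i => fderiv ℝ (G i)) ?_ ?_ (Eventually.of_forall h.tendsto)
  · have := h'.tendstoUniformlyOn (‖x‖ + 1)
    rw [tendstoUniformlyOn_iff_tendstoUniformlyOnFilter] at this
    exact this.mono_right (le_principal_iff.2 hx)
  · filter_upwards [(hd (‖x‖ + 1)).prod_mk hx] with q hq
    exact (hq.1 _ hq.2).hasFDerivAt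

lemma uCauchy_fderiv {w : ι → R2 → ℝ}
    (hC : ∀ R : ℝ, ∀ᶠ i in l, ∀ x ∈ closedBall (0 : R2) R, ContDiffAt ℝ 2 (w i) x)
    (hw : UCauchy l w) (hlw : UCauchy l fun i => lap (w i)) :
    UCauchy l fun i => fderiv ℝ (w i) := by
  intro R ε hε
  have hC' := (hC (R + 2)).prod_mk (hC (R + 2))
  filter_upwards [hC', hw (R + 2) (ε / 5) (by positivity), hlw (R + 2) (ε / 5) (by positivity)]
    with q hq h1 h2 x hx
  have hR : closedBall x (2 * 1) ⊆ closedBall (0 : R2) (R + 2) :=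
    closedBall_subset_closedBall' (by rw [mem_closedBall] at hx; linarith)
  have key := norm_fderiv_le_of_bounds (w := fun y => w q.1 y - w q.2 y) (c := x) one_pos
    (fun y hy => (hq.1 y (hR hy)).sub (hq.2 y (hR hy)))
    (fun y hy => h1 y (hR hy))
    (fun y hy => by
      rw [lap_sub (hq.1 y (hR hy)) (hq.2 y (hR hy))]
      exact h2 y (hR hy))
  have hx' := hR (mem_closedBall_self (by norm_num) : x ∈ closedBall x (2 * 1))
  rw [fderiv_fun_sub ((hq.1 x hx').differentiableAt (by norm_num))
    ((hq.2 x hx').differentiableAt (by norm_num))] at key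
  linarith

lemma uCauchy_fderiv_fderiv {w : ι → R2 → ℝ}
    (hC : ∀ R : ℝ, ∀ᶠ i in l, ∀ x ∈ closedBall (0 : R2) R, ContDiffAt ℝ 2 (w i) x)
    (hD : ∀ R : ℝ, ∀ᶠ i in l, ∀ x ∈ closedBall (0 : R2) R, DifferentiableAt ℝ (lap (w i)) x)
    (hw : UCauchy l fun i => fderiv ℝ (w i)) (hlw : UCauchy l fun i => fderiv ℝ (lap (w i))) :
    UCauchy l fun i => fderiv ℝ (fderiv ℝ (w i)) := by
  intro R ε hε
  have hC' := (hC (R + 4)).prod_mk (hC (R + 4))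
  have hD' := (hD (R + 4)).prod_mk (hD (R + 4))
  filter_upwards [hC', hD', hw (R + 4) (ε / 10) (by positivity),
    hlw (R + 4) (ε / 10) (by positivity)] with q hq hq' h1 h2 x hx
  have hR : closedBall x (3 * 1) ⊆ closedBall (0 : R2) (R + 4) :=
    closedBall_subset_closedBall' (by rw [mem_closedBall] at hx; linarith)
  have hnear : ∀ y ∈ closedBall x (3 * 1), closedBall (0 : R2) (R + 4) ∈ 𝓝 y := fun y hy =>
    closedBall_mem_nhds_of_mem (by
      rw [mem_closedBall] at hx hy
      have := dist_triangle y x 0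
      rw [mem_ball]
      linarith)
  have hsub : ∀ y ∈ closedBall x (3 * 1), lap (fun y => w q.1 y - w q.2 y) =ᶠ[𝓝 y]
      fun y => lap (w q.1) y - lap (w q.2) y := fun y hy => by
    filter_upwards [hnear y hy] with z hz
    exact lap_sub (hq.1 z hz) (hq.2 z hz)
  have hfd : ∀ y ∈ closedBall (0 : R2) (R + 4), fderiv ℝ (fun y => w q.1 y - w q.2 y) y =
      fderiv ℝ (w q.1) y - fderiv ℝ (w q.2) y := fun y hy =>
    fderiv_fun_sub ((hq.1 y hy).differentiableAt (by norm_num))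
      ((hq.2 y hy).differentiableAt (by norm_num))
  have key := norm_fderiv_fderiv_le_of_bounds (w := fun y => w q.1 y - w q.2 y) (c := x) one_pos
    (M := ε / 10) (N := ε / 10)
    (fun y hy => (hq.1 y (hR hy)).sub (hq.2 y (hR hy)))
    (fun y hy => ((hq'.1 y (hR hy)).sub (hq'.2 y (hR hy))).congr_of_eventuallyEq (hsub y hy))
    (fun y hy => by
      rw [hfd y (hR hy)]
      exact h1 y (hR hy))
    (fun y hy => by
      rw [(hsub y hy).fderiv_eq, fderiv_fun_sub (hq'.1 y (hR hy)) (hq'.2 y (hR hy))]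
      exact h2 y (hR hy))
  have hx0 : x ∈ closedBall x (3 * 1) := mem_closedBall_self (by norm_num)
  have hfd' : fderiv ℝ (fun y => w q.1 y - w q.2 y) =ᶠ[𝓝 x]
      fun y => fderiv ℝ (w q.1) y - fderiv ℝ (w q.2) y := by
    filter_upwards [hnear x hx0] with z hz
    exact hfd z hz
  rw [hfd'.fderiv_eq, fderiv_fun_sub
    ((hq.1 x (hR hx0)).fderiv_one.differentiableAt (by norm_num))
    ((hq.2 x (hR hx0)).fderiv_one.differentiableAt (by norm_num))] at key
  linarith

/-- Local uniform limits, together with their Laplacians and the gradients of these, converge in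
`C²`. -/
theorem UTendsto.contDiff_two [l.NeBot] {w : ι → R2 → ℝ} {v f : R2 → ℝ} {f' : R2 → R2 →L[ℝ] ℝ}
    (hC : ∀ R : ℝ, ∀ᶠ i in l, ∀ x ∈ closedBall (0 : R2) R, ContDiffAt ℝ 2 (w i) x)
    (hD : ∀ R : ℝ, ∀ᶠ i in l, ∀ x ∈ closedBall (0 : R2) R, DifferentiableAt ℝ (lap (w i)) x)
    (hw : UTendsto l w v) (hf : UTendsto l (fun i => lap (w i)) f)
    (hf' : UTendsto l (fun i => fderiv ℝ (lap (w i))) f') :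
    ContDiff ℝ 2 v ∧ (∀ x, lap v x = f x) ∧ UTendsto l (fun i => fderiv ℝ (w i)) (fderiv ℝ v) ∧
      UTendsto l (fun i => fderiv ℝ (fderiv ℝ (w i))) (fderiv ℝ (fderiv ℝ v)) := by
  have hc1 := uCauchy_fderiv hC hw.uCauchy hf.uCauchy
  have hc2 := uCauchy_fderiv_fderiv hC hD hc1 hf'.uCauchy
  obtain ⟨g₁, hg₁⟩ := hc1.exists_uTendsto
  obtain ⟨g₂, hg₂⟩ := hc2.exists_uTendsto
  have hd1 := hw.hasFDerivAt hg₁ fun R => by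
    filter_upwards [hC R] with i hi x hx
    exact (hi x hx).differentiableAt (by norm_num)
  have hd2 := hg₁.hasFDerivAt hg₂ fun R => by
    filter_upwards [hC R] with i hi x hx
    exact (hi x hx).fderiv_one.differentiableAt (by norm_num)
  have hcont : Continuous g₂ := hg₂.continuous fun R => by
    filter_upwards [hC R] with i hi x hx
    have : ContDiffAt ℝ 0 (fderiv ℝ (fderiv ℝ (w i))) x :=
      (hi x hx).fderiv_one.fderiv_right (by norm_num)
    exact this.continuousAt.continuousWithinAt
  have he1 : fderiv ℝ v = g₁ := funext fun x => (hd1 x).fderiv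
  have he2 : fderiv ℝ g₁ = g₂ := funext fun x => (hd2 x).fderiv
  have hg1C : ContDiff ℝ 1 g₁ :=
    contDiff_one_iff_fderiv.2 ⟨fun x => (hd2 x).differentiableAt, by rwa [he2]⟩
  have hvC : ContDiff ℝ 2 v := by
    rw [show (2 : WithTop ℕ∞) = 1 + 1 by norm_num, contDiff_succ_iff_fderiv]
    exact ⟨fun x => (hd1 x).differentiableAt, by simp, by rwa [he1]⟩
  refine ⟨hvC, fun x => ?_, by rwa [he1], by rwa [he1, he2]⟩
  have hlap : ∀ {u : R2 → ℝ}, ContDiffAt ℝ 2 u x → lap u x =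
      ∑ i : Fin 2, fderiv ℝ (fderiv ℝ u) x (EuclideanSpace.single i 1)
        (EuclideanSpace.single i 1) := by
    intro u hu
    unfold lap
    refine Finset.sum_congr rfl fun i _ => ?_
    rw [fderiv_clm_apply (hu.fderiv_one.differentiableAt (by norm_num))
      (differentiableAt_const _)]
    simp
  have h1 : Tendsto (fun i => lap (w i) x) l (𝓝 (lap v x)) := by
    rw [hlap hvC.contDiffAt, he1, he2]
    have h2 : Tendsto (fun i => ∑ j : Fin 2, fderiv ℝ (fderiv ℝ (w i)) x
        (EuclideanSpace.single j 1) (EuclideanSpace.single j 1)) l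
        (𝓝 (∑ j : Fin 2, g₂ x (EuclideanSpace.single j 1) (EuclideanSpace.single j 1))) :=
      tendsto_finsetSum _ fun j _ => by
        have h3 : Continuous fun A : R2 →L[ℝ] R2 →L[ℝ] ℝ =>
          A (EuclideanSpace.single j 1) (EuclideanSpace.single j 1) := by fun_prop
        exact (h3.tendsto _).comp (hg₂.tendsto x)
    refine h2.congr' ?_
    filter_upwards [hC ‖x‖] with i hi
    exact (hlap (hi x (by simp))).symm
  exact tendsto_nhds_unique h1 (hf.tendsto x)

/-- Difference quotients of a `C¹` map converge locally uniformly. -/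
lemma uTendsto_differenceQuotient {f : R2 → F} (hf : ContDiff ℝ 1 f) (e : R2) :
    UTendsto (𝓝[≠] (0 : ℝ)) (fun t x => t⁻¹ • (f (t • e + x) - f x)) (fun x => fderiv ℝ f x e) := by
  intro R ε hε
  have hcont : Continuous (fderiv ℝ f) := hf.continuous_fderiv (by norm_num)
  have huc : UniformContinuousOn (fderiv ℝ f) (closedBall (0 : R2) (R + 1)) :=
    (isCompact_closedBall _ _).uniformContinuousOn_of_continuous hcont.continuousOn
  rw [Metric.uniformContinuousOn_iff] at huc
  obtain ⟨δ, hδ, hδ'⟩ := huc (ε / (‖e‖ + 1)) (by positivity)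
  have hsmall : ∀ᶠ t in 𝓝[≠] (0 : ℝ), |t| * (‖e‖ + 1) < min δ 1 := by
    have : Tendsto (fun t : ℝ => |t| * (‖e‖ + 1)) (𝓝 0) (𝓝 0) := by
      have h : Continuous fun t : ℝ => |t| * (‖e‖ + 1) := by fun_prop
      simpa using h.tendsto 0
    exact (this.eventually_lt_const (by positivity)).filter_mono nhdsWithin_le_nhds
  filter_upwards [hsmall, self_mem_nhdsWithin] with t ht ht0 x hx
  have ht0' : 0 < |t| := abs_pos.2 ht0
  have hte : ‖t • e‖ < min δ 1 := by
    rw [norm_smul, Real.norm_eq_abs]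
    nlinarith
  rw [mem_closedBall_zero_iff] at hx
  set s := closedBall x ‖t • e‖ with hs
  have key : ‖(f (t • e + x) - fderiv ℝ f x (t • e + x)) - (f x - fderiv ℝ f x x)‖
      ≤ ε / (‖e‖ + 1) * ‖t • e + x - x‖ := by
    refine Convex.norm_image_sub_le_of_norm_hasFDerivWithin_le
      (f := fun y => f y - fderiv ℝ f x y) (f' := fun y => fderiv ℝ f y - fderiv ℝ f x) (s := s)
      (fun y _ => (((hf.differentiable (by norm_num)) y).hasFDerivAt.sub
        (fderiv ℝ f x).hasFDerivAt).hasFDerivWithinAt) (fun y hy => ?_) (convex_closedBall _ _)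
      (mem_closedBall_self (norm_nonneg _)) (by simp [hs])
    rw [hs, mem_closedBall] at hy
    have h1 := hδ' y (by
      rw [mem_closedBall_zero_iff]
      have h2 := norm_sub_norm_le y x
      rw [← dist_eq_norm] at h2
      linarith [hte.trans_le (min_le_right δ 1)]) x
      (by rw [mem_closedBall_zero_iff]; linarith) (hy.trans_lt (hte.trans_le (min_le_left δ 1)))
    rw [dist_eq_norm] at h1
    exact h1.le
  have h2 : t⁻¹ • (f (t • e + x) - f x) - fderiv ℝ f x e
      = t⁻¹ • ((f (t • e + x) - fderiv ℝ f x (t • e + x)) - (f x - fderiv ℝ f x x)) := by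
    have h0 : t ≠ 0 := ht0
    rw [map_add, map_smul]
    have : fderiv ℝ f x e = t⁻¹ • t • fderiv ℝ f x e := by
      rw [smul_smul, inv_mul_cancel₀ h0, one_smul]
    nth_rewrite 1 [this]
    rw [← smul_sub]
    congr 1
    abel
  rw [h2, norm_smul, norm_inv, Real.norm_eq_abs]
  rw [add_sub_cancel_right, norm_smul, Real.norm_eq_abs] at key
  calc |t|⁻¹ * _ ≤ |t|⁻¹ * (ε / (‖e‖ + 1) * (|t| * ‖e‖)) := by gcongr
    _ = ε * (‖e‖ / (‖e‖ + 1)) := by field_simp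
    _ ≤ ε * 1 := by
        gcongr
        rw [div_le_one (by positivity)]
        linarith
    _ = ε := mul_one ε
end UniformConvergence

lemma one_add_div_ge {p t B : ℝ} (hp : 1 < p) (hB : 2 * B ≤ p) (ht : -B ≤ t) :
    1 / 2 ≤ 1 + t / p := by
  have hp0 : 0 < p := by linarith
  have : -(1 / 2) ≤ t / p := by
    rw [le_div_iff₀ hp0]
    linarith
  linarith

lemma nl_eq {p t : ℝ} (h : 0 < 1 + t / p) : nl p t = (1 + t / p) ^ p := by
  rw [nl, abs_of_pos h]
  nth_rewrite 2 [← Real.rpow_one (1 + t / p)]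
  rw [← Real.rpow_add h]
  congr 1
  ring

lemma hasDerivAt_nl {p t : ℝ} (hp : 1 < p) (h : 0 < 1 + t / p) :
    HasDerivAt (nl p) ((1 + t / p) ^ (p - 1)) t := by
  have hp0 : p ≠ 0 := by positivity
  have h1 : HasDerivAt (fun s : ℝ => 1 + s / p) (1 / p) t :=
    ((hasDerivAt_id t).div_const p).const_add 1
  have h2 := h1.rpow_const (p := p) (Or.inl h.ne')
  have h3 : 1 / p * p * (1 + t / p) ^ (p - 1) = (1 + t / p) ^ (p - 1) := by field_simp
  rw [h3] at h2
  refine h2.congr_of_eventuallyEq ?_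
  have h4 : ∀ᶠ s in 𝓝 t, 0 < 1 + s / p :=
    (show ContinuousAt (fun s : ℝ => 1 + s / p) t from h1.continuousAt).eventually_const_lt h
  filter_upwards [h4] with s hs
  exact nl_eq hs

lemma abs_nl_sub_exp_le {p t B : ℝ} (hp : 1 < p) (hB : 2 * B ≤ p) (ht : -B ≤ t) (ht0 : t ≤ 0) :
    |nl p t - exp t| ≤ 2 * B ^ 2 / p := by
  have hp0 : 0 < p := by linarith
  have h := one_add_div_ge hp hB ht
  have h0 : 0 < 1 + t / p := by linarith
  rw [nl_eq h0, Real.rpow_def_of_pos h0]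
  have hup : log (1 + t / p) * p ≤ t := by
    have := Real.log_le_sub_one_of_pos h0
    have h1 := mul_le_mul_of_nonneg_right this hp0.le
    have h2 : (1 + t / p - 1) * p = t := by field_simp; ring
    linarith
  have hlo : t - 2 * B ^ 2 / p ≤ log (1 + t / p) * p := by
    have h1 := mul_le_mul_of_nonneg_right (Real.one_sub_inv_le_log_of_pos h0) hp0.le
    refine le_trans ?_ h1
    have h2 : (1 - (1 + t / p)⁻¹) * p = t - t ^ 2 / p * (1 + t / p)⁻¹ := by
      have : p + t ≠ 0 := by
        have : p * (1 + t / p) = p + t := by field_simp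
        rw [← this]; positivity
      field_simp
      ring
    have h3 : (1 + t / p)⁻¹ ≤ 2 := by
      rw [inv_le_comm₀ h0 (by norm_num)]
      linarith
    have h4 : t ^ 2 ≤ B ^ 2 := sq_le_sq' ht (by linarith)
    have h5 : t ^ 2 / p * (1 + t / p)⁻¹ ≤ B ^ 2 / p * 2 := by gcongr
    rw [h2]
    have h6 : 2 * B ^ 2 / p = B ^ 2 / p * 2 := by ring
    linarith
  have hexp1 : exp (log (1 + t / p) * p) ≤ exp t := Real.exp_le_exp.2 hup
  have hexp2 : exp t - 2 * B ^ 2 / p ≤ exp (log (1 + t / p) * p) := by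
    have h1 : exp (t - 2 * B ^ 2 / p) ≤ exp (log (1 + t / p) * p) := Real.exp_le_exp.2 hlo
    have h2 := Real.add_one_le_exp (-(2 * B ^ 2 / p))
    have h3 : exp t ≤ 1 := Real.exp_le_one_iff.2 ht0
    have h4 : 0 ≤ 2 * B ^ 2 / p := by positivity
    rw [sub_eq_add_neg, Real.exp_add] at h1
    have h5 := mul_le_mul_of_nonneg_left h2 (Real.exp_pos t).le
    nlinarith
  rw [abs_le]
  have : 0 ≤ 2 * B ^ 2 / p := by positivity
  constructor <;> linarith

lemma abs_deriv_nl_sub_exp_le {p t B : ℝ} (hp : 1 < p) (hB : 2 * B ≤ p) (ht : -B ≤ t)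
    (ht0 : t ≤ 0) : |(1 + t / p) ^ (p - 1) - exp t| ≤ (2 * B ^ 2 + 2 * B) / p := by
  have hp0 : 0 < p := by linarith
  have h := one_add_div_ge hp hB ht
  have h0 : 0 < 1 + t / p := by linarith
  have h1 := abs_nl_sub_exp_le hp hB ht ht0
  have htp : t / p ≤ 0 := div_nonpos_of_nonpos_of_nonneg ht0 hp0.le
  have hle : (1 + t / p) ^ (p - 1) ≤ 1 := Real.rpow_le_one h0.le (by linarith) (by linarith)
  have hnn : 0 ≤ (1 + t / p) ^ (p - 1) := by positivity
  have h2 : (1 + t / p) ^ (p - 1) = nl p t + (1 + t / p) ^ (p - 1) * (-(t / p)) := by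
    rw [nl, abs_of_pos h0]
    ring
  have h3 : |(1 + t / p) ^ (p - 1) * (-(t / p))| ≤ 2 * B / p := by
    rw [abs_of_nonneg (mul_nonneg hnn (by linarith))]
    have h4 : -(t / p) ≤ B / p := by
      rw [← neg_div]
      gcongr
      linarith
    have hB0 : 0 ≤ B := by linarith
    calc _ ≤ 1 * (B / p) := by
          refine mul_le_mul hle h4 (by linarith) zero_le_one
      _ ≤ 2 * B / p := by rw [one_mul]; gcongr; linarith
  have h5 : (1 + t / p) ^ (p - 1) - exp t
      = (nl p t - exp t) + (1 + t / p) ^ (p - 1) * (-(t / p)) := by linarith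
  rw [h5, add_div]
  exact (abs_add_le _ _).trans (add_le_add h1 h3)

lemma abs_exp_sub_exp_le {s t : ℝ} (hs : s ≤ 0) (ht : t ≤ 0) : |exp s - exp t| ≤ |s - t| := by
  have := Convex.norm_image_sub_le_of_norm_deriv_le (f := Real.exp) (C := 1) (s := Iic (0 : ℝ))
    (fun x _ => Real.differentiableAt_exp) (fun x hx => by
      rw [Real.deriv_exp, Real.norm_eq_abs, abs_of_pos (Real.exp_pos _)]
      exact Real.exp_le_one_iff.2 hx) (convex_Iic 0) (mem_Iic.2 ht) (mem_Iic.2 hs)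
  simpa [Real.norm_eq_abs] using this

/-- Along an ultrafilter, an eventually locally Lipschitz and bounded family of functions converges
locally uniformly. -/
lemma Ultrafilter.exists_uTendsto {ι : Type*} (𝒰 : Ultrafilter ι) {w : ι → R2 → ℝ}
    (hb : ∀ R : ℝ, ∃ B, ∀ᶠ i in (𝒰 : Filter ι), ∀ x ∈ closedBall (0 : R2) R, |w i x| ≤ B)
    (hd : ∀ R : ℝ, ∃ L, ∀ᶠ i in (𝒰 : Filter ι), ∀ x ∈ closedBall (0 : R2) R,
      DifferentiableAt ℝ (w i) x ∧ ‖fderiv ℝ (w i) x‖ ≤ L) :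
    ∃ v, UTendsto (𝒰 : Filter ι) w v := by
  have hpt : ∀ x, ∃ y, Tendsto (fun i => w i x) (𝒰 : Filter ι) (𝓝 y) := by
    intro x
    obtain ⟨B, hB⟩ := hb ‖x‖
    have h1 : ((𝒰.map fun i => w i x : Ultrafilter ℝ) : Filter ℝ) ≤ 𝓟 (Icc (-B) B) := by
      rw [le_principal_iff]
      show ∀ᶠ i in (𝒰 : Filter ι), w i x ∈ Icc (-B) B
      filter_upwards [hB] with i hi
      exact abs_le.1 (hi x (by simp))
    obtain ⟨y, -, hy⟩ := isCompact_Icc.ultrafilter_le_nhds _ h1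
    exact ⟨y, hy⟩
  choose v hv using hpt
  refine ⟨v, fun R ε hε => ?_⟩
  obtain ⟨L, hL⟩ := hd R
  set L' := max L 0
  have hLip : ∀ᶠ i in (𝒰 : Filter ι), ∀ x ∈ closedBall (0 : R2) R, ∀ y ∈ closedBall (0 : R2) R,
      |w i x - w i y| ≤ L' * ‖x - y‖ := by
    filter_upwards [hL] with i hi x hx y hy
    exact Convex.norm_image_sub_le_of_norm_fderiv_le (fun z hz => (hi z hz).1)
      (fun z hz => (hi z hz).2.trans (le_max_left _ _)) (convex_closedBall _ _) hy hx
  have hvLip : ∀ x ∈ closedBall (0 : R2) R, ∀ y ∈ closedBall (0 : R2) R,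
      |v x - v y| ≤ L' * ‖x - y‖ := by
    intro x hx y hy
    refine le_of_tendsto ((hv x).sub (hv y)).abs ?_
    filter_upwards [hLip] with i hi
    exact hi x hx y hy
  have hL0 : 0 ≤ L' := le_max_right _ _
  obtain ⟨t, htR, htf, htc⟩ := (isCompact_closedBall (0 : R2) R).finite_cover_balls
    (show 0 < ε / (3 * (L' + 1)) by positivity)
  have hfin : ∀ᶠ i in (𝒰 : Filter ι), ∀ c ∈ t, |w i c - v c| ≤ ε / 3 := by
    rw [eventually_all_finite htf]
    intro c _
    have := (Metric.tendsto_nhds.1 (hv c)) (ε / 3) (by positivity)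
    filter_upwards [this] with i hi
    exact hi.le
  filter_upwards [hLip, hfin] with i h1 h2 x hx
  obtain ⟨c, hc, hxc⟩ := mem_iUnion₂.1 (htc hx)
  rw [mem_ball, dist_eq_norm] at hxc
  have h3 : L' * ‖x - c‖ ≤ ε / 3 := by
    calc L' * ‖x - c‖ ≤ (L' + 1) * (ε / (3 * (L' + 1))) := by gcongr; linarith
      _ = ε / 3 := by field_simp
  have e1 := h1 x hx c (htR hc)
  have e2 := h2 c hc
  have e3 := hvLip x hx c (htR hc)
  rw [Real.norm_eq_abs, abs_le]
  rw [abs_le] at e1 e2 e3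
  constructor <;> linarith

/-- Compactness of the rescaled family. -/
theorem exists_limit {Ω : Set R2} {u : ℝ → R2 → ℝ} {xp : ℝ → R2} {C : ℝ}
    (hR : ∀ R > 0, ∀ᶠ p in atTop, RescaledOn Ω u xp C R p) (𝒰 : Ultrafilter ℝ)
    (h𝒰 : (𝒰 : Filter ℝ) ≤ atTop) :
    ∃ U : R2 → ℝ, ContDiff ℝ 2 U ∧ (∀ x, lap U x = -exp (U x)) ∧ (∀ x, U x ≤ 0) ∧ U 0 = 0 ∧
      (∀ R : ℝ, ∫ x in closedBall 0 R, exp (U x) ≤ C) ∧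
      UTendsto (𝒰 : Filter ℝ) (zp u xp) U ∧
      UTendsto (𝒰 : Filter ℝ) (fun p => fderiv ℝ (zp u xp p)) (fderiv ℝ U) ∧
      UTendsto (𝒰 : Filter ℝ) (fun p => fderiv ℝ (fderiv ℝ (zp u xp p)))
        (fderiv ℝ (fderiv ℝ U)) := by
  set z := zp u xp with hz
  have hloc : ∀ R : ℝ, ∃ B : ℝ, 0 ≤ B ∧ ∀ q : ℝ, ∀ᶠ p in (𝒰 : Filter ℝ), q ≤ p ∧ 1 < p ∧ 2 * B ≤ p ∧
      (∫ x in closedBall 0 R, nl p (z p x) ≤ C ∨ R ≤ 0) ∧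
      ∀ x ∈ closedBall (0 : R2) R, ContDiffAt ℝ 2 (z p) x ∧ z p x ≤ 0 ∧ -B ≤ z p x ∧
        -lap (z p) x = nl p (z p x) := by
    intro R
    refine ⟨115 * max R 1 ^ 2, by positivity, fun q => h𝒰 ?_⟩
    by_cases h0 : 0 < R
    · filter_upwards [hR R h0, eventually_ge_atTop q,
        eventually_ge_atTop (2 * (115 * max R 1 ^ 2))] with p hp hq hpB
      have hle : R ^ 2 ≤ max R 1 ^ 2 := by gcongr; exact le_max_left _ _
      exact ⟨hq, hp.one_lt, hpB, Or.inl hp.mass, fun x hx => ⟨hp.contDiffAt x hx, hp.nonpos x hx,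
        by linarith [hp.lower x hx], hp.lap_eq x hx⟩⟩
    · have hsub : closedBall (0 : R2) R ⊆ closedBall 0 1 :=
        closedBall_subset_closedBall (by linarith)
      filter_upwards [hR 1 one_pos, eventually_ge_atTop q,
        eventually_ge_atTop (2 * (115 * max R 1 ^ 2))] with p hp hq hpB
      have hle : (1 : ℝ) ^ 2 ≤ max R 1 ^ 2 := by gcongr; exact le_max_right _ _
      exact ⟨hq, hp.one_lt, hpB, Or.inr (not_lt.1 h0), fun x hx => ⟨hp.contDiffAt x (hsub hx),
        hp.nonpos x (hsub hx), by linarith [hp.lower x (hsub hx)], hp.lap_eq x (hsub hx)⟩⟩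
  choose B hB0 hB using hloc
  have hC : ∀ R : ℝ, ∀ᶠ p in (𝒰 : Filter ℝ), ∀ x ∈ closedBall (0 : R2) R,
      ContDiffAt ℝ 2 (z p) x := fun R => by
    filter_upwards [hB R 0] with p hp x hx
    exact (hp.2.2.2.2 x hx).1
  have hgrad : ∀ R : ℝ, ∀ᶠ p in (𝒰 : Filter ℝ), ∀ x ∈ closedBall (0 : R2) R,
      ‖fderiv ℝ (z p) x‖ ≤ 4 * B (R + 2) + 1 := by
    intro R
    filter_upwards [hB (R + 2) 0] with p hp0 x hx
    obtain ⟨_, hp, hpB, -, h⟩ := hp0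
    have hsub : closedBall x (2 * 1) ⊆ closedBall (0 : R2) (R + 2) :=
      closedBall_subset_closedBall' (by rw [mem_closedBall] at hx; linarith)
    have := norm_fderiv_le_of_bounds (w := z p) (c := x) (M := B (R + 2)) (N := 1) one_pos
      (fun y hy => (h y (hsub hy)).1)
      (fun y hy => by
        obtain ⟨_, h2, h3, _⟩ := h y (hsub hy)
        rw [abs_of_nonpos h2]; linarith)
      (fun y hy => by
        obtain ⟨_, h2, h3, h4⟩ := h y (hsub hy)
        rw [← abs_neg, h4, nl_eq (by linarith [one_add_div_ge hp hpB h3]),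
          abs_of_nonneg (Real.rpow_nonneg (by linarith [one_add_div_ge hp hpB h3]) _)]
        refine Real.rpow_le_one (by linarith [one_add_div_ge hp hpB h3]) ?_ (by linarith)
        linarith [div_nonpos_of_nonpos_of_nonneg h2 (show 0 ≤ p by linarith)])
    linarith
  obtain ⟨U, hU⟩ := 𝒰.exists_uTendsto (w := z)
    (fun R => ⟨B R, by
      filter_upwards [hB R 0] with p hp x hx
      obtain ⟨_, h2, h3, _⟩ := hp.2.2.2.2 x hx
      rw [abs_of_nonpos h2]; linarith⟩)
    (fun R => ⟨4 * B (R + 2) + 1, by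
      filter_upwards [hC R, hgrad R] with p h1 h2 x hx
      exact ⟨(h1 x hx).differentiableAt (by norm_num), h2 x hx⟩⟩)
  have hU0 : ∀ x, U x ≤ 0 := fun x => le_of_tendsto (hU.tendsto x) (by
    filter_upwards [hB ‖x‖ 0] with p hp
    exact (hp.2.2.2.2 x (by simp)).2.1)
  have hUz : U 0 = 0 := by
    refine tendsto_nhds_unique (hU.tendsto 0) ?_
    simp only [hz, zp_zero]
    exact tendsto_const_nhds
  have hnl : UTendsto (𝒰 : Filter ℝ) (fun p x => nl p (z p x)) (fun x => exp (U x)) := by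
    intro R ε hε
    filter_upwards [hB R (2 * B R ^ 2 * (2 / ε)), hU R (ε / 2) (by positivity)]
      with p hp0 h1 x hx
    obtain ⟨hq, hp, hpB, -, h⟩ := hp0
    obtain ⟨_, h2, h3, _⟩ := h x hx
    have e1 := abs_nl_sub_exp_le hp hpB h3 h2
    have e2 := (abs_exp_sub_exp_le h2 (hU0 x)).trans (h1 x hx)
    have e3 : 2 * B R ^ 2 / p ≤ ε / 2 := by
      rw [div_le_iff₀ (by linarith)]
      calc 2 * B R ^ 2 = ε / 2 * (2 * B R ^ 2 * (2 / ε)) := by field_simp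
        _ ≤ ε / 2 * p := by gcongr
    rw [Real.norm_eq_abs]
    have := abs_sub_le (nl p (z p x)) (exp (z p x)) (exp (U x))
    linarith
  have hdnl : UTendsto (𝒰 : Filter ℝ) (fun p x => (1 + z p x / p) ^ (p - 1))
      (fun x => exp (U x)) := by
    intro R ε hε
    filter_upwards [hB R ((2 * B R ^ 2 + 2 * B R) * (2 / ε)), hU R (ε / 2) (by positivity)]
      with p hp0 h1 x hx
    obtain ⟨hq, hp, hpB, -, h⟩ := hp0
    obtain ⟨_, h2, h3, _⟩ := h x hx
    have e1 := abs_deriv_nl_sub_exp_le hp hpB h3 h2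
    have e2 := (abs_exp_sub_exp_le h2 (hU0 x)).trans (h1 x hx)
    have e3 : (2 * B R ^ 2 + 2 * B R) / p ≤ ε / 2 := by
      rw [div_le_iff₀ (by linarith)]
      calc 2 * B R ^ 2 + 2 * B R = ε / 2 * ((2 * B R ^ 2 + 2 * B R) * (2 / ε)) := by field_simp
        _ ≤ ε / 2 * p := by gcongr
    rw [Real.norm_eq_abs]
    have := abs_sub_le ((1 + z p x / p) ^ (p - 1)) (exp (z p x)) (exp (U x))
    linarith
  have hlap : UTendsto (𝒰 : Filter ℝ) (fun p => lap (z p)) (fun x => -exp (U x)) := by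
    intro R ε hε
    filter_upwards [hnl R ε hε, hB R 0] with p h1 h2 x hx
    have h3 := (h2.2.2.2.2 x hx).2.2.2
    have h4 : lap (z p) x - -exp (U x) = -(nl p (z p x) - exp (U x)) := by linarith
    rw [h4, norm_neg]
    exact h1 x hx
  obtain ⟨g, hg⟩ := (uCauchy_fderiv hC hU.uCauchy hlap.uCauchy).exists_uTendsto
  have hder : ∀ R : ℝ, ∀ᶠ p in (𝒰 : Filter ℝ), ∀ x ∈ closedBall (0 : R2) R,
      HasFDerivAt (lap (z p)) (-((1 + z p x / p) ^ (p - 1) • fderiv ℝ (z p) x)) x := by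
    intro R
    filter_upwards [hB (R + 1) 0] with p hp0 x hx
    obtain ⟨_, hp, hpB, -, h⟩ := hp0
    have hn : closedBall (0 : R2) (R + 1) ∈ 𝓝 x := closedBall_mem_nhds_of_mem (by
      rw [mem_closedBall] at hx
      rw [mem_ball]
      linarith)
    obtain ⟨h1, h2, h3, _⟩ := h x (mem_of_mem_nhds hn)
    have h4 : HasFDerivAt (fun y => -nl p (z p y))
        (-((1 + z p x / p) ^ (p - 1) • fderiv ℝ (z p) x)) x :=
      ((hasDerivAt_nl hp (by linarith [one_add_div_ge hp hpB h3])).comp_hasFDerivAt x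
        (h1.differentiableAt (by norm_num)).hasFDerivAt).neg
    refine h4.congr_of_eventuallyEq ?_
    filter_upwards [hn] with y hy
    linarith [(h y hy).2.2.2]
  have hflap : UTendsto (𝒰 : Filter ℝ) (fun p => fderiv ℝ (lap (z p)))
      (fun x => -(exp (U x) • g x)) := by
    intro R ε hε
    set L := 4 * B (R + 2) + 1 with hL
    have hL0 : 0 < L := by
      have := hB0 (R + 2)
      positivity
    filter_upwards [hder R, hgrad R, hg R (ε / 2) (by positivity),
      hdnl R (ε / (2 * L)) (by positivity)] with p h1 h2 h3 h4 x hx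
    rw [(h1 x hx).fderiv]
    have e1 : -((1 + z p x / p) ^ (p - 1) • fderiv ℝ (z p) x) - -(exp (U x) • g x)
        = -(((1 + z p x / p) ^ (p - 1) - exp (U x)) • fderiv ℝ (z p) x
          + exp (U x) • (fderiv ℝ (z p) x - g x)) := by
      rw [sub_smul, smul_sub]
      abel
    rw [e1, norm_neg]
    refine (norm_add_le _ _).trans ?_
    rw [norm_smul, norm_smul, Real.norm_eq_abs (exp _), abs_of_pos (Real.exp_pos _)]
    have e2 : exp (U x) * ‖fderiv ℝ (z p) x - g x‖ ≤ 1 * (ε / 2) :=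
      mul_le_mul (Real.exp_le_one_iff.2 (hU0 x)) (h3 x hx) (norm_nonneg _) zero_le_one
    have e3 : ‖(1 + z p x / p) ^ (p - 1) - exp (U x)‖ * ‖fderiv ℝ (z p) x‖ ≤ ε / (2 * L) * L :=
      mul_le_mul (h4 x hx) (h2 x hx) (norm_nonneg _) (by positivity)
    have e4 : ε / (2 * L) * L = ε / 2 := by field_simp
    linarith
  obtain ⟨hUC, hUlap, hf1, hf2⟩ := hU.contDiff_two hC (fun R => by
    filter_upwards [hder R] with p hp x hx
    exact (hp x hx).differentiableAt) hlap hflap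
  refine ⟨U, hUC, hUlap, hU0, hUz, fun R => ?_, hU, hf1, hf2⟩
  have hexpc : Continuous fun x => exp (U x) := Real.continuous_exp.comp hUC.continuous
  have hmass : ∀ R > 0, ∫ x in closedBall 0 R, exp (U x) ≤ C := by
    intro R hR
    refine le_of_forall_pos_le_add fun ε hε => ?_
    set V := volume.real (closedBall (0 : R2) R) with hV
    have hV0 : 0 ≤ V := measureReal_nonneg
    obtain ⟨p, ⟨_, hp, _, hm, h⟩, hn⟩ :=
      ((hB R 0).and (hnl R (ε / (V + 1)) (by positivity))).exists
    have hci : IntegrableOn (fun _ => ε / (V + 1)) (closedBall (0 : R2) R) volume :=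
      integrableOn_const measure_closedBall_lt_top.ne
    have hni : IntegrableOn (fun x => nl p (z p x)) (closedBall (0 : R2) R) volume := by
      have hzc : ContinuousOn (z p) (closedBall 0 R) := fun x hx =>
        (h x hx).1.continuousAt.continuousWithinAt
      refine ContinuousOn.integrableOn_compact (isCompact_closedBall _ _) ?_
      unfold nl
      have h1 : ContinuousOn (fun x => 1 + z p x / p) (closedBall 0 R) := by fun_prop
      exact (h1.abs.rpow_const fun _ _ => Or.inr (by linarith)).mul h1
    calc ∫ x in closedBall 0 R, exp (U x)
        ≤ ∫ x in closedBall 0 R, (nl p (z p x) + ε / (V + 1)) := by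
          refine setIntegral_mono_on (hexpc.continuousOn.integrableOn_compact
            (isCompact_closedBall _ _)) (hni.add hci) measurableSet_closedBall fun x hx => ?_
          linarith [(abs_le.1 (hn x hx)).1]
      _ = (∫ x in closedBall 0 R, nl p (z p x)) + V * (ε / (V + 1)) := by
          rw [integral_add hni hci, setIntegral_const, smul_eq_mul]
      _ ≤ C + ε := by
          refine add_le_add (hm.resolve_right (not_le.2 hR)) ?_
          have : V * (ε / (V + 1)) = ε * (V / (V + 1)) := by ring
          rw [this]
          refine mul_le_of_le_one_right hε.le ?_
          rw [div_le_one (by positivity)]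
          linarith
  refine le_trans ?_ (hmass (max R 1) (by positivity))
  exact setIntegral_mono_set (hexpc.continuousOn.integrableOn_compact (isCompact_closedBall _ _))
    (Eventually.of_forall fun x => (Real.exp_pos _).le)
    (closedBall_subset_closedBall (le_max_left _ _)).eventuallyLE

lemma lap_comp_add_left {f : R2 → ℝ} (hf : ContDiff ℝ 2 f) (a x : R2) :
    lap (fun y => f (a + y)) x = lap f (a + x) := by
  have h := lap_comp_affine (u := f) (r := 1) (c := a) (x := x) hf.contDiffAt
  simpa [add_comm] using h

/-- A finite-mass solution of the Liouville equation, normalized at its maximum. -/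
structure LiouvilleSol (U : R2 → ℝ) (C : ℝ) : Prop where
  contDiff : ContDiff ℝ 2 U
  lap_eq : ∀ x, lap U x = -exp (U x)
  nonpos : ∀ x, U x ≤ 0
  zero : U 0 = 0
  mass : ∀ R : ℝ, ∫ x in closedBall 0 R, exp (U x) ≤ C

namespace LiouvilleSol
variable {U : R2 → ℝ} {C : ℝ}

lemma contDiff_lap (h : LiouvilleSol U C) : ContDiff ℝ 2 (lap U) := by
  have : lap U = fun x => -exp (U x) := funext h.lap_eq
  rw [this]
  exact (Real.contDiff_exp.comp h.contDiff).neg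

lemma fderiv_lap (h : LiouvilleSol U C) (x : R2) :
    fderiv ℝ (lap U) x = -(exp (U x) • fderiv ℝ U x) := by
  have : lap U = fun x => -exp (U x) := funext h.lap_eq
  rw [this]
  exact ((h.contDiff.differentiable (by norm_num) x).hasFDerivAt.exp.neg).fderiv

lemma contDiff_pd_and_lap (h : LiouvilleSol U C) (i : Fin 2) :
    ContDiff ℝ 2 (pd i U) ∧ ∀ x, lap (pd i U) x = -(exp (U x) * pd i U x) := by
  set e : R2 := EuclideanSpace.single i 1 with he
  set w : ℝ → R2 → ℝ := fun t x => t⁻¹ * (U (t • e + x) - U x) with hw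
  have htr : ∀ t : ℝ, ContDiff ℝ 2 fun x => U (t • e + x) := fun t =>
    h.contDiff.comp (contDiff_const.add contDiff_id)
  have hwC : ∀ t, ContDiff ℝ 2 (w t) := fun t => contDiff_const.mul ((htr t).sub h.contDiff)
  have hlap : ∀ t, lap (w t) = fun x => t⁻¹ * (lap U (t • e + x) - lap U x) := by
    intro t
    funext x
    rw [hw, lap_const_mul ((htr t).sub h.contDiff).contDiffAt,
      lap_sub (htr t).contDiffAt h.contDiff.contDiffAt, lap_comp_add_left h.contDiff]
  have hlC := h.contDiff_lap
  have hlt : ∀ t : ℝ, ContDiff ℝ 2 fun x => lap U (t • e + x) := fun t =>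
    hlC.comp (contDiff_const.add contDiff_id)
  have hflap : ∀ t, fderiv ℝ (lap (w t)) =
      fun x => t⁻¹ • (fderiv ℝ (lap U) (t • e + x) - fderiv ℝ (lap U) x) := by
    intro t
    funext x
    rw [hlap, fderiv_const_mul (((hlt t).sub hlC).differentiable (by norm_num) x),
      fderiv_fun_sub ((hlt t).differentiable (by norm_num) x) (hlC.differentiable (by norm_num) x),
      fderiv_comp_add_left]
  have h0 : UTendsto (𝓝[≠] (0 : ℝ)) w (pd i U) :=
    uTendsto_differenceQuotient (h.contDiff.of_le (by norm_num)) e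
  have h1 : UTendsto (𝓝[≠] (0 : ℝ)) (fun t => lap (w t)) (fun x => fderiv ℝ (lap U) x e) := by
    simp only [hlap]
    exact uTendsto_differenceQuotient (hlC.of_le (by norm_num)) e
  have h2 : UTendsto (𝓝[≠] (0 : ℝ)) (fun t => fderiv ℝ (lap (w t)))
      (fun x => fderiv ℝ (fderiv ℝ (lap U)) x e) := by
    simp only [hflap]
    exact uTendsto_differenceQuotient (hlC.fderiv_right (by norm_num)) e
  obtain ⟨h3, h4, -, -⟩ := h0.contDiff_two
    (fun R => Eventually.of_forall fun t x _ => (hwC t).contDiffAt)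
    (fun R => Eventually.of_forall fun t x _ => by
      rw [hlap]
      exact (contDiff_const.mul ((hlt t).sub hlC)).differentiable (by norm_num) x) h1 h2
  refine ⟨h3, fun x => ?_⟩
  rw [h4, h.fderiv_lap]
  rfl

lemma continuous_exp (h : LiouvilleSol U C) : Continuous fun x => exp (U x) :=
  Real.continuous_exp.comp h.contDiff.continuous

lemma integrable_exp (h : LiouvilleSol U C) : Integrable fun x => exp (U x) := by
  have hcov : AECover (volume : Measure R2) atTop fun n : ℕ => closedBall (0 : R2) n :=
    aecover_closedBall tendsto_natCast_atTop_atTop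
  refine hcov.integrable_of_integral_bounded_of_nonneg_ae C (fun n =>
    h.continuous_exp.continuousOn.integrableOn_compact (isCompact_closedBall _ _))
    (Eventually.of_forall fun x => (Real.exp_pos _).le) (Eventually.of_forall fun n => h.mass n)

lemma exp_sq_le_lap_exp (h : LiouvilleSol U C) (x : R2) :
    -exp (U x) ^ 2 ≤ lap (fun y => exp (U y)) x := by
  rw [lap_comp (g := exp) (g' := exp) (Eventually.of_forall Real.hasDerivAt_exp)
    (Real.hasDerivAt_exp _) h.contDiff.contDiffAt, h.lap_eq]
  have := Real.exp_pos (U x)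
  nlinarith [mul_nonneg this.le (add_nonneg (sq_nonneg (pd 0 U x)) (sq_nonneg (pd 1 U x)))]

lemma exists_exp_le (h : LiouvilleSol U C) :
    ∃ K : ℝ, 0 ≤ K ∧ ∀ x, exp (U x) ≤ K / (1 + ‖x‖ ^ 2) := by
  have hcov : AECover (volume : Measure R2) atTop fun R : ℝ => closedBall (0 : R2) R :=
    aecover_closedBall tendsto_id
  have hlim := hcov.integral_tendsto_of_countably_generated h.integrable_exp
  have hev := (hlim.eventually (lt_mem_nhds (sub_lt_self (∫ x, exp (U x))
    (show 0 < wtMass / 16 by linarith [wtMass_pos])))).exists_forall_of_atTop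
  obtain ⟨R₀, hR₀⟩ := hev
  set R := max (2 * R₀) 1 with hR
  have hR1 : 1 ≤ R := le_max_right _ _
  have hfar : ∀ x : R2, R ≤ ‖x‖ → ‖x‖ ^ 2 * exp (U x) ≤ 8 := by
    intro x hx
    have hx0 : 0 < ‖x‖ := by linarith
    have hdisj : closedBall x (‖x‖ / 4) ⊆ (closedBall (0 : R2) (‖x‖ / 2))ᶜ := by
      intro y hy hy'
      rw [mem_closedBall, dist_eq_norm] at hy
      rw [mem_closedBall, dist_zero_right] at hy'
      have := norm_sub_norm_le x y
      rw [norm_sub_rev] at this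
      linarith
    have hm : ∫ y in closedBall x (‖x‖ / 4), exp (U y) < wtMass / 16 := by
      have h1 : ∫ y in closedBall x (‖x‖ / 4), exp (U y)
          ≤ ∫ y in (closedBall (0 : R2) (‖x‖ / 2))ᶜ, exp (U y) :=
        setIntegral_mono_set h.integrable_exp.integrableOn
          (Eventually.of_forall fun y => (Real.exp_pos _).le) hdisj.eventuallyLE
      have h2 := integral_add_compl (measurableSet_closedBall (x := (0 : R2)) (ε := ‖x‖ / 2))
        h.integrable_exp
      have h3 := hR₀ (‖x‖ / 2) (by linarith [le_max_left (2 * R₀) 1])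
      linarith
    have := sq_mul_le_of_small_mass (f := fun y => exp (U y)) (show 0 < ‖x‖ / 4 by positivity)
      (Real.contDiff_exp.comp h.contDiff) (fun y => (Real.exp_pos _).le) h.exp_sq_le_lap_exp hm
    nlinarith
  refine ⟨16 + (1 + R ^ 2), by positivity, fun x => ?_⟩
  rw [le_div_iff₀ (by positivity)]
  have hexp1 : exp (U x) ≤ 1 := Real.exp_le_one_iff.2 (h.nonpos x)
  have hexp0 := Real.exp_pos (U x)
  rcases le_total R ‖x‖ with hx | hx
  · have := hfar x hx
    nlinarith [sq_nonneg R]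
  · have : ‖x‖ ^ 2 ≤ R ^ 2 := by gcongr
    calc exp (U x) * (1 + ‖x‖ ^ 2) ≤ 1 * (1 + R ^ 2) := by gcongr
      _ ≤ _ := by linarith

lemma exists_neg_le (h : LiouvilleSol U C) :
    ∃ A : ℝ, 0 ≤ A ∧ ∀ s : ℝ, 1 ≤ s → ∀ x ∈ closedBall (0 : R2) s, -U x ≤ A * √s := by
  obtain ⟨K, hK, hKx⟩ := h.exists_exp_le
  refine ⟨256 / 9 * (4 * K * 3), by positivity, fun s hs x hx => ?_⟩
  set G : R2 → ℝ := fun y => 4 * K * (1 + ‖y‖ ^ 2) ^ (1 / 4 : ℝ) with hG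
  have hpos : ∀ y : R2, 0 < 1 + ‖y‖ ^ 2 := fun y => by positivity
  have hgC : ContDiff ℝ 2 fun y : R2 => (1 + ‖y‖ ^ 2) ^ (1 / 4 : ℝ) :=
    (contDiff_const.add (contDiff_id.norm_sq ℝ)).rpow_const_of_ne fun y => (hpos y).ne'
  have hGC : ContDiff ℝ 2 G := contDiff_const.mul hgC
  have hder : ∀ (a t : ℝ), -1 < t →
      HasDerivAt (fun t : ℝ => (1 + t) ^ a) (a * (1 + t) ^ (a - 1)) t := by
    intro a t ht
    have h1 : HasDerivAt (fun t : ℝ => 1 + t) 1 t := (hasDerivAt_id t).const_add 1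
    have := h1.rpow_const (p := a) (Or.inl (by linarith))
    simpa using this
  have hGlap : ∀ y, K / (1 + ‖y‖ ^ 2) ≤ lap G y := by
    intro y
    rw [hG, lap_const_mul hgC.contDiffAt]
    have hy : (-1 : ℝ) < ‖y‖ ^ 2 := by linarith [sq_nonneg ‖y‖]
    rw [lap_radial (g := fun t => (1 + t) ^ (1 / 4 : ℝ))
      (g' := fun t => 1 / 4 * (1 + t) ^ (1 / 4 - 1 : ℝ))
      ((lt_mem_nhds hy).mono fun t ht => hder _ t ht)
      ((hder (1 / 4 - 1 : ℝ) _ hy).const_mul (1 / 4 : ℝ))]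
    have e1 : (1 + ‖y‖ ^ 2) ^ (1 / 4 - 1 : ℝ) = (1 + ‖y‖ ^ 2) ^ (1 / 4 : ℝ) / (1 + ‖y‖ ^ 2) := by
      rw [Real.rpow_sub_one (hpos y).ne']
    have e2 : (1 + ‖y‖ ^ 2) ^ (1 / 4 - 1 - 1 : ℝ)
        = (1 + ‖y‖ ^ 2) ^ (1 / 4 : ℝ) / (1 + ‖y‖ ^ 2) ^ 2 := by
      rw [Real.rpow_sub_one (hpos y).ne', e1, div_div, ← sq]
    have e3 : 1 ≤ (1 + ‖y‖ ^ 2) ^ (1 / 4 : ℝ) :=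
      Real.one_le_rpow (by linarith [sq_nonneg ‖y‖]) (by norm_num)
    rw [e1, e2]
    set P := (1 + ‖y‖ ^ 2) ^ (1 / 4 : ℝ)
    set q := ‖y‖ ^ 2 with hq
    have hq0 : 0 ≤ q := sq_nonneg _
    have e4 : 4 * K * (4 * (q * (1 / 4 * ((1 / 4 - 1) * (P / (1 + q) ^ 2)))
        + 1 / 4 * (P / (1 + q)))) = K / (1 + q) * (P * ((4 + q) / (1 + q))) := by
      field_simp
      ring
    rw [e4]
    refine le_mul_of_one_le_right (by positivity) ?_
    have : 1 ≤ (4 + q) / (1 + q) := by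
      rw [le_div_iff₀ (by positivity)]
      linarith
    nlinarith
  have hvC : ContDiff ℝ 2 fun y => -U y := h.contDiff.neg
  have hvlap : ∀ y, lap (fun y => -U y) y = exp (U y) := fun y => by
    rw [lap_neg h.contDiff.contDiffAt, h.lap_eq, neg_neg]
  have hmean := wmean_sub_le (v := fun y => -U y) (G := G) (c := 0) (R := 4 * s) (by linarith)
    (fun y _ => hvC.contDiffAt) (fun y _ => hGC.contDiffAt)
    (fun y _ => by rw [hvlap]; exact (hKx y).trans (hGlap y))
  have hGle : wmean G 0 (4 * s) ≤ 4 * K * 3 * √s * wtMass := by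
    refine wmean_le_of_le (by linarith) (fun y _ => hGC.contDiffAt.continuousAt.continuousWithinAt)
      fun y hy => ?_
    rw [mem_closedBall, dist_zero_right] at hy
    have : (1 + ‖y‖ ^ 2) ^ (1 / 4 : ℝ) ≤ 3 * √s := by
      have hle : 1 + ‖y‖ ^ 2 ≤ (3 * √s) ^ (4 : ℝ) := by
        have e1 : (3 * √s) ^ (4 : ℝ) = 81 * s ^ 2 := by
          have : (√s) ^ 2 = s := Real.sq_sqrt (by linarith)
          rw [show (4 : ℝ) = ((4 : ℕ) : ℝ) by norm_num, Real.rpow_natCast]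
          calc (3 * √s) ^ 4 = 81 * ((√s) ^ 2) ^ 2 := by ring
            _ = _ := by rw [this]
        have e2 : ‖y‖ ^ 2 ≤ (4 * s) ^ 2 := by gcongr
        rw [e1]
        nlinarith
      calc (1 + ‖y‖ ^ 2) ^ (1 / 4 : ℝ) ≤ ((3 * √s) ^ (4 : ℝ)) ^ (1 / 4 : ℝ) := by
            gcongr
        _ = 3 * √s := by
            rw [← Real.rpow_mul (by positivity)]
            norm_num
    calc G y ≤ 4 * K * (3 * √s) := by
          exact mul_le_mul_of_nonneg_left this (by positivity)
      _ = _ := by ring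
  have hG0 : 0 ≤ G 0 := by
    rw [hG]
    positivity
  have := le_of_wmean_le (v := fun y => -U y) (c := 0) (x := x) (s := s) (N := 0)
    (T := 4 * K * 3 * √s) (by linarith) le_rfl (fun y _ => hvC.contDiffAt)
    (fun y _ => by linarith [h.nonpos y])
    (fun y _ => by rw [hvlap]; linarith [Real.exp_pos (U y)])
    (by
      have h1 : (-U 0 - G 0) * wtMass ≤ 0 := by
        rw [h.zero]
        nlinarith [wtMass_pos]
      linarith) hx
  linarith

lemma exists_norm_fderiv_le (h : LiouvilleSol U C) :
    ∃ A : ℝ, 0 ≤ A ∧ ∀ c : R2, 1 ≤ ‖c‖ → ‖fderiv ℝ U c‖ ≤ A / √‖c‖ := by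
  obtain ⟨K, hK, hKx⟩ := h.exists_exp_le
  obtain ⟨A, hA, hAx⟩ := h.exists_neg_le
  refine ⟨32 * (2 * A) + K, by positivity, fun c hc => ?_⟩
  set r := ‖c‖ with hr
  have hr0 : 0 < r := by linarith
  have hball : ∀ x ∈ closedBall c (2 * (r / 8)), 3 / 4 * r ≤ ‖x‖ ∧ ‖x‖ ≤ 4 * r := by
    intro x hx
    rw [mem_closedBall, dist_eq_norm] at hx
    have h1 := norm_sub_norm_le c x
    have h2 := norm_sub_norm_le x c
    rw [norm_sub_rev] at h1
    constructor <;> linarith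
  have key := norm_fderiv_le_of_bounds (w := U) (c := c) (d := r / 8) (M := 2 * A * √r)
    (N := 2 * K / r ^ 2) (by positivity) (fun x _ => h.contDiff.contDiffAt)
    (fun x hx => by
      rw [abs_of_nonpos (h.nonpos x)]
      have h1 := hAx (4 * r) (by linarith) x (by simpa using (hball x hx).2)
      have h2 : √(4 * r) = 2 * √r := by
        rw [Real.sqrt_mul (by norm_num), show (4 : ℝ) = 2 ^ 2 by norm_num,
          Real.sqrt_sq (by norm_num)]
      rw [h2] at h1
      linarith)
    (fun x hx => by
      rw [h.lap_eq, abs_neg, abs_of_pos (Real.exp_pos _)]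
      refine (hKx x).trans ?_
      have h1 : (3 / 4 * r) ^ 2 ≤ ‖x‖ ^ 2 := by
        have := (hball x hx).1
        gcongr
      rw [div_le_div_iff₀ (by positivity) (by positivity)]
      nlinarith)
  have hs : √r * √r = r := Real.mul_self_sqrt hr0.le
  have hs0 : 0 < √r := Real.sqrt_pos.2 hr0
  have hs1 : √r ≤ r := by
    have : 1 ≤ √r := Real.one_le_sqrt.2 hc
    nlinarith
  have e1 : 4 * (2 * A * √r) / (r / 8) = 32 * (2 * A) / √r := by
    rw [div_eq_div_iff (by positivity) (by positivity)]
    linear_combination 8 * A * hs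
  have e2 : 2 * K / r ^ 2 * (r / 8) ≤ K / √r := by
    have : 2 * K / r ^ 2 * (r / 8) = K / (4 * r) := by
      field_simp
      ring
    rw [this]
    gcongr
    linarith
  rw [add_div]
  linarith

lemma exists_norm_fderiv_fderiv_le (h : LiouvilleSol U C) :
    ∃ A : ℝ, 0 ≤ A ∧ ∀ c : R2, 2 ≤ ‖c‖ → ‖fderiv ℝ (fderiv ℝ U) c‖ ≤ A / √‖c‖ := by
  obtain ⟨K, hK, hKx⟩ := h.exists_exp_le
  obtain ⟨A, hA, hAx⟩ := h.exists_norm_fderiv_le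
  refine ⟨64 * (2 * A) + 2 * K * A, by positivity, fun c hc => ?_⟩
  set r := ‖c‖ with hr
  have hr0 : 0 < r := by linarith
  have hball : ∀ x ∈ closedBall c (3 * (r / 8)), 5 / 8 * r ≤ ‖x‖ := by
    intro x hx
    rw [mem_closedBall, dist_eq_norm] at hx
    have h1 := norm_sub_norm_le c x
    rw [norm_sub_rev] at h1
    linarith
  have hs0 : 0 < √r := Real.sqrt_pos.2 hr0
  have hgrad : ∀ x ∈ closedBall c (3 * (r / 8)), ‖fderiv ℝ U x‖ ≤ 2 * A / √r := by
    intro x hx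
    have h1 := hball x hx
    refine (hAx x (by linarith)).trans ?_
    have h2 : √r ≤ 2 * √‖x‖ := by
      have : √r ≤ √(2 ^ 2 * ‖x‖) := Real.sqrt_le_sqrt (by linarith)
      rwa [Real.sqrt_mul (by norm_num), Real.sqrt_sq (by norm_num)] at this
    rw [div_le_div_iff₀ (by linarith) hs0]
    nlinarith
  have key := norm_fderiv_fderiv_le_of_bounds (w := U) (c := c) (d := r / 8) (M := 2 * A / √r)
    (N := 4 * K / r ^ 2 * (2 * A / √r)) (by positivity) (fun x _ => h.contDiff.contDiffAt)
    (fun x _ => h.contDiff_lap.differentiable (by norm_num) x) hgrad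
    (fun x hx => by
      rw [h.fderiv_lap, norm_neg, norm_smul, Real.norm_eq_abs, abs_of_pos (Real.exp_pos _)]
      refine mul_le_mul ((hKx x).trans ?_) (hgrad x hx) (norm_nonneg _) (by positivity)
      have h1 : (5 / 8 * r) ^ 2 ≤ ‖x‖ ^ 2 := by
        have := hball x hx
        gcongr
      rw [div_le_div_iff₀ (by positivity) (by positivity)]
      nlinarith)
  refine key.trans ?_
  have e0 : 2 * (4 * (2 * A / √r) / (r / 8) + 4 * K / r ^ 2 * (2 * A / √r) * (r / 8))
      = (64 * (2 * A) / r + 2 * K * A / r) / √r := by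
    field_simp
    ring
  rw [e0]
  have hr1 : 1 ≤ r := by linarith
  gcongr <;> exact div_le_self (by positivity) hr1

lemma tendsto_pd (h : LiouvilleSol U C) (i : Fin 2) :
    Tendsto (pd i U) (cocompact R2) (𝓝 0) := by
  obtain ⟨A, hA, hAx⟩ := h.exists_norm_fderiv_le
  have hlim : Tendsto (fun c : R2 => A / √‖c‖) (cocompact R2) (𝓝 0) :=
    tendsto_const_nhds.div_atTop (Real.tendsto_sqrt_atTop.comp tendsto_norm_cocompact_atTop)
  refine squeeze_zero_norm' ?_ hlim
  filter_upwards [(tendsto_norm_cocompact_atTop (E := R2)).eventually_ge_atTop 1] with c hc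
  exact (abs_pd_le i U c).trans (hAx c hc)

lemma tendsto_pd_pd (h : LiouvilleSol U C) (i j : Fin 2) :
    Tendsto (pd j (pd i U)) (cocompact R2) (𝓝 0) := by
  obtain ⟨A, hA, hAx⟩ := h.exists_norm_fderiv_fderiv_le
  have hlim : Tendsto (fun c : R2 => A / √‖c‖) (cocompact R2) (𝓝 0) :=
    tendsto_const_nhds.div_atTop (Real.tendsto_sqrt_atTop.comp tendsto_norm_cocompact_atTop)
  refine squeeze_zero_norm' ?_ hlim
  filter_upwards [(tendsto_norm_cocompact_atTop).eventually_ge_atTop 2] with c hc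
  refine le_trans ?_ (hAx c hc)
  rw [h.contDiff.contDiffAt.pd_pd]
  have h1 := (fderiv ℝ (fderiv ℝ U) c).le_opNorm₂ (EuclideanSpace.single j 1)
    (EuclideanSpace.single i 1)
  rwa [R2.norm_single, R2.norm_single, mul_one, mul_one] at h1

end LiouvilleSol

/-- A pair of `C¹` functions on the plane satisfying the Cauchy-Riemann equations and vanishing at
infinity is zero. -/
lemma eq_zero_of_cauchyRiemann {P Q : R2 → ℝ} (hP : Differentiable ℝ P) (hQ : Differentiable ℝ Q)
    (h0 : ∀ x, pd 0 P x = pd 1 Q x) (h1 : ∀ x, pd 1 P x = -pd 0 Q x)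
    (hP0 : Tendsto P (cocompact R2) (𝓝 0)) (hQ0 : Tendsto Q (cocompact R2) (𝓝 0)) :
    (∀ x, P x = 0) ∧ ∀ x, Q x = 0 := by
  set φ := Complex.orthonormalBasisOneI.repr with hφ
  set φL : ℂ →L[ℝ] R2 := (φ.toContinuousLinearEquiv : ℂ →L[ℝ] R2) with hφL
  have hφ1 : φL 1 = EuclideanSpace.single 0 1 := by
    have := Complex.orthonormalBasisOneI.repr_self 0
    rwa [Complex.coe_orthonormalBasisOneI] at this
  have hφI : φL Complex.I = EuclideanSpace.single 1 1 := by
    have := Complex.orthonormalBasisOneI.repr_self 1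
    rwa [Complex.coe_orthonormalBasisOneI] at this
  set f : ℂ → ℂ := fun z => (P (φ z) : ℂ) + (Q (φ z) : ℂ) * Complex.I with hf
  have hder : ∀ z, HasFDerivAt f
      (Complex.ofRealCLM.comp ((fderiv ℝ P (φ z)).comp φL) +
        Complex.I • Complex.ofRealCLM.comp ((fderiv ℝ Q (φ z)).comp φL)) z := by
    intro z
    have e1 : HasFDerivAt (fun z => φ z) φL z := φL.hasFDerivAt
    have e2 := Complex.ofRealCLM.hasFDerivAt.comp z ((hP (φ z)).hasFDerivAt.comp z e1)
    have e3 := Complex.ofRealCLM.hasFDerivAt.comp z ((hQ (φ z)).hasFDerivAt.comp z e1)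
    refine (e2.add (e3.const_smul Complex.I)).congr_of_eventuallyEq (Eventually.of_forall ?_)
    intro w
    simp [hf, mul_comm]
  have hdiff : Differentiable ℂ f := by
    intro z
    rw [differentiableAt_complex_iff_differentiableAt_real]
    refine ⟨(hder z).differentiableAt, ?_⟩
    rw [(hder z).fderiv]
    have e0 := h0 (φ z)
    have e1 := h1 (φ z)
    unfold pd at e0 e1
    simp only [add_apply, smul_apply, ContinuousLinearMap.comp_apply, hφ1, hφI,
      Complex.ofRealCLM_apply, smul_eq_mul]
    rw [e0, e1]
    push_cast
    linear_combination -(fderiv ℝ Q (φ z) (EuclideanSpace.single 0 1) : ℂ) * Complex.I_mul_I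
  have hφc : Tendsto φ (cocompact ℂ) (cocompact R2) :=
    φ.toHomeomorph.isClosedEmbedding.tendsto_cocompact
  have hlim : Tendsto f (cocompact ℂ) (𝓝 0) := by
    have e1 := (Complex.continuous_ofReal.tendsto 0).comp (hP0.comp hφc)
    have e2 := (Complex.continuous_ofReal.tendsto 0).comp (hQ0.comp hφc)
    simpa using e1.add (e2.mul_const Complex.I)
  have hzero : ∀ z, f z = 0 := fun z => hdiff.apply_eq_of_tendsto_cocompact z hlim
  constructor
  · intro x
    have := congrArg Complex.re (hzero (φ.symm x))
    simpa [hf] using this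
  · intro x
    have := congrArg Complex.im (hzero (φ.symm x))
    simpa [hf] using this

lemma eq_of_pd_eq_zero {f : R2 → ℝ} (hf : Differentiable ℝ f) (h : ∀ i x, pd i f x = 0) (x y : R2) :
    f x = f y := by
  refine is_const_of_fderiv_eq_zero hf (fun z => ?_) x y
  have h1 := norm_fderiv_le_pd f z
  rw [h 0 z, h 1 z, abs_zero, add_zero] at h1
  exact norm_le_zero_iff.1 h1

/-- A function whose Hessian is a multiple of the identity everywhere is a radial quadratic, if its
gradient vanishes at the origin. -/
lemma eq_quadratic_of_hessian {w : R2 → ℝ} (hw : ContDiff ℝ 2 w) (hw' : ∀ i, ContDiff ℝ 2 (pd i w))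
    (h0 : ∀ i, pd i w 0 = 0) (h01 : ∀ x, pd 1 (pd 0 w) x = 0)
    (h00 : ∀ x, pd 0 (pd 0 w) x = pd 1 (pd 1 w) x) (x : R2) :
    w x = w 0 + lap w 0 / 4 * ‖x‖ ^ 2 := by
  have h10 : ∀ x, pd 0 (pd 1 w) x = 0 := fun x => by
    rw [hw.contDiffAt.pd_comm, h01]
  have hf01 : pd 1 (pd 0 w) = fun _ => 0 := funext h01
  have hf10 : pd 0 (pd 1 w) = fun _ => 0 := funext h10
  have hf00 : pd 0 (pd 0 w) = pd 1 (pd 1 w) := funext h00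
  have hq : Differentiable ℝ (pd 0 (pd 0 w)) := fun x =>
    ((hw' 0).contDiffAt.pd_one 0).differentiableAt (by norm_num)
  have hconst : ∀ x, pd 0 (pd 0 w) x = pd 0 (pd 0 w) 0 := by
    refine fun x => eq_of_pd_eq_zero hq (fun i y => ?_) x 0
    fin_cases i
    · change pd 0 (pd 0 (pd 0 w)) y = 0
      rw [hf00, (hw' 1).contDiffAt.pd_comm, hf10, pd_const]
    · change pd 1 (pd 0 (pd 0 w)) y = 0
      rw [(hw' 0).contDiffAt.pd_comm, hf01, pd_const]
  set q := pd 0 (pd 0 w) 0 with hqdef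
  have hlap : lap w 0 = 2 * q := by
    rw [lap_eq_pd, ← h00]
    ring
  have hcd : ∀ j : Fin 2, Differentiable ℝ fun y : R2 => y j - (0 : R2) j := fun j =>
    (contDiff_coord j 0 (n := 1)).differentiable (by norm_num)
  have hlin : ∀ i x, pd i w x = q * x i := by
    intro i x
    have hd : Differentiable ℝ fun y : R2 => pd i w y - q * (y i - (0 : R2) i) :=
      ((hw' i).differentiable (by norm_num)).sub ((hcd i).const_mul q)
    have := eq_of_pd_eq_zero hd (fun j y => by
      rw [pd_sub ((hw' i).differentiable (by norm_num) y) ((hcd i).const_mul q y),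
        pd_const_mul (hcd i y), pd_coord]
      fin_cases i <;> fin_cases j
      · simp [hconst]
      · simp [h01]
      · simp [h10]
      · simp [← h00, hconst]) x 0
    rw [h0] at this
    simp only [PiLp.zero_apply, sub_zero, mul_zero] at this
    linarith
  have hnd : Differentiable ℝ fun y : R2 => ‖y - 0‖ ^ 2 :=
    (contDiff_norm_sub_sq 0 (n := 1)).differentiable (by norm_num)
  have hd : Differentiable ℝ fun y : R2 => w y - q / 2 * ‖y - 0‖ ^ 2 :=
    (hw.differentiable (by norm_num)).sub (hnd.const_mul _)
  have := eq_of_pd_eq_zero hd (fun j y => by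
    rw [pd_sub (hw.differentiable (by norm_num) y) (hnd.const_mul _ y), pd_const_mul (hnd y),
      pd_norm_sub_sq, hlin]
    simp only [PiLp.zero_apply]
    ring) x 0
  simp only [sub_zero, norm_zero] at this
  rw [hlap]
  linarith

namespace LiouvilleSol
variable {U : R2 → ℝ} {C : ℝ}

/-- The quadratic differential associated with a finite-mass solution vanishes. -/
lemma quadraticDifferential_eq_zero (h : LiouvilleSol U C) :
    (∀ x, (pd 0 (pd 0 U) x - pd 1 (pd 1 U) x)
        - 1 / 2 * (pd 0 U x * pd 0 U x - pd 1 U x * pd 1 U x) = 0) ∧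
      ∀ x, pd 0 U x * pd 1 U x - 2 * pd 1 (pd 0 U) x = 0 := by
  have hC := fun i => (h.contDiff_pd_and_lap i).1
  have hL := fun i => (h.contDiff_pd_and_lap i).2
  have hd : ∀ i, Differentiable ℝ (pd i U) := fun i => (hC i).differentiable (by norm_num)
  have hdd : ∀ i j, Differentiable ℝ (pd j (pd i U)) := fun i j x =>
    ((hC i).contDiffAt.pd_one j).differentiableAt (by norm_num)
  have hS : pd 0 (pd 1 U) = pd 1 (pd 0 U) := funext fun x => h.contDiff.contDiffAt.pd_comm 1 0
  have hd2 : ∀ i j, Differentiable ℝ fun x => pd i U x * pd j U x := fun i j => (hd i).mul (hd j)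
  have hPd : ∀ i x, pd i (fun x => (pd 0 (pd 0 U) x - pd 1 (pd 1 U) x)
        - 1 / 2 * (pd 0 U x * pd 0 U x - pd 1 U x * pd 1 U x)) x =
      pd i (pd 0 (pd 0 U)) x - pd i (pd 1 (pd 1 U)) x
        - (pd 0 U x * pd i (pd 0 U) x - pd 1 U x * pd i (pd 1 U) x) := by
    intro i x
    have hA : Differentiable ℝ fun x => pd 0 (pd 0 U) x - pd 1 (pd 1 U) x :=
      (hdd 0 0).sub (hdd 1 1)
    have hB : Differentiable ℝ fun x => pd 0 U x * pd 0 U x - pd 1 U x * pd 1 U x :=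
      (hd2 0 0).sub (hd2 1 1)
    rw [pd_sub (hA x) (hB.const_mul (1 / 2) x),
      pd_sub (hdd 0 0 x) (hdd 1 1 x), pd_const_mul (hB x),
      pd_sub (hd2 0 0 x) (hd2 1 1 x), pd_mul (hd 0 x) (hd 0 x), pd_mul (hd 1 x) (hd 1 x)]
    ring
  have hQd : ∀ i x, pd i (fun x => pd 0 U x * pd 1 U x - 2 * pd 1 (pd 0 U) x) x =
      pd 0 U x * pd i (pd 1 U) x + pd 1 U x * pd i (pd 0 U) x - 2 * pd i (pd 1 (pd 0 U)) x := by
    intro i x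
    rw [pd_sub (hd2 0 1 x) ((hdd 0 1).const_mul 2 x), pd_mul (hd 0 x) (hd 1 x),
      pd_const_mul (hdd 0 1 x)]
  refine eq_zero_of_cauchyRiemann
    (((hdd 0 0).sub (hdd 1 1)).sub (((hd2 0 0).sub (hd2 1 1)).const_mul (1 / 2)))
    ((hd2 0 1).sub ((hdd 0 1).const_mul 2)) (fun x => ?_) (fun x => ?_) ?_ ?_
  · rw [hPd, hQd]
    have e1 : pd 0 (pd 1 (pd 1 U)) x = pd 1 (pd 1 (pd 0 U)) x := by
      rw [(hC 1).contDiffAt.pd_comm, hS]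
    have e2 := hL 0 x
    have e3 := h.lap_eq x
    rw [lap_eq_pd] at e2 e3
    rw [e1, hS]
    linear_combination e2 - pd 0 U x * e3
  · rw [hPd, hQd]
    have e1 : pd 1 (pd 0 (pd 0 U)) x = pd 0 (pd 1 (pd 0 U)) x := (hC 0).contDiffAt.pd_comm 0 1
    have e2 := hL 1 x
    have e3 := h.lap_eq x
    rw [lap_eq_pd] at e2 e3
    rw [hS] at e2
    rw [e1, hS]
    linear_combination -e2 + pd 1 U x * e3
  · have := ((h.tendsto_pd_pd 0 0).sub (h.tendsto_pd_pd 1 1)).sub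
      ((((h.tendsto_pd 0).mul (h.tendsto_pd 0)).sub
        ((h.tendsto_pd 1).mul (h.tendsto_pd 1))).const_mul (1 / 2))
    simpa using this
  · have := ((h.tendsto_pd 0).mul (h.tendsto_pd 1)).sub ((h.tendsto_pd_pd 0 1).const_mul 2)
    simpa using this

/-- Classification of the finite-mass solutions of the Liouville equation. -/
theorem eq_stdBubble (h : LiouvilleSol U C) : U = stdBubble := by
  have hC := fun i => (h.contDiff_pd_and_lap i).1
  have hd : ∀ i, Differentiable ℝ (pd i U) := fun i => (hC i).differentiable (by norm_num)
  have hUd : Differentiable ℝ U := h.contDiff.differentiable (by norm_num)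
  obtain ⟨hP, hQ⟩ := h.quadraticDifferential_eq_zero
  set w : R2 → ℝ := fun x => exp (-(1 / 2) * U x) with hw
  have hwC : ContDiff ℝ 2 w := Real.contDiff_exp.comp (contDiff_const.mul h.contDiff)
  have hwd : Differentiable ℝ w := hwC.differentiable (by norm_num)
  have hder : ∀ t : ℝ, HasDerivAt (fun t => exp (-(1 / 2) * t)) (-(1 / 2) * exp (-(1 / 2) * t)) t :=
    fun t => by
      have := ((hasDerivAt_id t).const_mul (-(1 / 2 : ℝ))).exp
      simpa [mul_comm] using this
  have hpd : ∀ i, pd i w = fun x => -(1 / 2) * (w x * pd i U x) := fun i => funext fun x => by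
    rw [hw, pd_comp (hder (U x)) (hUd x)]
    ring
  have hpdd : ∀ i j x, pd j (pd i w) x =
      -(1 / 2) * w x * (pd j (pd i U) x - 1 / 2 * (pd i U x * pd j U x)) := by
    intro i j x
    have hA : Differentiable ℝ fun x => w x * pd i U x := hwd.mul (hd i)
    rw [hpd i, pd_const_mul (hA x), pd_mul (hwd x) (hd i x), hpd j]
    ring
  have hfd0 : fderiv ℝ U 0 = 0 :=
    IsLocalMax.fderiv_eq_zero (Eventually.of_forall fun x => by
      rw [h.zero]
      exact h.nonpos x)
  have hpd0 : ∀ i, pd i U 0 = 0 := fun i => by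
    unfold pd
    rw [hfd0]
    rfl
  have hw0 : w 0 = 1 := by simp [hw, h.zero]
  have key := eq_quadratic_of_hessian hwC (fun i => by
      rw [hpd]
      exact contDiff_const.mul (hwC.mul (hC i)))
    (fun i => by simp [hpd, hpd0])
    (fun x => by
      rw [hpdd]
      linear_combination 1 / 4 * w x * hQ x)
    (fun x => by
      rw [hpdd, hpdd]
      linear_combination -(1 / 2) * w x * hP x)
  have hlap : lap w 0 = 1 / 2 := by
    have := h.lap_eq 0
    rw [lap_eq_pd, h.zero, Real.exp_zero] at this
    rw [lap_eq_pd, hpdd, hpdd, hpd0, hpd0, hw0]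
    linarith
  funext x
  have hx := key x
  rw [hw0, hlap] at hx
  have : w x = 1 + ‖x‖ ^ 2 / 8 := by linarith
  unfold stdBubble
  rw [← this, hw, Real.log_exp]
  ring

end LiouvilleSol

section
variable {ι F : Type*} [NormedAddCommGroup F] {l : Filter ι} {G : ι → R2 → F} {g : R2 → F}

lemma UTendsto.of_ultrafilter (h : ∀ 𝒰 : Ultrafilter ι, (𝒰 : Filter ι) ≤ l → UTendsto 𝒰 G g) :
    UTendsto l G g := fun R ε hε =>
  Filter.mem_iff_ultrafilter.2 fun 𝒰 h𝒰 => h 𝒰 h𝒰 R ε hε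

lemma UTendsto.tendstoUniformlyOn_of_norm_le {F' : Type*} [NormedAddCommGroup F']
    {H : ι → R2 → F'} {h : R2 → F'} (hG : UTendsto l G g)
    (hle : ∀ i x, ‖H i x - h x‖ ≤ ‖G i x - g x‖) {K : Set R2} (hK : IsCompact K) :
    TendstoUniformlyOn H h l K := by
  obtain ⟨R, hR⟩ := hK.isBounded.subset_closedBall (0 : R2)
  rw [Metric.tendstoUniformlyOn_iff]
  intro ε hε
  filter_upwards [hG R (ε / 2) (by positivity)] with i hi x hx
  rw [dist_comm, dist_eq_norm]
  linarith [hle i x, hi x (hR hx)]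

end

lemma norm_iteratedFDeriv_zero_sub_le (f g : R2 → ℝ) (x : R2) :
    ‖iteratedFDeriv ℝ 0 f x - iteratedFDeriv ℝ 0 g x‖ ≤ ‖f x - g x‖ :=
  ContinuousMultilinearMap.opNorm_le_bound (norm_nonneg _) fun m => by
    simp

lemma norm_iteratedFDeriv_one_sub_le (f g : R2 → ℝ) (x : R2) :
    ‖iteratedFDeriv ℝ 1 f x - iteratedFDeriv ℝ 1 g x‖ ≤ ‖fderiv ℝ f x - fderiv ℝ g x‖ :=
  ContinuousMultilinearMap.opNorm_le_bound (norm_nonneg _) fun m => by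
    have := (fderiv ℝ f x - fderiv ℝ g x).le_opNorm (m 0)
    simpa using this

lemma norm_iteratedFDeriv_two_sub_le (f g : R2 → ℝ) (x : R2) :
    ‖iteratedFDeriv ℝ 2 f x - iteratedFDeriv ℝ 2 g x‖
      ≤ ‖fderiv ℝ (fderiv ℝ f) x - fderiv ℝ (fderiv ℝ g) x‖ :=
  ContinuousMultilinearMap.opNorm_le_bound (ContinuousLinearMap.opNorm_nonneg _) fun m => by
    have := (fderiv ℝ (fderiv ℝ f) x - fderiv ℝ (fderiv ℝ g) x).le_opNorm₂ (m 0) (m 1)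
    rw [sub_apply, iteratedFDeriv_two_apply, iteratedFDeriv_two_apply,
      Fin.prod_univ_two, ← mul_assoc]
    exact this

lemma stdBubble_nonpos (x : R2) : stdBubble x ≤ 0 := by
  have : 0 ≤ Real.log (1 + ‖x‖ ^ 2 / 8) := Real.log_nonneg (by linarith [sq_nonneg ‖x‖])
  unfold stdBubble
  linarith

lemma stdBubble_zero : stdBubble 0 = 0 := by simp [stdBubble]

lemma exp_stdBubble (x : R2) : exp (stdBubble x) = ((1 + ‖x‖ ^ 2 / 8) ^ 2)⁻¹ := by
  have h : 0 < 1 + ‖x‖ ^ 2 / 8 := by positivity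
  rw [stdBubble, neg_mul, Real.exp_neg, show (2 : ℝ) = ((2 : ℕ) : ℝ) by norm_num, Real.exp_nat_mul,
    Real.exp_log h]

lemma lap_stdBubble (x : R2) : -lap stdBubble x = exp (stdBubble x) := by
  have hx : (-8 : ℝ) < ‖x‖ ^ 2 := by linarith [sq_nonneg ‖x‖]
  have hin : ∀ t : ℝ, HasDerivAt (fun t : ℝ => 1 + t / 8) (1 / 8) t := fun t =>
    ((hasDerivAt_id t).div_const 8).const_add 1
  have h1 : ∀ t : ℝ, -8 < t → HasDerivAt (fun t : ℝ => -2 * Real.log (1 + t / 8))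
      (-2 * (8 + t)⁻¹) t := by
    intro t ht
    refine (((hin t).log (by linarith)).const_mul (-2)).congr_deriv ?_
    have : 8 + t ≠ 0 := by linarith
    field_simp
  have h2 : HasDerivAt (fun t : ℝ => -2 * (8 + t)⁻¹) (2 / (8 + ‖x‖ ^ 2) ^ 2) (‖x‖ ^ 2) := by
    have h3 : HasDerivAt (fun t : ℝ => 8 + t) 1 (‖x‖ ^ 2) := (hasDerivAt_id _).const_add 8
    refine ((h3.fun_inv (by linarith)).const_mul (-2)).congr_deriv ?_
    ring
  rw [exp_stdBubble]
  have : lap stdBubble x = _ := lap_radial ((lt_mem_nhds hx).mono h1) h2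
  rw [this]
  have : 0 < 8 + ‖x‖ ^ 2 := by linarith
  field_simp
  ring

lemma integral_exp_stdBubble : ∫ x : R2, exp (stdBubble x) = 8 * π := by
  have hder : ∀ r : ℝ, HasDerivAt (fun r : ℝ => -4 * (1 + r ^ 2 / 8)⁻¹)
      (r * ((1 + r ^ 2 / 8) ^ 2)⁻¹) r := by
    intro r
    have h3 : HasDerivAt (fun r : ℝ => 1 + r ^ 2 / 8) (2 * r / 8) r := by
      simpa using (((hasDerivAt_id r).pow 2).div_const 8).const_add 1
    refine ((h3.fun_inv (by positivity)).const_mul (-4)).congr_deriv ?_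
    field_simp
    ring
  have hlim : Tendsto (fun r : ℝ => -4 * (1 + r ^ 2 / 8)⁻¹) atTop (𝓝 (-4 * 0)) := by
    refine Tendsto.const_mul _ (Tendsto.inv_tendsto_atTop ?_)
    exact tendsto_atTop_add_const_left _ _
      ((tendsto_pow_atTop (by norm_num)).atTop_div_const (by norm_num))
  have hgint : ∫ r in Ioi (0 : ℝ), r * ((1 + r ^ 2 / 8) ^ 2)⁻¹ = 4 := by
    rw [integral_Ioi_of_hasDerivAt_of_nonneg' (fun r _ => hder r)
      (fun r hr => mul_nonneg (le_of_lt hr) (by positivity)) hlim]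
    norm_num
  simp only [exp_stdBubble]
  have := integral_fun_norm_addHaar (volume : Measure R2) fun r => ((1 + r ^ 2 / 8) ^ 2)⁻¹
  rw [this]
  simp only [finrank_euclideanSpace, Fintype.card_fin, Nat.add_one_sub_one, pow_one, smul_eq_mul,
    hgint, measureReal_def, EuclideanSpace.volume_ball_fin_two]
  simp [pi_nonneg]
  ring

lemma tendstoC2loc_zp {Ω : Set R2} {u : ℝ → R2 → ℝ} {xp : ℝ → R2} {C : ℝ}
    (hR : ∀ R > 0, ∀ᶠ p in atTop, RescaledOn Ω u xp C R p) :
    TendstoC2loc atTop (fun p : ℝ => {x : R2 | eps u xp p • x + xp p ∈ Ω})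
      (fun p : ℝ => zp u xp p) stdBubble := by
  have hlim : ∀ 𝒰 : Ultrafilter ℝ, (𝒰 : Filter ℝ) ≤ atTop →
      UTendsto (𝒰 : Filter ℝ) (zp u xp) stdBubble ∧
      UTendsto (𝒰 : Filter ℝ) (fun p => fderiv ℝ (zp u xp p)) (fderiv ℝ stdBubble) ∧
      UTendsto (𝒰 : Filter ℝ) (fun p => fderiv ℝ (fderiv ℝ (zp u xp p)))
        (fderiv ℝ (fderiv ℝ stdBubble)) := by
    intro 𝒰 h𝒰
    obtain ⟨U, h1, h2, h3, h4, h5, h6⟩ := exists_limit hR 𝒰 h𝒰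
    have hU := LiouvilleSol.eq_stdBubble ⟨h1, h2, h3, h4, h5⟩
    rwa [hU] at h6
  intro K hK
  refine ⟨?_, fun n hn => ?_⟩
  · obtain ⟨R, hKR⟩ := hK.isBounded.subset_closedBall (0 : R2)
    filter_upwards [hR (max R 1) (by positivity)] with p hp x hx
    exact hp.mem x (closedBall_subset_closedBall (le_max_left _ _) (hKR hx))
  · interval_cases n
    · exact (UTendsto.of_ultrafilter fun 𝒰 h => (hlim 𝒰 h).1).tendstoUniformlyOn_of_norm_le
        (fun p x => norm_iteratedFDeriv_zero_sub_le _ _ x) hK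
    · exact (UTendsto.of_ultrafilter fun 𝒰 h => (hlim 𝒰 h).2.1).tendstoUniformlyOn_of_norm_le
        (fun p x => norm_iteratedFDeriv_one_sub_le _ _ x) hK
    · exact (UTendsto.of_ultrafilter fun 𝒰 h => (hlim 𝒰 h).2.2).tendstoUniformlyOn_of_norm_le
        (fun p x => norm_iteratedFDeriv_two_sub_le _ _ x) hK

theorem stmt8
    (Ω : Set R2) (hne : Ω.Nonempty) (hop : IsOpen Ω)
    (hbdd : Bornology.IsBounded Ω) (hconn : IsConnected Ω) (hsm : SmoothBoundary Ω)
    (u : ℝ → R2 → ℝ)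
    (hsol : ∀ p > (1:ℝ), IsSolution Ω p (u p))
    (hnod : ∀ p > (1:ℝ), IsNodal Ω (u p))
    (xp xm : ℝ → R2)
    (hxpmem : ∀ p > (1:ℝ), xp p ∈ Ω)
    (hxpmax : ∀ p > (1:ℝ), ∀ x ∈ Ω, u p x ≤ u p (xp p))
    (hxmmem : ∀ p > (1:ℝ), xm p ∈ Ω)
    (hxmmin : ∀ p > (1:ℝ), ∀ x ∈ Ω, u p (xm p) ≤ u p x)
    (hcomp : ∀ p > (1:ℝ), -u p (xm p) ≤ u p (xp p))
    (hA : CondA Ω u) :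
    TendstoC2loc atTop (fun p : ℝ => {x : R2 | eps u xp p • x + xp p ∈ Ω})
      (fun p : ℝ => zp u xp p) stdBubble ∧
    (∀ x : R2, -lap stdBubble x = Real.exp (stdBubble x)) ∧
    (∀ x : R2, stdBubble x ≤ 0) ∧
    stdBubble 0 = 0 ∧
    (∫ x : R2, Real.exp (stdBubble x)) = 8 * π := by
  have hpos : ∀ p > (1 : ℝ), 0 < u p (xp p) := fun p hp => by
    obtain ⟨x, hx, hux⟩ := (hnod p hp).1
    exact hux.trans_le (hxpmax p hp x hx)
  have hum : ∀ p > (1 : ℝ), ∀ x ∈ Ω, |u p x| ≤ u p (xp p) := fun p hp x hx =>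
    abs_le.2 ⟨by linarith [hxmmin p hp x hx, hcomp p hp], hxpmax p hp x hx⟩
  obtain ⟨C, hC⟩ := exists_eventually_rescaledOn hop hbdd hsm hsol hxpmem hpos hum hA
  exact ⟨tendstoC2loc_zp hC, lap_stdBubble, stdBubble_nonpos, stdBubble_zero,
    integral_exp_stdBubble⟩
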